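/- arXiv:2508.20509 — 3 statements merged into one kernel-verified Lean document; each statement's English description precedes it below -/
import Mathlib

section
/- Let q be a power of an odd prime and let n, d, r be integers with 1 ≤ d ≤ n−1 and 0 ≤ r ≤ d. Then the number of irreducible characters of R_u^{U,d} of degree (q²)^{(n−d)r} equals q^{4d(n−d)−4(n−d)r} times the number of skew-Hermitian d×d matrices over 𝔽_{q²} (i.e. matrices C with (C̄)^t = −C) of rank r. Moreover, every irreducible character of R_u^{U,d} has degree (q²)^{(n−d)r} for some integer r with 0 ≤ r ≤ d. -/
open Matrix

namespace UnitaryUnipotentRadical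

/-- Index type for `2n×2n` matrices, split as `d + (n−d) + (n−d) + d`. -/
abbrev κ (n d : ℕ) := (Fin d ⊕ Fin (n - d)) ⊕ (Fin (n - d) ⊕ Fin d)

/-- The `m × m` matrix with `1`'s on the antidiagonal and `0`'s elsewhere. -/
def antidiagMat (F : Type) [Field F] (m : ℕ) : Matrix (Fin m) (Fin m) F :=
  Matrix.of fun i j => if (i : ℕ) + (j : ℕ) = m - 1 then 1 else 0

/-- The antidiagonal matrix `J_{2n}`, written in block form with respect to the
partition `d + (n−d) + (n−d) + d`. -/
def J2n (F : Type) [Field F] (n d : ℕ) : Matrix (κ n d) (κ n d) F :=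
  Matrix.fromBlocks 0
    (Matrix.fromBlocks 0 (antidiagMat F d) (antidiagMat F (n - d)) 0)
    (Matrix.fromBlocks 0 (antidiagMat F (n - d)) (antidiagMat F d) 0) 0

/-- The level of an index with respect to the three-block partition `d + (2n−2d) + d`. -/
def lvl (n d : ℕ) : κ n d → ℕ
  | Sum.inl (Sum.inl _) => 0
  | Sum.inl (Sum.inr _) => 1
  | Sum.inr (Sum.inl _) => 1
  | Sum.inr (Sum.inr _) => 2

/-- `R_u^{U,d}`: elements of `U_{2n}(q²)` of the form `[[I_d, X, Y],[0, I_{2n−2d}, Z],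
[0, 0, I_d]]` with respect to the partition `d + (2n−2d) + d`. -/
def RuU (q : ℕ) (F : Type) [Field F] (n d : ℕ) : Set (Matrix (κ n d) (κ n d) F) :=
  {g | (g.map (fun x => x ^ q))ᵀ * J2n F n d * g = J2n F n d ∧
    (∀ i j, lvl n d j < lvl n d i → g i j = 0) ∧
    (∀ i j, lvl n d i = lvl n d j → g i j = if i = j then 1 else 0)}

/-- `A^U`. -/
def AU (q : ℕ) (F : Type) [Field F] (n d : ℕ) : Set (Matrix (κ n d) (κ n d) F) :=
  {g | ∃ (B1 : Matrix (Fin d) (Fin (n - d)) F) (B2 : Matrix (Fin d) (Fin d) F)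
      (B3 : Matrix (Fin (n - d)) (Fin d) F),
    B1 = -(antidiagMat F d) * (B3.map (fun x => x ^ q))ᵀ * antidiagMat F (n - d) ∧
    B2 = -(antidiagMat F d) * (B2.map (fun x => x ^ q))ᵀ * antidiagMat F d ∧
    g = Matrix.fromBlocks 1 (Matrix.fromBlocks B1 B2 0 B3) 0 1}

/-- `H^U`. -/
def HU (q : ℕ) (F : Type) [Field F] (n d : ℕ) : Set (Matrix (κ n d) (κ n d) F) :=
  {g | ∃ (A1 : Matrix (Fin d) (Fin (n - d)) F) (A2 : Matrix (Fin (n - d)) (Fin d) F),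
    A1 = -(antidiagMat F d) * (A2.map (fun x => x ^ q))ᵀ * antidiagMat F (n - d) ∧
    g = Matrix.fromBlocks (Matrix.fromBlocks 1 A1 0 1) 0 0 (Matrix.fromBlocks 1 A2 0 1)}

end UnitaryUnipotentRadical

/-- Coordinates on a group of nilpotency class at most two, identifying it with `V × S` under
`(v, s) * (w, t) = (v + w, s + t + form v w)` for an alternating form `form`. -/
structure HeisenbergCoord (G V S : Type*) [Group G] [AddCommGroup V] [AddCommGroup S] where
  toEquiv : G ≃ V × S
  form : V →+ V →+ S
  form_self : ∀ v, form v v = 0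
  fst_mul : ∀ g h, (toEquiv (g * h)).1 = (toEquiv g).1 + (toEquiv h).1
  snd_mul : ∀ g h, (toEquiv (g * h)).2 =
    (toEquiv g).2 + (toEquiv h).2 + form (toEquiv g).1 (toEquiv h).1

namespace HeisenbergCoord

open Representation Module

variable {G V S : Type*} [Group G] [AddCommGroup V] [AddCommGroup S] (c : HeisenbergCoord G V S)

/-- The first coordinate. -/
def vec (g : G) : V := (c.toEquiv g).1

/-- The second coordinate. -/
def cen (g : G) : S := (c.toEquiv g).2

/-- The element with given coordinates. -/
def elt (v : V) (s : S) : G := c.toEquiv.symm (v, s)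

@[simp] lemma vec_elt (v : V) (s : S) : c.vec (c.elt v s) = v := by simp [vec, elt]

@[simp] lemma cen_elt (v : V) (s : S) : c.cen (c.elt v s) = s := by simp [cen, elt]

@[simp] lemma elt_vec_cen (g : G) : c.elt (c.vec g) (c.cen g) = g := by simp [vec, cen, elt]

@[simp] lemma vec_mul (g h : G) : c.vec (g * h) = c.vec g + c.vec h := c.fst_mul g h

@[simp] lemma cen_mul (g h : G) : c.cen (g * h) = c.cen g + c.cen h + c.form (c.vec g) (c.vec h) :=
  c.snd_mul g h

lemma ext_coord {g h : G} (h₁ : c.vec g = c.vec h) (h₂ : c.cen g = c.cen h) : g = h :=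
  c.toEquiv.injective (Prod.ext h₁ h₂)

@[simp] lemma vec_one : c.vec 1 = 0 := by simpa using c.vec_mul 1 1

@[simp] lemma cen_one : c.cen 1 = 0 := by simpa using c.cen_mul 1 1

@[simp] lemma vec_inv (g : G) : c.vec g⁻¹ = -c.vec g := by
  rw [eq_neg_iff_add_eq_zero, ← vec_mul, inv_mul_cancel, vec_one]

lemma form_swap (v w : V) : c.form v w = -c.form w v := by
  have := c.form_self (v + w)
  simp only [map_add, AddMonoidHom.add_apply, form_self, zero_add, add_zero] at this
  rwa [eq_neg_iff_add_eq_zero, add_comm]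

lemma mul_eq_central_mul (g h : G) :
    g * h = c.elt 0 (c.form (c.vec g) (c.vec h + c.vec h)) * (h * g) := by
  apply c.ext_coord
  · simp [add_comm]
  · simp [c.form_swap (c.vec h)]
    abel

/-- The radical of the form composed with a character of `S`. -/
def radical (l : AddChar S ℂ) : AddSubgroup V where
  carrier := {v | ∀ w, l (c.form v w) = 1}
  add_mem' {a b} ha hb w := by simp [AddChar.map_add_eq_mul, ha w, hb w]
  zero_mem' w := by simp
  neg_mem' {a} ha w := by simp [AddChar.map_neg_eq_inv, ha w]

lemma mem_radical {l : AddChar S ℂ} {v : V} : v ∈ c.radical l ↔ ∀ w, l (c.form v w) = 1 := Iff.rfl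

/-- The linear character of the preimage of the radical given by characters `l` of `S` and `ν` of
the radical, extended by zero to the whole group. -/
noncomputable def extChar (l : AddChar S ℂ) (ν : AddChar (c.radical l) ℂ) (g : G) : ℂ :=
  open Classical in if h : c.vec g ∈ c.radical l then ν ⟨c.vec g, h⟩ * l (c.cen g) else 0

lemma extChar_of_mem {l : AddChar S ℂ} (ν : AddChar (c.radical l) ℂ) {g : G}
    (h : c.vec g ∈ c.radical l) : c.extChar l ν g = ν ⟨c.vec g, h⟩ * l (c.cen g) := by
  simp [extChar, h]

lemma extChar_of_notMem {l : AddChar S ℂ} (ν : AddChar (c.radical l) ℂ) {g : G}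
    (h : c.vec g ∉ c.radical l) : c.extChar l ν g = 0 := by
  simp [extChar, h]

@[simp] lemma extChar_one (l : AddChar S ℂ) (ν : AddChar (c.radical l) ℂ) :
    c.extChar l ν 1 = 1 := by
  have h : c.vec 1 ∈ c.radical l := by rw [vec_one]; exact zero_mem _
  have h0 : (⟨c.vec 1, h⟩ : c.radical l) = 0 := Subtype.ext c.vec_one
  rw [extChar_of_mem c ν h, h0]
  simp

lemma extChar_mul {l : AddChar S ℂ} (ν : AddChar (c.radical l) ℂ) {g h : G}
    (hg : c.vec g ∈ c.radical l) (hh : c.vec h ∈ c.radical l) :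
    c.extChar l ν (g * h) = c.extChar l ν g * c.extChar l ν h := by
  have hgh : c.vec (g * h) ∈ c.radical l := by rw [vec_mul]; exact add_mem hg hh
  have h0 : (⟨c.vec (g * h), hgh⟩ : c.radical l) = ⟨c.vec g, hg⟩ + ⟨c.vec h, hh⟩ :=
    Subtype.ext (c.vec_mul g h)
  rw [extChar_of_mem c ν hg, extChar_of_mem c ν hh, extChar_of_mem c ν hgh, h0,
    AddChar.map_add_eq_mul, cen_mul, AddChar.map_add_eq_mul, AddChar.map_add_eq_mul, hg]
  ring

lemma extChar_mul_inv {l : AddChar S ℂ} (ν : AddChar (c.radical l) ℂ) {g : G}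
    (hg : c.vec g ∈ c.radical l) : c.extChar l ν g * c.extChar l ν g⁻¹ = 1 := by
  rw [← c.extChar_mul ν hg (by simpa using neg_mem hg), mul_inv_cancel, extChar_one]

lemma extChar_elt_zero {l : AddChar S ℂ} (ν : AddChar (c.radical l) ℂ) (s : S) :
    c.extChar l ν (c.elt 0 s) = l s := by
  have h : c.vec (c.elt 0 s) ∈ c.radical l := by rw [vec_elt]; exact zero_mem _
  have h0 : (⟨c.vec (c.elt 0 s), h⟩ : c.radical l) = 0 := Subtype.ext (c.vec_elt 0 s)
  rw [extChar_of_mem c ν h, h0]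
  simp

lemma extChar_injective : Function.Injective
    fun p : Σ l : AddChar S ℂ, AddChar (c.radical l) ℂ ↦ c.extChar p.1 p.2 := by
  rintro ⟨l, ν⟩ ⟨l', ν'⟩ h
  obtain rfl : l = l' := by
    ext s
    simpa [extChar_elt_zero] using congrFun h (c.elt 0 s)
  congr 1
  ext v
  have h' : c.vec (c.elt v 0) ∈ c.radical l := by rw [vec_elt]; exact v.2
  have h0 : (⟨c.vec (c.elt v 0), h'⟩ : c.radical l) = v := Subtype.ext (c.vec_elt v 0)
  have := congrFun h (c.elt v 0)
  simp only [extChar_of_mem c _ h', h0] at this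
  simpa using this

/-- Conjugation does not change the linear character on the preimage of the radical. -/
lemma extChar_conj {l : AddChar S ℂ} (ν : AddChar (c.radical l) ℂ) (g h : G)
    (hg : c.vec g ∈ c.radical l) : c.extChar l ν (h⁻¹ * g * h) = c.extChar l ν g := by
  have : h⁻¹ * g * h = g * c.elt 0 (c.form (c.vec g) (c.vec h + c.vec h)) := by
    rw [mul_assoc, c.mul_eq_central_mul g h]
    apply c.ext_coord
    · simp
    · simp only [cen_mul, vec_mul, cen_elt, vec_elt, vec_inv]
      have : c.cen (h⁻¹ * h) = 0 := by simp
      simp only [cen_mul, vec_inv] at this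
      simp only [map_neg, AddMonoidHom.neg_apply, form_self, neg_zero, add_zero, zero_add, map_add,
        map_zero, AddMonoidHom.zero_apply] at this ⊢
      rw [eq_neg_of_add_eq_zero_left this, c.form_swap (c.vec h) (c.vec g)]
      abel
  rw [this, c.extChar_mul ν hg (by rw [vec_elt]; exact zero_mem _), extChar_elt_zero, hg, mul_one]

/-- The common degree of the irreducible characters over a character of `S`. -/
noncomputable def degree (l : AddChar S ℂ) : ℝ := √((Nat.card V : ℝ) / Nat.card (c.radical l))

variable {W : Type*} [AddCommGroup W] [Module ℂ W]

lemma exists_eq_smul_one {ρ : Representation ℂ G W}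
    (hρ : finrank ℂ (IntertwiningMap ρ ρ) = 1) (f : End ℂ W) (hf : ∀ g, Commute f (ρ g)) :
    ∃ a : ℂ, f = a • 1 := by
  let F : IntertwiningMap ρ ρ := ⟨f, fun g ↦ hf g⟩
  have h1 : (1 : IntertwiningMap ρ ρ) ≠ 0 := by
    intro h
    have : Subsingleton (IntertwiningMap ρ ρ) :=
      ⟨fun a b ↦ by rw [← mul_one a, ← mul_one b, h, mul_zero, mul_zero]⟩
    rw [finrank_zero_of_subsingleton] at hρ
    omega
  obtain ⟨a, ha⟩ := (finrank_eq_one_iff_of_nonzero' _ h1).mp hρ F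
  exact ⟨a, congrArg (fun f : IntertwiningMap ρ ρ ↦ f.toLinearMap) ha.symm⟩

lemma finite_coord [Finite G] (c : HeisenbergCoord G V S) : Finite V ∧ Finite S := by
  have := Finite.of_equiv _ c.toEquiv
  exact ⟨.of_surjective (Prod.fst : V × S → V) Prod.fst_surjective,
    .of_surjective (Prod.snd : V × S → S) Prod.snd_surjective⟩

lemma character_eq [Finite G] [FiniteDimensional ℂ W] {ρ : Representation ℂ G W}
    (hρ : finrank ℂ (IntertwiningMap ρ ρ) = 1) (h2 : ∀ v : V, ∃ w, w + w = v)
    {l : AddChar S ℂ} {ν : AddChar (c.radical l) ℂ}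
    (h : ∀ g, c.vec g ∈ c.radical l → ρ g = c.extChar l ν g • 1) (g : G) :
    ρ.character g = c.degree l * c.extChar l ν g := by
  classical
  have key : ∀ g, ρ.character g = finrank ℂ W * c.extChar l ν g := by
    intro g
    by_cases hg : c.vec g ∈ c.radical l
    · simp [character, h g hg, mul_comm]
    · rw [c.extChar_of_notMem ν hg, mul_zero]
      rw [mem_radical] at hg
      push Not at hg
      obtain ⟨v, hv⟩ := hg
      obtain ⟨w, rfl⟩ := h2 v
      have h1 := c.mul_eq_central_mul g (c.elt w 0)
      rw [vec_elt] at h1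
      have h3 : ρ.character g = l (c.form (c.vec g) (w + w)) * ρ.character g := by
        conv_lhs => rw [← mul_inv_cancel_right g (c.elt w 0), h1]
        rw [mul_assoc, character, map_mul, h _ (by rw [vec_elt]; exact zero_mem _),
          extChar_elt_zero, smul_one_mul, map_smul, smul_eq_mul]
        exact congrArg _ (char_conj ρ g (c.elt w 0))
      have h4 : (l (c.form (c.vec g) (w + w)) - 1) * ρ.character g = 0 := by
        linear_combination -h3
      exact (mul_eq_zero.mp h4).resolve_left (sub_ne_zero.mpr hv)
  have := Fintype.ofFinite G
  obtain ⟨_, _⟩ := c.finite_coord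
  have := invertibleOfNonzero (NeZero.ne (Nat.card G : ℂ))
  have h5 := card_inv_mul_sum_char_mul_char_eq_finrank ρ ρ
  rw [hρ, inv_mul_eq_iff_eq_mul₀ (NeZero.ne _)] at h5
  have h6 : ∀ g, ρ.character g * ρ.character g⁻¹ =
      if c.vec g ∈ c.radical l then (finrank ℂ W : ℂ) ^ 2 else 0 := by
    intro g
    rw [key, key]
    split_ifs with hg
    · linear_combination (finrank ℂ W : ℂ) ^ 2 * c.extChar_mul_inv ν hg
    · simp [c.extChar_of_notMem ν hg]
  have h7 : Nat.card {g // c.vec g ∈ c.radical l} = Nat.card (c.radical l) * Nat.card S := by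
    rw [← Nat.card_prod]
    exact Nat.card_congr ⟨fun g ↦ (⟨c.vec g, g.2⟩, c.cen g),
      fun p ↦ ⟨c.elt p.1 p.2, by rw [vec_elt]; exact p.1.2⟩, fun g ↦ by simp, fun p ↦ by simp⟩
  have h8 : Nat.card G = Nat.card V * Nat.card S := by
    rw [← Nat.card_prod]; exact Nat.card_congr c.toEquiv
  simp only [h6, Finset.sum_ite, Finset.sum_const_zero, add_zero, Finset.sum_const, nsmul_eq_mul,
    ← Fintype.card_subtype, ← Nat.card_eq_fintype_card, h7, h8] at h5
  have h9 : (Nat.card (c.radical l) : ℝ) * (finrank ℂ W) ^ 2 = Nat.card V := by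
    have hS : (Nat.card S : ℂ) ≠ 0 := NeZero.ne _
    have : (Nat.card (c.radical l) : ℂ) * (finrank ℂ W) ^ 2 = Nat.card V := by
      apply mul_right_cancel₀ hS
      push_cast at h5
      linear_combination h5
    exact_mod_cast this
  have hR : (Nat.card (c.radical l) : ℝ) ≠ 0 := NeZero.ne _
  rw [key, degree, ← h9, mul_div_cancel_left₀ _ hR, Real.sqrt_sq (Nat.cast_nonneg _)]
  simp

lemma exists_eq_extChar {ρ : Representation ℂ G W} (hρ : finrank ℂ (IntertwiningMap ρ ρ) = 1) :
    ∃ (l : AddChar S ℂ) (ν : AddChar (c.radical l) ℂ),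
      ∀ g, c.vec g ∈ c.radical l → ρ g = c.extChar l ν g • 1 := by
  have : Nontrivial W := by
    by_contra h
    rw [not_nontrivial_iff_subsingleton] at h
    have : Subsingleton (IntertwiningMap ρ ρ) := ⟨fun a b ↦ by ext v; exact Subsingleton.elim _ _⟩
    rw [finrank_zero_of_subsingleton] at hρ
    omega
  have hinj : Function.Injective fun a : ℂ ↦ a • (1 : End ℂ W) :=
    smul_left_injective ℂ one_ne_zero
  have h1 : ∀ s, ∃ a : ℂ, ρ (c.elt 0 s) = a • 1 := fun s ↦ exists_eq_smul_one hρ _ fun g ↦ by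
    rw [Commute, SemiconjBy, ← map_mul, ← map_mul]
    congr 1
    rw [c.mul_eq_central_mul]
    apply c.ext_coord <;> simp
  choose a ha using h1
  let l : AddChar S ℂ :=
    { toFun := a
      map_zero_eq_one' := hinj <| by
        beta_reduce
        rw [one_smul, ← ha, ← map_one ρ]
        exact congrArg ρ (c.ext_coord (by simp) (by simp))
      map_add_eq_mul' s t := hinj <| by
        simp only [← smul_smul, ← ha]
        rw [← one_mul (ρ (c.elt 0 t)), ← smul_mul_assoc, ← ha, ← map_mul]
        exact congrArg ρ (c.ext_coord (by simp) (by simp)) }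
  have hl : ∀ s, ρ (c.elt 0 s) = l s • 1 := ha
  have h3 : ∀ v : c.radical l, ∃ b : ℂ, ρ (c.elt v 0) = b • 1 :=
    fun v ↦ exists_eq_smul_one hρ _ fun g ↦ by
      rw [Commute, SemiconjBy, ← map_mul, ← map_mul, c.mul_eq_central_mul, map_mul, hl, vec_elt,
        v.2, one_smul, one_mul]
  choose b hb using h3
  let ν : AddChar (c.radical l) ℂ :=
    { toFun := b
      map_zero_eq_one' := hinj <| by
        beta_reduce
        rw [one_smul, ← hb, ← map_one ρ]
        exact congrArg ρ (c.ext_coord (by simp) (by simp))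
      map_add_eq_mul' v w := hinj <| by
        simp only [← smul_smul, ← hb]
        rw [← one_mul (ρ (c.elt w 0)), ← smul_mul_assoc, ← hb, ← map_mul]
        have : c.elt v 0 * c.elt w 0 = c.elt 0 (c.form v w) * c.elt (v + w) 0 :=
          c.ext_coord (by simp) (by simp)
        rw [this, map_mul, hl, v.2, one_smul, one_mul]
        rfl }
  refine ⟨l, ν, fun g hg ↦ ?_⟩
  have h4 : g = c.elt 0 (c.cen g) * c.elt (c.vec g) 0 := c.ext_coord (by simp) (by simp)
  rw [c.extChar_of_mem ν hg]
  conv_lhs => rw [h4, map_mul, hl, hb ⟨c.vec g, hg⟩, smul_mul_smul_comm, one_mul, mul_comm]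
  rfl

end HeisenbergCoord

section IrreducibleCharacters

open Representation Module

/-- Every nonzero subrepresentation of a finite-dimensional representation contains an irreducible
one. -/
lemma Subrepresentation.exists_le_isIrreducible {k G W : Type*} [Field k] [Monoid G]
    [AddCommGroup W] [Module k W] [FiniteDimensional k W] {ρ : Representation k G W}
    (N : Subrepresentation ρ) (hN : N.toSubmodule ≠ ⊥) :
    ∃ M : Subrepresentation ρ, M.toSubmodule ≤ N.toSubmodule ∧
      IsIrreducible M.toRepresentation := by
  obtain ⟨M, ⟨hM, hMN⟩, hmin⟩ := exists_minimalFor_of_wellFoundedLT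
    (fun M : Subrepresentation ρ ↦ M.toSubmodule ≠ ⊥ ∧ M.toSubmodule ≤ N.toSubmodule)
    (fun M ↦ M.toSubmodule) ⟨N, hN, le_rfl⟩
  refine ⟨M, hMN, ?_⟩
  have hnt : Nontrivial (Subrepresentation M.toRepresentation) := by
    refine ⟨⊥, ⊤, fun h ↦ hM ?_⟩
    have h' : (⊥ : Submodule k M.toSubmodule) = ⊤ := congrArg Subrepresentation.toSubmodule h
    rw [Submodule.eq_bot_iff]
    intro x hx
    have : (⟨x, hx⟩ : M.toSubmodule) ∈ (⊥ : Submodule k M.toSubmodule) := h' ▸ Submodule.mem_top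
    simpa using this
  refine { eq_bot_or_eq_top := fun P ↦ ?_ }
  let P' : Subrepresentation ρ :=
    ⟨P.toSubmodule.map M.toSubmodule.subtype, by
      rintro g _ ⟨v, hv, rfl⟩
      exact ⟨_, P.apply_mem_toSubmodule g hv, rfl⟩⟩
  have hP' : P'.toSubmodule ≤ M.toSubmodule := by
    rintro _ ⟨v, -, rfl⟩
    exact v.2
  by_cases h : P'.toSubmodule = ⊥
  · left
    apply Subrepresentation.toSubmodule_injective
    exact Submodule.map_injective_of_injective M.toSubmodule.subtype_injective
      (h.trans (Submodule.map_bot _).symm)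
  · right
    apply Subrepresentation.toSubmodule_injective
    have := hmin (j := P') ⟨h, hP'.trans hMN⟩ hP'
    refine eq_top_iff.mpr fun v _ ↦ ?_
    obtain ⟨w, hw, hwv⟩ := this v.2
    rwa [← Subtype.ext hwv]

namespace HeisenbergCoord

variable {G V S : Type*} [Group G] [AddCommGroup V] [AddCommGroup S] (c : HeisenbergCoord G V S)

/-- The right regular representation on functions. -/
def rightTranslation (G : Type*) [Group G] : Representation ℂ G (G → ℂ) where
  toFun g := LinearMap.funLeft ℂ ℂ (· * g)
  map_one' := by ext; simp
  map_mul' g h := by ext; simp [mul_assoc]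

/-- The functions on which the preimage of the radical acts by a given linear character. -/
noncomputable def eigenSubrep (l : AddChar S ℂ) (ν : AddChar (c.radical l) ℂ) :
    Subrepresentation (rightTranslation G) where
  toSubmodule :=
    { carrier := {f | ∀ z, c.vec z ∈ c.radical l → ∀ x, f (x * z) = c.extChar l ν z * f x}
      add_mem' {f f'} hf hf' z hz x := by simp [hf z hz, hf' z hz, mul_add]
      zero_mem' := by simp
      smul_mem' a f hf z hz x := by simp [hf z hz]; ring }
  apply_mem_toSubmodule g f hf z hz x := by
    change f (x * z * g) = _ * f (x * g)
    have : x * z * g = x * g * (g⁻¹ * z * g) := by group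
    rw [this, hf _ (by simpa [add_comm] using hz), c.extChar_conj ν z g hz]

lemma exists_irreducible [Finite G] (l : AddChar S ℂ) (ν : AddChar (c.radical l) ℂ) :
    ∃ (W : Submodule ℂ (G → ℂ)) (ρ : Representation ℂ G W), IsIrreducible ρ ∧
      ∀ g, c.vec g ∈ c.radical l → ρ g = c.extChar l ν g • 1 := by
  have hne : (c.eigenSubrep l ν).toSubmodule ≠ ⊥ := by
    rw [Submodule.ne_bot_iff]
    refine ⟨c.extChar l ν, fun z hz x ↦ ?_, fun h ↦ by simpa using congrFun h 1⟩
    by_cases hx : c.vec x ∈ c.radical l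
    · rw [c.extChar_mul ν hx hz, mul_comm]
    · rw [c.extChar_of_notMem ν hx, c.extChar_of_notMem ν, mul_zero]
      rwa [vec_mul, AddSubgroup.add_mem_cancel_right _ hz]
  obtain ⟨M, hM, hirr⟩ := (c.eigenSubrep l ν).exists_le_isIrreducible hne
  refine ⟨M.toSubmodule, M.toRepresentation, hirr, fun g hg ↦ ?_⟩
  ext f x
  exact hM f.2 g hg x

lemma simple_iff_finrank_intertwiningMap {G : Type} [Group G] [Finite G] (V : FDRep ℂ G) :
    CategoryTheory.Simple V ↔ finrank ℂ (IntertwiningMap V.ρ V.ρ) = 1 := by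
  have := Fintype.ofFinite G
  have := invertibleOfNonzero (NeZero.ne (Nat.card G : ℂ))
  rw [FDRep.simple_iff_char_is_norm_one]
  have h : (Nat.card G : ℂ)⁻¹ * ∑ g : G, V.character g * V.character g⁻¹ =
      finrank ℂ (IntertwiningMap V.ρ V.ρ) :=
    card_inv_mul_sum_char_mul_char_eq_finrank V.ρ V.ρ
  rw [inv_mul_eq_iff_eq_mul₀ (NeZero.ne _)] at h
  rw [h, mul_eq_left₀ (NeZero.ne _), Nat.cast_eq_one]

/-- The irreducible characters of a group with Heisenberg coordinates. -/
theorem isSimple_character_iff {G V S : Type} [Group G] [Finite G] [AddCommGroup V] [AddCommGroup S]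
    (c : HeisenbergCoord G V S) (h2 : ∀ v : V, ∃ w, w + w = v) (χ : G → ℂ) :
    (∃ W : FDRep ℂ G, CategoryTheory.Simple W ∧ W.character = χ) ↔
      ∃ p : Σ l : AddChar S ℂ, AddChar (c.radical l) ℂ,
        χ = (c.degree p.1 : ℂ) • c.extChar p.1 p.2 := by
  constructor
  · rintro ⟨W, hW, rfl⟩
    rw [simple_iff_finrank_intertwiningMap] at hW
    obtain ⟨l, ν, h⟩ := c.exists_eq_extChar hW
    exact ⟨⟨l, ν⟩, funext (c.character_eq hW h2 h)⟩
  · rintro ⟨⟨l, ν⟩, rfl⟩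
    obtain ⟨W, ρ, hρ, h⟩ := c.exists_irreducible l ν
    have hρ' := IsIrreducible.finrank_intertwiningMap_self ρ
    exact ⟨FDRep.of ρ, (simple_iff_finrank_intertwiningMap _).mpr hρ',
      funext (c.character_eq hρ' h2 h)⟩

lemma degree_pos [Finite G] (l : AddChar S ℂ) : 0 < c.degree l := by
  obtain ⟨_, _⟩ := c.finite_coord
  exact Real.sqrt_pos.mpr (div_pos (Nat.cast_pos.mpr Nat.card_pos) (Nat.cast_pos.mpr Nat.card_pos))

/-- The number of irreducible characters of given degree of a group with Heisenberg coordinates. -/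
theorem natCard_character_degree_eq {G V S : Type} [Group G] [Finite G] [AddCommGroup V]
    [AddCommGroup S] (c : HeisenbergCoord G V S) (h2 : ∀ v : V, ∃ w, w + w = v) (N : ℝ) :
    Nat.card {χ : G → ℂ | (∃ W : FDRep ℂ G, CategoryTheory.Simple W ∧ W.character = χ) ∧ χ 1 = N} =
      Nat.card (Σ l : {l : AddChar S ℂ // c.degree l = N}, c.radical l.1) := by
  obtain ⟨_, _⟩ := c.finite_coord
  have hcard : ∀ l : {l : AddChar S ℂ // c.degree l = N},
      Nat.card (c.radical l.1) = Nat.card (AddChar (c.radical l.1) ℂ) := fun l ↦ by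
    have := Fintype.ofFinite (c.radical l.1)
    rw [Nat.card_eq_fintype_card, Nat.card_eq_fintype_card, AddChar.card_eq]
  rw [Nat.card_sigma, Finset.sum_congr rfl fun l _ ↦ hcard l, ← Nat.card_sigma]
  symm
  refine Nat.card_eq_of_bijective
    (fun p : Σ l : {l : AddChar S ℂ // c.degree l = N}, AddChar (c.radical l.1) ℂ ↦
      ⟨(N : ℂ) • c.extChar p.1.1 p.2, ?_, ?_⟩) ⟨?_, ?_⟩
  · exact (c.isSimple_character_iff h2 _).mpr ⟨⟨p.1.1, p.2⟩, by rw [p.1.2]⟩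
  · simp
  · rintro ⟨⟨l, hl⟩, ν⟩ ⟨⟨l', hl'⟩, ν'⟩ h
    have hN : (N : ℂ) ≠ 0 := by
      rw [← hl]; exact_mod_cast (c.degree_pos l).ne'
    have h1 := smul_right_injective _ hN (congrArg Subtype.val h)
    have h3 := c.extChar_injective (a₁ := ⟨l, ν⟩) (a₂ := ⟨l', ν'⟩) h1
    cases h3
    rfl
  · rintro ⟨χ, hχ, h1⟩
    obtain ⟨⟨l, ν⟩, rfl⟩ := (c.isSimple_character_iff h2 χ).mp hχ
    have hl : c.degree l = N := by
      simpa using h1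
    exact ⟨⟨⟨l, hl⟩, ν⟩, by simp [hl]⟩

end HeisenbergCoord

end IrreducibleCharacters

namespace SkewHermitianForm

variable {F : Type*} [Field F] {m ι : Type*} [Fintype ι]

lemma eq_zero_of_forall_trace_mul [Fintype m] {φ : AddChar F ℂ} (hφ : φ ≠ 1) (C : Matrix m ι F)
    (h : ∀ M : Matrix ι m F, φ (trace (C * M)) = 1) : C = 0 := by
  classical
  obtain ⟨a, ha⟩ := AddChar.ne_one_iff.mp hφ
  ext i j
  by_contra hC
  apply ha
  have := h (Matrix.single j i (a / C i j))
  rwa [trace_mul_comm, trace_single_mul, smul_eq_mul, div_mul_cancel₀ _ hC] at this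

lemma natCard_mul_eq_zero [Fintype m] [Fintype F] (C : Matrix m m F) :
    Nat.card {X : Matrix m ι F // C * X = 0} =
      Fintype.card F ^ ((Fintype.card m - C.rank) * Fintype.card ι) := by
  classical
  have e : {X : Matrix m ι F // C * X = 0} ≃ (ι → LinearMap.ker C.mulVecLin) :=
    { toFun X j := ⟨X.1.col j, by
        rw [LinearMap.mem_ker, mulVecLin_apply]
        ext i
        exact congrFun (congrFun X.2 i) j⟩
      invFun f := ⟨of fun i j ↦ (f j).1 i, by
        ext i j
        exact congrFun (f j).2 i⟩
      left_inv X := rfl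
      right_inv f := rfl }
  have hk : Module.finrank F (LinearMap.ker C.mulVecLin) = Fintype.card m - C.rank := by
    have := LinearMap.finrank_range_add_finrank_ker C.mulVecLin
    rw [Module.finrank_fintype_fun_eq_card] at this
    rw [Matrix.rank]
    omega
  rw [Nat.card_congr e, Nat.card_fun, Module.natCard_eq_pow_finrank (K := F), hk, pow_mul]
  simp

variable [StarRing F]

lemma star_two_inv : star (2⁻¹ : F) = 2⁻¹ := by
  rw [star_inv₀, star_ofNat]

lemma smul_sub_mem_skewAdjoint {K : Matrix ι ι F} (hK : K.IsHermitian) (X X' : Matrix m ι F) :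
    (2⁻¹ : F) • (X' * K * Xᴴ - X * K * X'ᴴ) ∈ skewAdjoint (Matrix m m F) := by
  rw [skewAdjoint.mem_iff, star_eq_conjTranspose]
  simp only [conjTranspose_smul, star_two_inv, conjTranspose_sub, conjTranspose_mul,
    conjTranspose_conjTranspose, hK.eq, ← smul_neg, neg_sub, Matrix.mul_assoc]

/-- The biadditive alternating form attached to the Hermitian form with Gram matrix `K`. -/
def skewForm {K : Matrix ι ι F} (hK : K.IsHermitian) :
    Matrix m ι F →+ Matrix m ι F →+ skewAdjoint (Matrix m m F) :=
  AddMonoidHom.mk' (fun X ↦ AddMonoidHom.mk'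
    (fun X' ↦ ⟨(2⁻¹ : F) • (X' * K * Xᴴ - X * K * X'ᴴ), smul_sub_mem_skewAdjoint hK X X'⟩)
    fun X' X'' ↦ Subtype.ext <| by
      simp only [AddSubgroup.coe_add, conjTranspose_add, Matrix.add_mul, Matrix.mul_add,
        ← smul_add]
      congr 1; abel)
    fun X X' ↦ AddMonoidHom.ext fun X'' ↦ Subtype.ext <| by
      simp only [AddMonoidHom.mk'_apply, AddMonoidHom.add_apply, AddSubgroup.coe_add,
        conjTranspose_add, Matrix.add_mul, Matrix.mul_add, ← smul_add]
      congr 1; abel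

lemma coe_skewForm {K : Matrix ι ι F} (hK : K.IsHermitian) (X X' : Matrix m ι F) :
    (skewForm hK X X' : Matrix m m F) = (2⁻¹ : F) • (X' * K * Xᴴ - X * K * X'ᴴ) := rfl

/-- Every finite field of odd characteristic with involution has a nontrivial invariant additive
character. -/
lemma exists_star_invariant_addChar [Finite F] (h2 : (2 : F) ≠ 0) :
    ∃ φ : AddChar F ℂ, (∀ x, φ (star x) = φ x) ∧ φ ≠ 1 := by
  obtain ⟨ψ, hψ⟩ := AddChar.exists_apply_ne_zero.mpr h2
  refine ⟨ψ.compAddMonoidHom (AddMonoidHom.mk' (fun x ↦ x + star x) fun x y ↦ by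
    rw [star_add]; abel), fun x ↦ ?_, fun h ↦ hψ ?_⟩
  · simp [add_comm]
  · have := DFunLike.congr_fun h 1
    simpa [one_add_one_eq_two] using this

/-- The additive character of the skew-Hermitian matrices attached to a matrix. -/
def traceChar [Fintype m] (φ : AddChar F ℂ) (C : Matrix m m F) :
    AddChar (skewAdjoint (Matrix m m F)) ℂ :=
  φ.compAddMonoidHom
    (AddMonoidHom.mk' (fun s : skewAdjoint (Matrix m m F) ↦ trace (C * (s : Matrix m m F)))
      fun s t ↦ by simp [Matrix.mul_add])

lemma traceChar_apply [Fintype m] (φ : AddChar F ℂ) (C : Matrix m m F)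
    (s : skewAdjoint (Matrix m m F)) :
    traceChar φ C s = φ (trace (C * (s : Matrix m m F))) := rfl

lemma traceChar_skewForm [Fintype m] {φ : AddChar F ℂ}
    (hφ : ∀ x, φ (star x) = φ x) (h2 : (2 : F) ≠ 0)
    {K : Matrix ι ι F} (hK : K.IsHermitian) {C : Matrix m m F}
    (hC : C ∈ skewAdjoint (Matrix m m F)) (X X' : Matrix m ι F) :
    traceChar φ C (skewForm hK X X') = φ (trace (C * X * K * (-X')ᴴ)) := by
  rw [skewAdjoint.mem_iff, star_eq_conjTranspose] at hC
  have h1 : trace (C * (X' * K * Xᴴ)) = star (-trace (C * (X * K * X'ᴴ))) := by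
    rw [star_neg, ← trace_conjTranspose]
    simp only [conjTranspose_mul, conjTranspose_conjTranspose, hK.eq, hC]
    rw [trace_mul_comm]
    simp [Matrix.mul_assoc]
  rw [traceChar_apply, coe_skewForm, Matrix.mul_smul, trace_smul, Matrix.mul_sub, trace_sub, h1]
  set t := trace (C * (X * K * X'ᴴ)) with ht
  have h3 : trace (C * X * K * (-X')ᴴ) = 2⁻¹ * -t + 2⁻¹ * -t := by
    rw [conjTranspose_neg, Matrix.mul_neg, trace_neg, ht]
    simp only [Matrix.mul_assoc]
    field_simp
    ring
  have h4 : φ (2⁻¹ * star (-t)) = φ (2⁻¹ * -t) := by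
    rw [← hφ (2⁻¹ * star (-t)), star_mul', star_star, star_two_inv]
  rw [h3, AddChar.map_add_eq_mul, smul_eq_mul, mul_sub, sub_eq_add_neg, AddChar.map_add_eq_mul, h4,
    mul_neg]

lemma forall_traceChar_skewForm_eq_one_iff [Fintype m] [DecidableEq ι] {φ : AddChar F ℂ}
    (hφ : ∀ x, φ (star x) = φ x) (hφ1 : φ ≠ 1) (h2 : (2 : F) ≠ 0)
    {K : Matrix ι ι F} (hK : K.IsHermitian) (hK2 : K * K = 1)
    {C : Matrix m m F} (hC : C ∈ skewAdjoint (Matrix m m F)) (X : Matrix m ι F) :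
    (∀ X', traceChar φ C (skewForm hK X X') = 1) ↔ C * X = 0 := by
  simp only [traceChar_skewForm hφ h2 hK hC]
  constructor
  · intro h
    have h1 : C * X * K = 0 := eq_zero_of_forall_trace_mul hφ1 _ fun M ↦ by simpa using h (-Mᴴ)
    rw [← Matrix.mul_one (C * X), ← hK2, ← Matrix.mul_assoc, h1, Matrix.zero_mul]
  · intro h X'
    simp [h]

lemma traceChar_bijective [Fintype m] [DecidableEq m] [Finite F] {φ : AddChar F ℂ}
    (hφ : ∀ x, φ (star x) = φ x) (hφ1 : φ ≠ 1) (h2 : (2 : F) ≠ 0) :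
    Function.Bijective fun C : skewAdjoint (Matrix m m F) ↦ traceChar φ (C : Matrix m m F) := by
  classical
  have := Fintype.ofFinite (skewAdjoint (Matrix m m F))
  rw [Fintype.bijective_iff_injective_and_card, AddChar.card_eq]
  refine ⟨fun C C' h ↦ ?_, rfl⟩
  rw [← sub_eq_zero]
  apply Subtype.ext
  have hD := (C - C').2
  have key : ∀ s, traceChar φ ((C - C' : skewAdjoint (Matrix m m F)) : Matrix m m F) s = 1 := by
    intro s
    have := DFunLike.congr_fun h s
    simp only [traceChar_apply] at this
    rw [traceChar_apply, AddSubgroup.coe_sub, Matrix.sub_mul, trace_sub, AddChar.map_sub_eq_div,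
      this, div_self (φ.val_isUnit _).ne_zero]
  have h1 := (forall_traceChar_skewForm_eq_one_iff hφ hφ1 h2 (K := (1 : Matrix m m F))
    isHermitian_one (one_mul 1) hD 1).mp fun X' ↦ key _
  simpa using h1

end SkewHermitianForm

namespace UnitaryUnipotentRadical

section Unipotent

variable {F : Type} [Field F] {n d : ℕ}

lemma antidiagMat_apply (m : ℕ) (i j : Fin m) :
    antidiagMat F m i j = if j = i.rev then 1 else 0 := by
  have : (i : ℕ) + j = m - 1 ↔ j = i.rev := by
    rw [Fin.ext_iff, Fin.val_rev]
    omega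
  simp [antidiagMat, this]

lemma antidiagMat_mul_self (m : ℕ) : antidiagMat F m * antidiagMat F m = 1 := by
  ext i j
  rw [mul_apply, Finset.sum_eq_single i.rev]
  · simp [antidiagMat_apply, one_apply, eq_comm]
  · intro x _ hx
    rw [antidiagMat_apply, if_neg hx, zero_mul]
  · simp

lemma antidiagMat_mul_cancel {ι : Type*} (m : ℕ) (A : Matrix (Fin m) ι F) :
    antidiagMat F m * (antidiagMat F m * A) = A := by
  rw [← Matrix.mul_assoc, antidiagMat_mul_self, Matrix.one_mul]

lemma conjTranspose_antidiagMat [StarRing F] (m : ℕ) :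
    (antidiagMat F m)ᴴ = antidiagMat F m := by
  ext i j
  have : i = j.rev ↔ j = i.rev := by
    constructor <;> (rintro rfl; simp)
  simp only [conjTranspose_apply, antidiagMat_apply, this]
  split_ifs <;> simp

/-- The Gram matrix of the Hermitian form on the middle block. -/
def middleGram (F : Type) [Field F] (m : ℕ) : Matrix (Fin m ⊕ Fin m) (Fin m ⊕ Fin m) F :=
  fromBlocks 0 (antidiagMat F m) (antidiagMat F m) 0

lemma middleGram_mul_self (m : ℕ) : middleGram F m * middleGram F m = 1 := by
  simp [middleGram, fromBlocks_multiply, antidiagMat_mul_self]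

lemma isHermitian_middleGram [StarRing F] (m : ℕ) : (middleGram F m).IsHermitian := by
  simp [IsHermitian, middleGram, fromBlocks_conjTranspose, conjTranspose_antidiagMat]

/-- The block upper unitriangular matrix with first row of blocks `X₁, X₂, T w` and the last column
of blocks forced by unitarity. -/
def unip [StarRing F] (X₁ X₂ : Matrix (Fin d) (Fin (n - d)) F) (T : Matrix (Fin d) (Fin d) F) :
    Matrix (κ n d) (κ n d) F :=
  fromBlocks (fromBlocks 1 X₁ 0 1)
    (fromBlocks X₂ (T * antidiagMat F d) 0 (-(antidiagMat F (n - d) * X₂ᴴ * antidiagMat F d)))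
    0 (fromBlocks 1 (-(antidiagMat F (n - d) * X₁ᴴ * antidiagMat F d)) 0 1)

lemma unip_mul [StarRing F] (X₁ X₂ X₁' X₂' : Matrix (Fin d) (Fin (n - d)) F)
    (T T' : Matrix (Fin d) (Fin d) F) :
    unip X₁ X₂ T * unip X₁' X₂' T' = unip (X₁ + X₁') (X₂ + X₂')
      (T + T' - (X₁ * antidiagMat F (n - d) * X₂'ᴴ + X₂ * antidiagMat F (n - d) * X₁'ᴴ)) := by
  simp only [unip, fromBlocks_multiply, fromBlocks_add, fromBlocks_inj, Matrix.one_mul,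
    Matrix.mul_one, Matrix.zero_mul, Matrix.mul_zero, zero_add, add_zero, Matrix.mul_neg,
    Matrix.add_mul, Matrix.sub_mul, conjTranspose_add, Matrix.mul_add, Matrix.mul_assoc,
    true_and, and_true]
  refine ⟨add_comm _ _, ⟨add_comm _ _, ?_, ?_⟩, ?_, ?_⟩ <;> abel

lemma unip_inj [StarRing F] {X₁ X₂ X₁' X₂' : Matrix (Fin d) (Fin (n - d)) F}
    {T T' : Matrix (Fin d) (Fin d) F} (h : unip X₁ X₂ T = unip X₁' X₂' T') :
    X₁ = X₁' ∧ X₂ = X₂' ∧ T = T' := by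
  simp only [unip, fromBlocks_inj] at h
  refine ⟨h.1.2.1, h.2.1.1, ?_⟩
  have := congrArg (· * antidiagMat F d) h.2.1.2.1
  simpa [Matrix.mul_assoc, antidiagMat_mul_self] using this

variable [StarRing F]

lemma mem_RuU_iff {q : ℕ} (hstar : ∀ x : F, star x = x ^ q) (g : Matrix (κ n d) (κ n d) F) :
    g ∈ RuU q F n d ↔ ∃ (X₁ X₂ : Matrix (Fin d) (Fin (n - d)) F) (T : Matrix (Fin d) (Fin d) F),
      g = unip X₁ X₂ T ∧
      X₁ * antidiagMat F (n - d) * X₂ᴴ + X₂ * antidiagMat F (n - d) * X₁ᴴ + (T + Tᴴ) = 0 := by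
  have hconj : (g.map fun x ↦ x ^ q)ᵀ = gᴴ := by
    ext; simp [hstar]
  rw [RuU, Set.mem_ofPred_eq, hconj]
  have hblock : ((∀ i j, lvl n d j < lvl n d i → g i j = 0) ∧
      ∀ i j, lvl n d i = lvl n d j → g i j = if i = j then 1 else 0) ↔
      ∃ (X₁ X₂ : Matrix (Fin d) (Fin (n - d)) F) (T : Matrix (Fin d) (Fin d) F)
        (Z₁ Z₂ : Matrix (Fin (n - d)) (Fin d) F),
        g = fromBlocks (fromBlocks 1 X₁ 0 1) (fromBlocks X₂ (T * antidiagMat F d) 0 Z₁) 0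
          (fromBlocks 1 Z₂ 0 1) := by
    constructor
    · rintro ⟨h1, h2⟩
      refine ⟨g.toBlocks₁₁.toBlocks₁₂, g.toBlocks₁₂.toBlocks₁₁,
        g.toBlocks₁₂.toBlocks₁₂ * antidiagMat F d, g.toBlocks₁₂.toBlocks₂₂,
        g.toBlocks₂₂.toBlocks₁₂, ?_⟩
      rw [Matrix.mul_assoc, antidiagMat_mul_self, Matrix.mul_one]
      ext ((i | i) | (i | i)) ((j | j) | (j | j)) <;>
        first
        | rfl
        | (refine (h1 _ _ ?_).trans ?_ <;> simp [lvl]; done)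
        | (refine (h2 _ _ ?_).trans ?_ <;> simp [lvl, one_apply])
    · rintro ⟨X₁, X₂, T, Z₁, Z₂, rfl⟩
      constructor <;> rintro ((i | i) | (i | i)) ((j | j) | (j | j)) <;> simp [lvl, one_apply]
  rw [hblock]
  have hlast (X : Matrix (Fin d) (Fin (n - d)) F) (Z : Matrix (Fin (n - d)) (Fin d) F) :
      antidiagMat F (n - d) * Z + Xᴴ * antidiagMat F d = 0 ↔
        Z = -(antidiagMat F (n - d) * Xᴴ * antidiagMat F d) := by
    rw [← eq_neg_iff_add_eq_zero]
    constructor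
    · intro h
      rw [← antidiagMat_mul_cancel (n - d) Z, h, Matrix.mul_neg, Matrix.mul_assoc]
    · rintro rfl
      rw [Matrix.mul_neg, Matrix.mul_assoc, antidiagMat_mul_cancel]
  have hunit : ∀ (X₁ X₂ : Matrix (Fin d) (Fin (n - d)) F) (T : Matrix (Fin d) (Fin d) F)
      (Z₁ Z₂ : Matrix (Fin (n - d)) (Fin d) F),
      g = fromBlocks (fromBlocks 1 X₁ 0 1) (fromBlocks X₂ (T * antidiagMat F d) 0 Z₁) 0
        (fromBlocks 1 Z₂ 0 1) →
      (gᴴ * J2n F n d * g = J2n F n d ↔ g = unip X₁ X₂ T ∧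
        X₁ * antidiagMat F (n - d) * X₂ᴴ + X₂ * antidiagMat F (n - d) * X₁ᴴ + (T + Tᴴ) = 0) := by
    rintro X₁ X₂ T Z₁ Z₂ rfl
    simp only [J2n, unip, fromBlocks_conjTranspose, fromBlocks_multiply, fromBlocks_add,
      fromBlocks_inj, Matrix.one_mul, Matrix.mul_one, Matrix.zero_mul, Matrix.mul_zero, zero_add,
      add_zero, conjTranspose_one, conjTranspose_zero, true_and, and_true,
      conjTranspose_mul, conjTranspose_antidiagMat]
    rw [← fromBlocks_zero, fromBlocks_inj, hlast, hlast]
    have hrow : ∀ X : Matrix (Fin d) (Fin (n - d)) F, antidiagMat F d * X +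
        (-(antidiagMat F (n - d) * Xᴴ * antidiagMat F d))ᴴ * antidiagMat F (n - d) = 0 := by
      intro X
      simp [conjTranspose_antidiagMat, Matrix.mul_assoc, antidiagMat_mul_self]
    have hcorner (h₁ : Z₁ = -(antidiagMat F (n - d) * X₂ᴴ * antidiagMat F d))
        (h₂ : Z₂ = -(antidiagMat F (n - d) * X₁ᴴ * antidiagMat F d)) :
        antidiagMat F d * (T * antidiagMat F d) + Z₂ᴴ * antidiagMat F (n - d) * Z₁ +
          (Z₁ᴴ * antidiagMat F (n - d) * Z₂ + antidiagMat F d * Tᴴ * antidiagMat F d) = 0 ↔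
        X₁ * antidiagMat F (n - d) * X₂ᴴ + X₂ * antidiagMat F (n - d) * X₁ᴴ + (T + Tᴴ) = 0 := by
      have hmul : antidiagMat F d * (T * antidiagMat F d) + Z₂ᴴ * antidiagMat F (n - d) * Z₁ +
          (Z₁ᴴ * antidiagMat F (n - d) * Z₂ + antidiagMat F d * Tᴴ * antidiagMat F d) =
          antidiagMat F d * ((X₁ * antidiagMat F (n - d) * X₂ᴴ +
            X₂ * antidiagMat F (n - d) * X₁ᴴ + (T + Tᴴ)) * antidiagMat F d) := by
        subst h₁ h₂
        simp only [conjTranspose_neg, conjTranspose_mul, conjTranspose_conjTranspose,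
          conjTranspose_antidiagMat, Matrix.mul_assoc, Matrix.neg_mul, Matrix.mul_neg, neg_neg,
          Matrix.add_mul, Matrix.mul_add, antidiagMat_mul_cancel]
        abel
      rw [hmul]
      constructor
      · intro h
        have h' := congrArg (fun A ↦ antidiagMat F d * A * antidiagMat F d) h
        simpa only [antidiagMat_mul_cancel, Matrix.mul_assoc, antidiagMat_mul_self,
          Matrix.mul_one, Matrix.mul_zero, Matrix.zero_mul] using h'
      · intro h
        rw [h, Matrix.zero_mul, Matrix.mul_zero]
    constructor
    · rintro ⟨h₂, -, -, h₁, -, h⟩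
      exact ⟨⟨h₁, h₂⟩, (hcorner h₁ h₂).mp h⟩
    · rintro ⟨⟨h₁, h₂⟩, h⟩
      refine ⟨h₂, ?_, rfl, h₁, ?_, (hcorner h₁ h₂).mpr h⟩
      · rw [h₂, hrow]
      · rw [h₁, hrow]
  constructor
  · rintro ⟨h, X₁, X₂, T, Z₁, Z₂, hg⟩
    exact ⟨X₁, X₂, T, (hunit X₁ X₂ T Z₁ Z₂ hg).mp h⟩
  · rintro ⟨X₁, X₂, T, hg, h⟩
    exact ⟨(hunit X₁ X₂ T _ _ hg).mpr ⟨hg, h⟩, X₁, X₂, T, _, _, hg⟩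

end Unipotent

section Coordinates

open SkewHermitianForm

variable {F : Type} [Field F] [StarRing F] {n d : ℕ}

/-- The element of the unipotent radical with Heisenberg coordinates `(X, S)`. -/
def coordMat (X : Matrix (Fin d) (Fin (n - d) ⊕ Fin (n - d)) F)
    (S : Matrix (Fin d) (Fin d) F) : Matrix (κ n d) (κ n d) F :=
  unip X.toCols₁ X.toCols₂ (S - (2⁻¹ : F) • (X * middleGram F (n - d) * Xᴴ))

lemma mul_middleGram_mul_conjTranspose {m : ℕ} (X X' : Matrix (Fin d) (Fin m ⊕ Fin m) F) :
    X * middleGram F m * X'ᴴ =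
      X.toCols₁ * antidiagMat F m * X'.toCols₂ᴴ + X.toCols₂ * antidiagMat F m * X'.toCols₁ᴴ := by
  conv_lhs => rw [← fromCols_toCols X, ← fromCols_toCols X']
  rw [conjTranspose_fromCols_eq_fromRows_conjTranspose, middleGram, fromCols_mul_fromBlocks,
    fromCols_mul_fromRows]
  simp [add_comm]

lemma coordMat_mul (h2 : (2 : F) ≠ 0) (X X' : Matrix (Fin d) (Fin (n - d) ⊕ Fin (n - d)) F)
    (S S' : Matrix (Fin d) (Fin d) F) :
    coordMat X S * coordMat X' S' =
      coordMat (X + X') (S + S' + skewForm (isHermitian_middleGram (n - d)) X X') := by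
  rw [coordMat, coordMat, unip_mul, ← mul_middleGram_mul_conjTranspose, coordMat]
  have h (A : Matrix (Fin d) (Fin d) F) : A = (2⁻¹ : F) • (A + A) := by
    rw [← two_smul F A, smul_smul, inv_mul_cancel₀ h2, one_smul]
  congr 1
  conv_lhs => rw [h (X * middleGram F (n - d) * X'ᴴ)]
  rw [coe_skewForm]
  simp only [conjTranspose_add, Matrix.add_mul, Matrix.mul_add, smul_add, smul_sub]
  abel

lemma coordMat_injective {X X' : Matrix (Fin d) (Fin (n - d) ⊕ Fin (n - d)) F}
    {S S' : Matrix (Fin d) (Fin d) F} (h : coordMat X S = coordMat X' S') : X = X' ∧ S = S' := by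
  obtain ⟨h₁, h₂, h₃⟩ := unip_inj h
  have hX : X = X' := by rw [← fromCols_toCols X, h₁, h₂, fromCols_toCols]
  subst hX
  exact ⟨rfl, sub_left_injective h₃⟩

lemma coordMat_zero : coordMat 0 0 = (1 : Matrix (κ n d) (κ n d) F) := by
  have h₁ : (0 : Matrix (Fin d) (Fin (n - d) ⊕ Fin (n - d)) F).toCols₁ = 0 := rfl
  have h₂ : (0 : Matrix (Fin d) (Fin (n - d) ⊕ Fin (n - d)) F).toCols₂ = 0 := rfl
  simp [coordMat, unip, h₁, h₂]

lemma mem_RuU_iff_exists_coordMat {q : ℕ} (hstar : ∀ x : F, star x = x ^ q) (h2 : (2 : F) ≠ 0)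
    (g : Matrix (κ n d) (κ n d) F) :
    g ∈ RuU q F n d ↔ ∃ (X : Matrix (Fin d) (Fin (n - d) ⊕ Fin (n - d)) F)
      (S : skewAdjoint (Matrix (Fin d) (Fin d) F)), g = coordMat X S := by
  have hH (X : Matrix (Fin d) (Fin (n - d) ⊕ Fin (n - d)) F) :
      (X * middleGram F (n - d) * Xᴴ)ᴴ = X * middleGram F (n - d) * Xᴴ := by
    simp [Matrix.mul_assoc, (isHermitian_middleGram (F := F) (n - d)).eq]
  have h (A : Matrix (Fin d) (Fin d) F) : A = (2⁻¹ : F) • A + (2⁻¹ : F) • A := by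
    rw [← smul_add, ← two_smul F A, smul_smul, inv_mul_cancel₀ h2, one_smul]
  rw [mem_RuU_iff hstar]
  constructor
  · rintro ⟨X₁, X₂, T, rfl, hT⟩
    have hX := mul_middleGram_mul_conjTranspose (fromCols X₁ X₂) (fromCols X₁ X₂)
    rw [toCols₁_fromCols, toCols₂_fromCols] at hX
    rw [← hX] at hT
    refine ⟨fromCols X₁ X₂,
      ⟨T + (2⁻¹ : F) • (fromCols X₁ X₂ * middleGram F (n - d) * (fromCols X₁ X₂)ᴴ), ?_⟩, ?_⟩
    · rw [skewAdjoint.mem_iff, star_eq_conjTranspose, conjTranspose_add, conjTranspose_smul, hH,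
        star_two_inv, eq_neg_iff_add_eq_zero, ← hT]
      conv_rhs => rw [h (fromCols X₁ X₂ * middleGram F (n - d) * (fromCols X₁ X₂)ᴴ)]
      abel
    · simp [coordMat]
  · rintro ⟨X, ⟨S, hS⟩, rfl⟩
    refine ⟨X.toCols₁, X.toCols₂, _, rfl, ?_⟩
    rw [skewAdjoint.mem_iff, star_eq_conjTranspose] at hS
    rw [← mul_middleGram_mul_conjTranspose, conjTranspose_sub, conjTranspose_smul, hH,
      star_two_inv, hS]
    conv_lhs => enter [1]; rw [h (X * middleGram F (n - d) * Xᴴ)]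
    abel

/-- The element of the unipotent radical with given coordinates, as a unit. -/
def coordUnit (h2 : (2 : F) ≠ 0) (X : Matrix (Fin d) (Fin (n - d) ⊕ Fin (n - d)) F)
    (S : Matrix (Fin d) (Fin d) F) : (Matrix (κ n d) (κ n d) F)ˣ where
  val := coordMat X S
  inv := coordMat (-X) (-S)
  val_inv := by
    rw [coordMat_mul h2, coe_skewForm, ← coordMat_zero]
    simp
  inv_val := by
    rw [coordMat_mul h2, coe_skewForm, ← coordMat_zero]
    simp

/-- Heisenberg coordinates on the unipotent radical. -/
noncomputable def heisenbergCoord {q : ℕ} (hstar : ∀ x : F, star x = x ^ q) (h2 : (2 : F) ≠ 0)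
    (G : Subgroup (Matrix (κ n d) (κ n d) F)ˣ)
    (hG : ∀ u : (Matrix (κ n d) (κ n d) F)ˣ,
      u ∈ G ↔ (u : Matrix (κ n d) (κ n d) F) ∈ RuU q F n d) :
    HeisenbergCoord G (Matrix (Fin d) (Fin (n - d) ⊕ Fin (n - d)) F)
      (skewAdjoint (Matrix (Fin d) (Fin d) F)) :=
  let e : Matrix (Fin d) (Fin (n - d) ⊕ Fin (n - d)) F ×
      skewAdjoint (Matrix (Fin d) (Fin d) F) ≃ G :=
    Equiv.ofBijective
      (fun x ↦ ⟨coordUnit h2 x.1 x.2,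
        (hG _).mpr ((mem_RuU_iff_exists_coordMat hstar h2 _).mpr ⟨x.1, x.2, rfl⟩)⟩)
      ⟨fun x y hxy ↦ by
        have h : coordMat x.1 x.2 = coordMat y.1 y.2 :=
          congrArg Units.val (congrArg Subtype.val hxy)
        obtain ⟨h₁, h₂⟩ := coordMat_injective h
        exact Prod.ext h₁ (Subtype.ext h₂),
      fun g ↦ by
        obtain ⟨X, S, h⟩ := (mem_RuU_iff_exists_coordMat hstar h2 _).mp ((hG _).mp g.2)
        exact ⟨(X, S), Subtype.ext (Units.ext h.symm)⟩⟩
  have hmul (g h : G) : e.symm (g * h) = ((e.symm g).1 + (e.symm h).1,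
      (e.symm g).2 + (e.symm h).2 +
        skewForm (isHermitian_middleGram (n - d)) (e.symm g).1 (e.symm h).1) := by
    obtain ⟨x, rfl⟩ := e.surjective g
    obtain ⟨y, rfl⟩ := e.surjective h
    rw [Equiv.symm_apply_eq, Equiv.symm_apply_apply, Equiv.symm_apply_apply]
    exact Subtype.ext (Units.ext (coordMat_mul h2 _ _ _ _))
  { toEquiv := e.symm
    form := skewForm (isHermitian_middleGram (n - d))
    form_self X := Subtype.ext (by simp [coe_skewForm])
    fst_mul g h := congrArg Prod.fst (hmul g h)
    snd_mul g h := congrArg Prod.snd (hmul g h) }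

variable [Fintype F] {q : ℕ} (hstar : ∀ x : F, star x = x ^ q) (h2 : (2 : F) ≠ 0)
    (G : Subgroup (Matrix (κ n d) (κ n d) F)ˣ)
    (hG : ∀ u : (Matrix (κ n d) (κ n d) F)ˣ,
      u ∈ G ↔ (u : Matrix (κ n d) (κ n d) F) ∈ RuU q F n d)
    {φ : AddChar F ℂ}

lemma natCard_radical_traceChar (hφ : ∀ x, φ (star x) = φ x) (hφ1 : φ ≠ 1)
    (C : skewAdjoint (Matrix (Fin d) (Fin d) F)) :
    Nat.card ((heisenbergCoord hstar h2 G hG).radical (traceChar φ C.1)) =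
      Fintype.card F ^ ((d - C.1.rank) * (2 * (n - d))) := by
  have h := natCard_mul_eq_zero (ι := Fin (n - d) ⊕ Fin (n - d)) C.1
  rw [Fintype.card_sum, Fintype.card_fin, Fintype.card_fin, ← two_mul] at h
  rw [← h]
  exact Nat.card_congr (Equiv.subtypeEquivRight
    (forall_traceChar_skewForm_eq_one_iff hφ hφ1 h2 (isHermitian_middleGram (n - d))
      (middleGram_mul_self (n - d)) C.2))

lemma degree_traceChar (hφ : ∀ x, φ (star x) = φ x) (hφ1 : φ ≠ 1)
    (C : skewAdjoint (Matrix (Fin d) (Fin d) F)) :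
    (heisenbergCoord hstar h2 G hG).degree (traceChar φ C.1) =
      (Fintype.card F : ℝ) ^ ((n - d) * C.1.rank) := by
  have hr : C.1.rank ≤ d := by
    simpa using C.1.rank_le_width
  have hF : (Fintype.card F : ℝ) ≠ 0 := by simp
  rw [HeisenbergCoord.degree, natCard_radical_traceChar hstar h2 G hG hφ hφ1]
  have hV : Nat.card (Matrix (Fin d) (Fin (n - d) ⊕ Fin (n - d)) F) =
      Fintype.card F ^ (d * (2 * (n - d))) := by
    unfold Matrix
    simp [two_mul, ← pow_mul, mul_comm d]
  obtain ⟨s, hs⟩ := Nat.exists_eq_add_of_le hr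
  rw [hV, Nat.cast_pow, Nat.cast_pow, Real.sqrt_eq_iff_mul_self_eq (by positivity) (by positivity),
    div_eq_iff (pow_ne_zero _ hF), ← pow_add, ← pow_add]
  congr 1
  rw [show d - C.1.rank = s by omega]
  generalize C.1.rank = t at hs
  generalize n - d = m
  rw [hs]
  ring

end Coordinates

/-- the number of irreducible characters of `R_u^{U,d}` of degree
`(q²)^{(n−d)r}` equals `q^{4d(n−d)−4(n−d)r}` times the number of skew-Hermitian `d×d`
matrices over `F_{q²}` of rank `r`; moreover every irreducible character of `R_u^{U,d}`
has degree `(q²)^{(n−d)r}` for some `0 ≤ r ≤ d`. -/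
theorem ruU_char_count
    (p k q : ℕ) (hp : p.Prime) (hpodd : Odd p) (hk : 1 ≤ k) (hq : q = p ^ k)
    (F : Type) [Field F] [Fintype F] (hF : Fintype.card F = q ^ 2)
    (n d : ℕ) (hd : 1 ≤ d) (hdn : d ≤ n - 1)
    (G : Subgroup (Matrix (κ n d) (κ n d) F)ˣ)
    (hG : ∀ u : (Matrix (κ n d) (κ n d) F)ˣ,
      u ∈ G ↔ (u : Matrix (κ n d) (κ n d) F) ∈ RuU q F n d)
    (r : ℕ) (hr : r ≤ d) :
    Nat.card {χ : ↥G → ℂ |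
        (∃ V : FDRep ℂ ↥G, CategoryTheory.Simple V ∧ FDRep.character V = χ) ∧
        χ 1 = ((q : ℂ) ^ 2) ^ ((n - d) * r)} =
      q ^ (4 * d * (n - d) - 4 * (n - d) * r) *
        Nat.card {M : Matrix (Fin d) (Fin d) F |
          (M.map (fun x => x ^ q))ᵀ = -M ∧ M.rank = r} ∧
    ∀ V : FDRep ℂ ↥G, CategoryTheory.Simple V →
      ∃ r' : ℕ, r' ≤ d ∧ FDRep.character V 1 = ((q : ℂ) ^ 2) ^ ((n - d) * r') := by
  have hcard : Fintype.card F = p ^ (k * 2) := by rw [hF, hq, pow_mul]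
  have : Fact p.Prime := ⟨hp⟩
  have : CharP F p := charP_of_card_eq_prime_pow hcard
  have h2 : (2 : F) ≠ 0 := by
    refine Ring.two_ne_zero ?_
    rw [ringChar.eq F p]
    rintro rfl
    exact absurd hpodd (by decide)
  have hqq (x : F) : (x ^ q) ^ q = x := by
    rw [← pow_mul, ← sq, ← hF, FiniteField.pow_card]
  let _ : StarRing F :=
    { star x := x ^ q
      star_involutive := hqq
      star_mul x y := by rw [mul_comm, mul_pow]
      star_add x y := by rw [hq]; exact add_pow_char_pow x y p k }
  have hstar (x : F) : star x = x ^ q := rfl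
  obtain ⟨φ, hφ, hφ1⟩ := SkewHermitianForm.exists_star_invariant_addChar h2
  have hbij := SkewHermitianForm.traceChar_bijective (m := Fin d) hφ hφ1 h2
  set c := heisenbergCoord hstar h2 G hG with hc
  have hdeg (C : skewAdjoint (Matrix (Fin d) (Fin d) F)) :=
    degree_traceChar hstar h2 G hG hφ hφ1 C
  have hrad (C : skewAdjoint (Matrix (Fin d) (Fin d) F)) :=
    natCard_radical_traceChar hstar h2 G hG hφ hφ1 C
  rw [← hc, hF] at hdeg hrad
  have hdiv (X : Matrix (Fin d) (Fin (n - d) ⊕ Fin (n - d)) F) : ∃ Y, Y + Y = X :=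
    ⟨(2⁻¹ : F) • X, by rw [← smul_add, ← two_smul F X, smul_smul, inv_mul_cancel₀ h2, one_smul]⟩
  have hrank (C : Matrix (Fin d) (Fin d) F) : C.rank ≤ d := by simpa using C.rank_le_width
  have hq1 : 1 < (q : ℝ) ^ 2 := by
    rw [← Nat.cast_pow, Nat.one_lt_cast, ← hF]
    exact Fintype.one_lt_card
  have hm : n - d ≠ 0 := by omega
  constructor
  · have hcount := c.natCard_character_degree_eq hdiv (((q : ℝ) ^ 2) ^ ((n - d) * r))
    push_cast at hcount
    have hdeg_iff (C : skewAdjoint (Matrix (Fin d) (Fin d) F)) :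
        c.degree (SkewHermitianForm.traceChar φ C.1) = ((q : ℝ) ^ 2) ^ ((n - d) * r) ↔
          C.1.rank = r := by
      rw [hdeg, Nat.cast_pow, pow_right_inj₀ (by positivity) hq1.ne', mul_right_inj' hm]
    let e : {M : Matrix (Fin d) (Fin d) F | (M.map (fun x => x ^ q))ᵀ = -M ∧ M.rank = r} ≃
        {l // c.degree l = ((q : ℝ) ^ 2) ^ ((n - d) * r)} :=
      Equiv.ofBijective
        (fun M ↦ ⟨SkewHermitianForm.traceChar φ M.1, (hdeg_iff ⟨M.1, M.2.1⟩).mpr M.2.2⟩)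
        ⟨fun M M' h ↦ by
          have hMM := hbij.1 (a₁ := ⟨M.1, M.2.1⟩) (a₂ := ⟨M'.1, M'.2.1⟩) (congrArg Subtype.val h)
          exact Subtype.ext (Subtype.mk.inj hMM),
        fun ⟨l, hl⟩ ↦ by
          obtain ⟨C, rfl⟩ := hbij.2 l
          exact ⟨⟨C.1, C.2, (hdeg_iff C).mp hl⟩, rfl⟩⟩
    have hexp : (q ^ 2) ^ ((d - r) * (2 * (n - d))) = q ^ (4 * d * (n - d) - 4 * (n - d) * r) := by
      rw [← pow_mul]
      congr 1
      obtain ⟨s, rfl⟩ := Nat.exists_eq_add_of_le hr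
      generalize n - (r + s) = m
      rw [Nat.add_sub_cancel_left]
      refine (Nat.sub_eq_of_eq_add ?_).symm
      ring
    have hfib (M : {M : Matrix (Fin d) (Fin d) F | (M.map (fun x => x ^ q))ᵀ = -M ∧ M.rank = r}) :
        Nat.card (c.radical (e M).1) = q ^ (4 * d * (n - d) - 4 * (n - d) * r) := by
      refine (hrad ⟨M.1, M.2.1⟩).trans (Eq.trans ?_ hexp)
      exact congrArg (fun t ↦ (q ^ 2) ^ ((d - t) * (2 * (n - d)))) M.2.2
    have := Fintype.ofFinite
      {M : Matrix (Fin d) (Fin d) F | (M.map (fun x => x ^ q))ᵀ = -M ∧ M.rank = r}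
    rw [hcount, ← Nat.card_congr (Equiv.sigmaCongrLeft (β := fun l ↦ c.radical l.1) e),
      Nat.card_sigma, Finset.sum_congr rfl fun M _ ↦ hfib M, Finset.sum_const, Finset.card_univ,
      ← Nat.card_eq_fintype_card, smul_eq_mul, mul_comm]
  · intro V hV
    obtain ⟨⟨l, ν⟩, h⟩ := (c.isSimple_character_iff hdiv V.character).mp ⟨V, hV, rfl⟩
    obtain ⟨C, rfl⟩ := hbij.2 l
    refine ⟨C.1.rank, hrank C.1, ?_⟩
    rw [h]
    simp [hdeg]

end UnitaryUnipotentRadical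
end

section
/- Fix integers n, d, e with 1 ≤ d < n and e ≥ 0. Then there exists a polynomial P with non-negative integer coefficients such that for every power q of an odd prime, the number of irreducible characters of R_u^{C,d} (defined over 𝔽_q) of degree q^e equals P(q−1). -/
open Matrix

namespace SpUnipotentRadical

/-- The index type for `n×n` matrices, split as `d + (n−d)`. -/
abbrev ι (n d : ℕ) := Fin d ⊕ Fin (n - d)

/-- The index type for `2n×2n` matrices, split as `n + n`. -/
abbrev κ (n d : ℕ) := ι n d ⊕ ι n d

/-- `U(A) = [[I_d, A],[0, I_{n−d}]]`. -/
def Umat (F : Type) [Field F] (n d : ℕ) (A : Matrix (Fin d) (Fin (n - d)) F) :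
    Matrix (ι n d) (ι n d) F :=
  Matrix.fromBlocks 1 A 0 1

/-- `S_d`: symmetric `n×n` matrices whose lower-right `(n−d)×(n−d)` block is zero. -/
def Sd (F : Type) [Field F] (n d : ℕ) : Set (Matrix (ι n d) (ι n d) F) :=
  {V | Vᵀ = V ∧ ∀ i j, V (Sum.inr i) (Sum.inr j) = 0}

/-- `R_u^{C,d} = { [[U(A), V·U(A)⁻ᵀ],[0, U(A)⁻ᵀ]] | A ∈ Mat_{d×(n−d)}, V ∈ S_d }`. -/
def RuC (F : Type) [Field F] (n d : ℕ) : Set (Matrix (κ n d) (κ n d) F) :=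
  {g | ∃ (A : Matrix (Fin d) (Fin (n - d)) F) (V : Matrix (ι n d) (ι n d) F),
    V ∈ Sd F n d ∧
    g = Matrix.fromBlocks (Umat F n d A) (V * ((Umat F n d A)ᵀ)⁻¹) 0 ((Umat F n d A)ᵀ)⁻¹}

section SymmetricRank

variable {F : Type} [Field F] {d : ℕ}

/-- The symmetric matrix obtained from `X` by adding the last column `v`, the last row `v` and
the corner entry `c`. -/
def bordered (X : Matrix (Fin d) (Fin d) F) (v : Fin d → F) (c : F) :
    Matrix (Fin d ⊕ Unit) (Fin d ⊕ Unit) F :=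
  Matrix.fromBlocks X (Matrix.replicateCol Unit v) (Matrix.replicateRow Unit v)
    (Matrix.of fun _ _ => c)

lemma finrank_ker_add_rank {m : Type} [Fintype m] [DecidableEq m] (M : Matrix m m F) :
    Module.finrank F (LinearMap.ker M.mulVecLin) + M.rank = Fintype.card m := by
  rw [add_comm, Matrix.rank, LinearMap.finrank_range_add_finrank_ker, Module.finrank_pi]

lemma mem_ker_bordered {X : Matrix (Fin d) (Fin d) F} {v : Fin d → F} {c : F}
    {z : Fin d ⊕ Unit → F} :
    z ∈ LinearMap.ker (bordered X v c).mulVecLin ↔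
      X *ᵥ (z ∘ Sum.inl) + z (Sum.inr ()) • v = 0 ∧
        v ⬝ᵥ (z ∘ Sum.inl) + c * z (Sum.inr ()) = 0 := by
  rw [LinearMap.mem_ker, Matrix.mulVecLin_apply, bordered, Matrix.fromBlocks_mulVec]
  constructor
  · intro h
    refine ⟨?_, ?_⟩
    · ext i
      have := congrFun h (Sum.inl i)
      simpa [Matrix.mulVec, dotProduct, mul_comm] using this
    · have := congrFun h (Sum.inr ())
      simpa [Matrix.mulVec, dotProduct] using this
  · rintro ⟨h1, h2⟩
    ext (i | i)
    · have := congrFun h1 i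
      simpa [Matrix.mulVec, dotProduct, mul_comm] using this
    · simpa [Matrix.mulVec, dotProduct] using h2

lemma dotProduct_symm_mulVec {X : Matrix (Fin d) (Fin d) F} (hX : Xᵀ = X) (w y : Fin d → F) :
    (X *ᵥ w) ⬝ᵥ y = w ⬝ᵥ (X *ᵥ y) := by
  rw [Matrix.dotProduct_mulVec, ← Matrix.mulVec_transpose, hX]

lemma rank_bordered_of_eq {X : Matrix (Fin d) (Fin d) F} (hX : Xᵀ = X) (w : Fin d → F) :
    (bordered X (X *ᵥ w) (w ⬝ᵥ (X *ᵥ w))).rank = X.rank := by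
  let f : (LinearMap.ker (bordered X (X *ᵥ w) (w ⬝ᵥ (X *ᵥ w))).mulVecLin) ≃ₗ[F]
      LinearMap.ker X.mulVecLin × F :=
    { toFun := fun z => (⟨z.1 ∘ Sum.inl + z.1 (Sum.inr ()) • w, by
        have := (mem_ker_bordered.1 z.2).1
        rw [LinearMap.mem_ker, Matrix.mulVecLin_apply, Matrix.mulVec_add, Matrix.mulVec_smul]
        exact this⟩, z.1 (Sum.inr ()))
      map_add' := by
        intro a b
        ext i
        · simp; ring
        · simp
      map_smul' := by
        intro a b
        ext i
        · simp; ring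
        · simp
      invFun := fun p => ⟨Sum.elim (p.1.1 - p.2 • w) (fun _ => p.2), by
        have hp := p.1.2
        rw [LinearMap.mem_ker, Matrix.mulVecLin_apply] at hp
        rw [mem_ker_bordered]
        simp only [Sum.elim_comp_inl, Sum.elim_inr]
        rw [dotProduct_symm_mulVec hX, Matrix.mulVec_sub, Matrix.mulVec_smul, hp]
        refine ⟨by simp, ?_⟩
        simp [dotProduct_neg, dotProduct_smul]
        ring⟩
      left_inv := by
        intro z
        ext (i | i) <;> simp
      right_inv := by
        intro z
        ext i <;> simp }
  have h1 := f.finrank_eq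
  rw [Module.finrank_prod, Module.finrank_self] at h1
  have h2 := finrank_ker_add_rank X
  have h3 := finrank_ker_add_rank (bordered X (X *ᵥ w) (w ⬝ᵥ (X *ᵥ w)))
  simp only [Fintype.card_sum, Fintype.card_fin, Fintype.card_unit] at h2 h3
  omega

lemma rank_bordered_of_ne {X : Matrix (Fin d) (Fin d) F} (hX : Xᵀ = X) (w : Fin d → F) {c : F}
    (hc : c ≠ w ⬝ᵥ (X *ᵥ w)) :
    (bordered X (X *ᵥ w) c).rank = X.rank + 1 := by
  have key : ∀ z ∈ LinearMap.ker (bordered X (X *ᵥ w) c).mulVecLin, z (Sum.inr ()) = 0 := by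
    intro z hz
    obtain ⟨h1, h2⟩ := mem_ker_bordered.1 hz
    rw [dotProduct_symm_mulVec hX, eq_neg_of_add_eq_zero_left h1, dotProduct_neg,
      dotProduct_smul, smul_eq_mul] at h2
    have h3 : z (Sum.inr ()) * (c - w ⬝ᵥ (X *ᵥ w)) = 0 := by linear_combination h2
    exact (mul_eq_zero.1 h3).resolve_right (sub_ne_zero.2 hc)
  let f : (LinearMap.ker (bordered X (X *ᵥ w) c).mulVecLin) ≃ₗ[F] LinearMap.ker X.mulVecLin :=
    { toFun := fun z => ⟨z.1 ∘ Sum.inl, by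
        have := (mem_ker_bordered.1 z.2).1
        rw [key z.1 z.2, zero_smul, add_zero] at this
        exact this⟩
      map_add' := by
        intro a b
        ext i
        simp
      map_smul' := by
        intro a b
        ext i
        simp
      invFun := fun p => ⟨Sum.elim p.1 0, by
        have hp := p.2
        rw [LinearMap.mem_ker, Matrix.mulVecLin_apply] at hp
        rw [mem_ker_bordered]
        simp only [Sum.elim_comp_inl, Sum.elim_inr]
        rw [dotProduct_symm_mulVec hX, hp]
        simp⟩
      left_inv := by
        intro z
        ext (i | i)
        · simp
        · simp [key z.1 z.2]
      right_inv := by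
        intro z
        ext i
        simp }
  have h1 := f.finrank_eq
  have h2 := finrank_ker_add_rank X
  have h3 := finrank_ker_add_rank (bordered X (X *ᵥ w) c)
  simp only [Fintype.card_sum, Fintype.card_fin, Fintype.card_unit] at h2 h3
  omega

lemma exists_mem_ker_of_notMem_range {X : Matrix (Fin d) (Fin d) F} (hX : Xᵀ = X)
    {v : Fin d → F} (hv : v ∉ LinearMap.range X.mulVecLin) :
    ∃ y, X *ᵥ y = 0 ∧ v ⬝ᵥ y ≠ 0 := by
  obtain ⟨f, hf, hle⟩ := Submodule.exists_le_ker_of_notMem hv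
  obtain ⟨y, rfl⟩ := (dotProductEquiv F (Fin d)).surjective f
  simp only [dotProductEquiv_apply_apply] at hf
  refine ⟨y, ?_, by rwa [dotProduct_comm]⟩
  refine dotProduct_eq_zero _ fun w => ?_
  rw [dotProduct_symm_mulVec hX]
  exact hle ⟨w, rfl⟩

lemma rank_bordered_of_notMem {X : Matrix (Fin d) (Fin d) F} (hX : Xᵀ = X) {v : Fin d → F}
    (hv : v ∉ LinearMap.range X.mulVecLin) (c : F) :
    (bordered X v c).rank = X.rank + 2 := by
  have key : ∀ z ∈ LinearMap.ker (bordered X v c).mulVecLin, z (Sum.inr ()) = 0 := by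
    intro z hz
    by_contra h0
    obtain ⟨h1, -⟩ := mem_ker_bordered.1 hz
    refine hv ⟨-(z (Sum.inr ()))⁻¹ • (z ∘ Sum.inl), ?_⟩
    rw [Matrix.mulVecLin_apply, Matrix.mulVec_smul, eq_neg_of_add_eq_zero_left h1, smul_neg,
      smul_smul, neg_mul, inv_mul_cancel₀ h0]
    simp
  let φ : LinearMap.ker X.mulVecLin →ₗ[F] F :=
    (dotProductEquiv F (Fin d) v).comp (LinearMap.ker X.mulVecLin).subtype
  have hφ : LinearMap.range φ = ⊤ := by
    obtain ⟨y, hy, hvy⟩ := exists_mem_ker_of_notMem_range hX hv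
    refine LinearMap.range_eq_top.2 fun t => ⟨(t * (v ⬝ᵥ y)⁻¹) • ⟨y, hy⟩, ?_⟩
    rw [map_smul]
    simp [φ, hvy]
  let f : (LinearMap.ker (bordered X v c).mulVecLin) ≃ₗ[F] LinearMap.ker φ :=
    { toFun := fun z => ⟨⟨z.1 ∘ Sum.inl, by
        have := (mem_ker_bordered.1 z.2).1
        rw [key z.1 z.2, zero_smul, add_zero] at this
        exact this⟩, by
        have := (mem_ker_bordered.1 z.2).2
        rw [key z.1 z.2, mul_zero, add_zero] at this
        exact this⟩
      map_add' := by
        intro a b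
        ext i
        simp
      map_smul' := by
        intro a b
        ext i
        simp
      invFun := fun p => ⟨Sum.elim p.1.1 0, by
        have hp := p.1.2
        have hp2 : v ⬝ᵥ p.1.1 = 0 := p.2
        rw [LinearMap.mem_ker, Matrix.mulVecLin_apply] at hp
        rw [mem_ker_bordered]
        simp only [Sum.elim_comp_inl, Sum.elim_inr]
        rw [hp, hp2]
        simp⟩
      left_inv := by
        intro z
        ext (i | i)
        · simp
        · simp [key z.1 z.2]
      right_inv := by
        intro z
        ext i
        simp }
  have h1 := f.finrank_eq
  have h2 := finrank_ker_add_rank X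
  have h3 := finrank_ker_add_rank (bordered X v c)
  have h4 := LinearMap.finrank_range_add_finrank_ker φ
  rw [hφ, finrank_top, Module.finrank_self] at h4
  simp only [Fintype.card_sum, Fintype.card_fin, Fintype.card_unit] at h2 h3
  omega

open Polynomial in
/-- The number of ways of bordering a symmetric `d × d` matrix of rank `s` to obtain a matrix of
rank `r`, as a polynomial in `q - 1`. -/
noncomputable def borderPoly (d s r : ℕ) : ℕ[X] :=
  if r = s then (X + 1) ^ s
  else if r = s + 1 then (X + 1) ^ s * X
  else if r = s + 2 then (X + 1) ^ s * (X * ∑ i ∈ Finset.range (d - s), (X + 1) ^ i) * (X + 1)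
  else 0

lemma card_range_mulVecLin [Fintype F] (X : Matrix (Fin d) (Fin d) F) :
    Nat.card (LinearMap.range X.mulVecLin) = Fintype.card F ^ X.rank := by
  rw [Module.natCard_eq_pow_finrank (K := F), Nat.card_eq_fintype_card, Matrix.rank]

lemma pow_mul_geom_add {q s d : ℕ} (hq : 0 < q) (hs : s ≤ d) :
    q ^ s + q ^ s * ((q - 1) * ∑ i ∈ Finset.range (d - s), q ^ i) = q ^ d := by
  obtain ⟨t, rfl⟩ := Nat.exists_eq_add_of_le' hq
  obtain ⟨m, rfl⟩ := Nat.exists_eq_add_of_le hs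
  have := Commute.geom_sum₂_mul (Commute.all (t + 1 : ℤ) 1) m
  have h2 : t * ∑ i ∈ Finset.range m, (t + 1) ^ i + 1 = (t + 1) ^ m := by
    zify
    simp at this
    linear_combination this
  simp only [Nat.add_sub_cancel_left, Nat.add_sub_cancel]
  rw [pow_add, ← h2]
  ring

lemma card_bordered [Fintype F] {X : Matrix (Fin d) (Fin d) F} (hX : Xᵀ = X) (r : ℕ) :
    Nat.card {p : (Fin d → F) × F // (bordered X p.1 p.2).rank = r} =
      (borderPoly d X.rank r).eval (Fintype.card F - 1) := by
  classical
  have hq : 0 < Fintype.card F := Fintype.card_pos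
  have hrank : X.rank ≤ d := by simpa using X.rank_le_card_width
  set R := LinearMap.range X.mulVecLin
  have hfib : ∀ v : Fin d → F, Nat.card {c : F // (bordered X v c).rank = r} =
      if v ∈ R then (if r = X.rank then 1 else if r = X.rank + 1 then Fintype.card F - 1 else 0)
      else (if r = X.rank + 2 then Fintype.card F else 0) := by
    intro v
    split_ifs with hv h1 h1 h1
    · obtain ⟨w, rfl⟩ := hv
      rw [Nat.card_eq_one_iff_unique]
      refine ⟨⟨fun a b => ?_⟩, ⟨⟨w ⬝ᵥ (X *ᵥ w), ?_⟩⟩⟩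
      · have key : ∀ a : F, (bordered X (X *ᵥ w) a).rank = r → a = w ⬝ᵥ (X *ᵥ w) := by
          intro a ha
          by_contra hne
          rw [rank_bordered_of_ne hX w hne] at ha
          omega
        exact Subtype.ext ((key a.1 a.2).trans (key b.1 b.2).symm)
      · rw [Matrix.mulVecLin_apply, rank_bordered_of_eq hX, h1]
    · obtain ⟨w, rfl⟩ := hv
      have : ∀ c : F, (bordered X (X *ᵥ w) c).rank = r ↔ c ≠ w ⬝ᵥ (X *ᵥ w) := by
        intro c
        refine ⟨?_, fun h => by rw [rank_bordered_of_ne hX w h, h1]⟩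
        rintro h rfl
        rw [rank_bordered_of_eq hX] at h
        omega
      simp only [Matrix.mulVecLin_apply, this]
      rw [Nat.card_eq_fintype_card, Fintype.card_subtype_compl, Fintype.card_subtype_eq]
    · obtain ⟨w, rfl⟩ := hv
      have : IsEmpty {c : F // (bordered X (X.mulVecLin w) c).rank = r} := by
        refine ⟨fun c => ?_⟩
        have hc : (bordered X (X *ᵥ w) c.1).rank = r := c.2
        by_cases h : c.1 = w ⬝ᵥ (X *ᵥ w)
        · rw [h, rank_bordered_of_eq hX] at hc
          omega
        · rw [rank_bordered_of_ne hX w h] at hc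
          omega
      exact Nat.card_of_isEmpty
    · simp only [rank_bordered_of_notMem hX hv, h1]
      simp
    · have : ∀ c : F, ¬ (bordered X v c).rank = r := by
        intro c
        rw [rank_bordered_of_notMem hX hv]
        omega
      simp [this]
  let E : {p : (Fin d → F) × F // (bordered X p.1 p.2).rank = r} ≃
      Σ v : Fin d → F, {c : F // (bordered X v c).rank = r} :=
    { toFun := fun p => ⟨p.1.1, p.1.2, p.2⟩
      invFun := fun p => ⟨(p.1, p.2.1), p.2.2⟩
      left_inv := fun _ => rfl
      right_inv := fun _ => rfl }
  have hR : (Finset.univ.filter (· ∈ R)).card = Fintype.card F ^ X.rank := by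
    rw [← card_range_mulVecLin, Nat.card_eq_fintype_card, Fintype.card_subtype]
  have hR' : (Finset.univ.filter (· ∉ R)).card =
      Fintype.card F ^ X.rank *
        ((Fintype.card F - 1) * ∑ i ∈ Finset.range (d - X.rank), Fintype.card F ^ i) := by
    have h1 := Finset.card_filter_add_card_filter_not (s := Finset.univ)
      (fun v : Fin d → F => v ∈ R)
    have h2 := pow_mul_geom_add hq hrank
    rw [hR] at h1
    simp only [Finset.card_univ, Fintype.card_pi, Finset.prod_const, Fintype.card_fin] at h1
    omega
  rw [Nat.card_congr E, Nat.card_sigma]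
  simp only [hfib]
  rw [Finset.sum_ite, Finset.sum_const, Finset.sum_const, hR, hR', borderPoly]
  have hq1 : Fintype.card F - 1 + 1 = Fintype.card F := Nat.sub_add_cancel hq
  split_ifs <;> first | omega | simp [Polynomial.eval_finsetSum, hq1]

lemma bordered_eq_of_symm {K : Type} {M : Matrix (Fin d ⊕ Unit) (Fin d ⊕ Unit) K} (hM : Mᵀ = M) :
    bordered M.toBlocks₁₁ (fun i => M (Sum.inl i) (Sum.inr ())) (M (Sum.inr ()) (Sum.inr ())) =
      M := by
  ext (i | i) (j | j)
  · rfl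
  · rfl
  · exact congrFun (congrFun hM (Sum.inr i)) (Sum.inl j)
  · rfl

lemma bordered_transpose {K : Type} {X : Matrix (Fin d) (Fin d) K} (hX : Xᵀ = X)
    (v : Fin d → K) (c : K) :
    (bordered X v c)ᵀ = bordered X v c := by
  rw [bordered, Matrix.fromBlocks_transpose, hX]
  rfl

/-- Symmetric matrices of size `d + 1` are bordered symmetric matrices of size `d`. -/
def symmSuccEquiv (F : Type) [Field F] (d r : ℕ) (ε : Fin (d + 1) ≃ Fin d ⊕ Unit) :
    {S : Matrix (Fin (d + 1)) (Fin (d + 1)) F // Sᵀ = S ∧ S.rank = r} ≃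
      Σ X : {X : Matrix (Fin d) (Fin d) F // Xᵀ = X},
        {p : (Fin d → F) × F // (bordered X.1 p.1 p.2).rank = r} where
  toFun S :=
    ⟨⟨(S.1.submatrix ε.symm ε.symm).toBlocks₁₁, by
      ext i j
      exact congrFun (congrFun S.2.1 _) _⟩,
      ⟨(fun i => S.1 (ε.symm (Sum.inl i)) (ε.symm (Sum.inr ())),
        S.1 (ε.symm (Sum.inr ())) (ε.symm (Sum.inr ()))), by
        have h : (S.1.submatrix ε.symm ε.symm)ᵀ = S.1.submatrix ε.symm ε.symm := by
          rw [Matrix.transpose_submatrix, S.2.1]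
        have := bordered_eq_of_symm h
        simp only [Matrix.submatrix_apply] at this
        rw [this, Matrix.rank_submatrix, S.2.2]⟩⟩
  invFun p := ⟨(bordered p.1.1 p.2.1.1 p.2.1.2).submatrix ε ε, by
    rw [Matrix.transpose_submatrix, bordered_transpose p.1.2], by
    rw [Matrix.rank_submatrix, p.2.2]⟩
  left_inv S := by
    have h : (S.1.submatrix ε.symm ε.symm)ᵀ = S.1.submatrix ε.symm ε.symm := by
      rw [Matrix.transpose_submatrix, S.2.1]
    have := bordered_eq_of_symm h
    simp only [Matrix.submatrix_apply] at this
    ext i j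
    simp [this]
  right_inv p := by
    obtain ⟨⟨X, hX⟩, ⟨⟨v, c⟩, hp⟩⟩ := p
    have h1 : (((bordered X v c).submatrix ε ε).submatrix ε.symm ε.symm).toBlocks₁₁ = X := by
      ext i j
      simp [bordered, Matrix.toBlocks₁₁]
    simp only [Sigma.mk.injEq, Subtype.mk.injEq]
    refine ⟨h1, ?_⟩
    congr! 1
    · rw [h1]
    · simp [bordered]

/-- The number of symmetric matrices of given size and rank is a polynomial in `q - 1` with
coefficients in `ℕ`. -/
theorem exists_card_symm_rank_polynomial (d : ℕ) :
    ∃ P : ℕ → Polynomial ℕ, ∀ (r : ℕ) (F : Type) [Field F] [Fintype F],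
      Nat.card {S : Matrix (Fin d) (Fin d) F // Sᵀ = S ∧ S.rank = r} =
        (P r).eval (Fintype.card F - 1) := by
  classical
  induction d with
  | zero =>
    refine ⟨fun r => if r = 0 then 1 else 0, fun r F _ _ => ?_⟩
    have hr : ∀ S : Matrix (Fin 0) (Fin 0) F, S.rank = 0 := fun S => by
      simpa using S.rank_le_card_width
    dsimp only
    split_ifs with h
    · subst h
      simp only [hr, and_true, Polynomial.eval_one]
      rw [Nat.card_eq_one_iff_unique]
      exact ⟨⟨fun a b => Subsingleton.elim _ _⟩, ⟨⟨0, rfl⟩⟩⟩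
    · have : IsEmpty {S : Matrix (Fin 0) (Fin 0) F // Sᵀ = S ∧ S.rank = r} :=
        ⟨fun S => h (by rw [← S.2.2, hr])⟩
      rw [Nat.card_of_isEmpty, Polynomial.eval_zero]
  | succ d ih =>
    obtain ⟨P, hP⟩ := ih
    refine ⟨fun r => ∑ s ∈ Finset.range (d + 1), P s * borderPoly d s r, fun r F _ _ => ?_⟩
    have ε : Fin (d + 1) ≃ Fin d ⊕ Unit := Fintype.equivOfCardEq (by simp)
    rw [Nat.card_congr (symmSuccEquiv F d r ε), Nat.card_sigma]
    simp only [fun X : {X : Matrix (Fin d) (Fin d) F // Xᵀ = X} => card_bordered X.2 r]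
    rw [Polynomial.eval_finsetSum, ← Finset.sum_fiberwise_of_maps_to
      (s := Finset.univ) (t := Finset.range (d + 1))
      (g := fun X : {X : Matrix (Fin d) (Fin d) F // Xᵀ = X} => X.1.rank)]
    · refine Finset.sum_congr rfl fun s _ => ?_
      rw [Finset.sum_congr rfl (g := fun _ => (borderPoly d s r).eval (Fintype.card F - 1)),
        Finset.sum_const, Polynomial.eval_mul, ← hP s F, smul_eq_mul]
      · congr 1
        rw [← Fintype.card_subtype, ← Nat.card_eq_fintype_card]
        exact Nat.card_congr (Equiv.subtypeSubtypeEquivSubtypeInter _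
          (fun X : Matrix (Fin d) (Fin d) F => X.rank = s))
      · intro X hX
        rw [(Finset.mem_filter.1 hX).2]
    · intro X _
      have : X.1.rank ≤ d := by simpa using X.1.rank_le_card_width
      exact Finset.mem_range.2 (by omega)

end SymmetricRank

section CentralType

variable {G : Type} [Group G]

lemma exists_smul_of_commute [Finite G] (V : FDRep ℂ G) [CategoryTheory.Simple V]
    (T : V →ₗ[ℂ] V) (hT : ∀ g, V.ρ g ∘ₗ T = T ∘ₗ V.ρ g) : ∃ c : ℂ, T = c • LinearMap.id := by
  have hmem : ∀ T : V →ₗ[ℂ] V, (∀ g, V.ρ g ∘ₗ T = T ∘ₗ V.ρ g) →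
      T ∈ (Representation.linHom V.ρ V.ρ).invariants := by
    intro T hT g
    rw [Representation.linHom_apply, ← LinearMap.comp_assoc, hT, LinearMap.comp_assoc,
      ← Module.End.mul_eq_comp (V.ρ g), ← map_mul, mul_inv_cancel, map_one]
    rfl
  have hfin : Module.finrank ℂ (Representation.linHom V.ρ V.ρ).invariants = 1 := by
    rw [(Representation.linHom.invariantsEquivFDRepHom V V).finrank_eq]
    exact CategoryTheory.finrank_endomorphism_simple_eq_one ℂ V
  by_cases h0 : (LinearMap.id : V →ₗ[ℂ] V) = 0
  · exact ⟨0, by rw [zero_smul, ← LinearMap.comp_id T, h0, LinearMap.comp_zero]⟩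
  · let i : (Representation.linHom V.ρ V.ρ).invariants := ⟨LinearMap.id, hmem _ fun g => rfl⟩
    have hi : i ≠ 0 := fun h => h0 (congrArg Subtype.val h)
    obtain ⟨c, hc⟩ := (finrank_eq_one_iff_of_nonzero' i hi).1 hfin ⟨T, hmem T hT⟩
    exact ⟨c, (congrArg Subtype.val hc).symm⟩

variable {R : Subgroup G} {μ : G → ℂ}

lemma character_of_scalar (hμ0 : ∀ g ∉ R, μ g = 0)
    (hR : ∀ g ∉ R, ∃ h, ∃ z ∈ R, h * g * h⁻¹ = z * g ∧ μ z ≠ 1)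
    (V : FDRep ℂ G) (hV : ∀ r ∈ R, V.ρ r = μ r • LinearMap.id) (g : G) :
    V.character g = Module.finrank ℂ V * μ g := by
  by_cases hg : g ∈ R
  · rw [FDRep.character, hV g hg, map_smul, LinearMap.trace_id, smul_eq_mul, mul_comm]
  · obtain ⟨h, z, hz, hzg, hz1⟩ := hR g hg
    have h1 := V.char_conj g h
    rw [hzg] at h1
    have h2 : V.character (z * g) = μ z * V.character g := by
      rw [FDRep.character, map_mul, hV z hz]
      rw [smul_mul_assoc, map_smul]
      rfl
    rw [h2] at h1
    have h3 : (μ z - 1) * V.character g = 0 := by linear_combination h1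
    rw [hμ0 g hg, mul_zero]
    exact (mul_eq_zero.1 h3).resolve_left (sub_ne_zero.2 hz1)

lemma finrank_sq_mul_card [Finite G] (hμ0 : ∀ g ∉ R, μ g = 0) (hμ1 : μ 1 = 1)
    (hμ : ∀ r ∈ R, ∀ s ∈ R, μ (r * s) = μ r * μ s)
    (hR : ∀ g ∉ R, ∃ h, ∃ z ∈ R, h * g * h⁻¹ = z * g ∧ μ z ≠ 1)
    (V : FDRep ℂ G) [hs : CategoryTheory.Simple V]
    (hV : ∀ r ∈ R, V.ρ r = μ r • LinearMap.id) :
    Module.finrank ℂ V ^ 2 * Nat.card R = Nat.card G := by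
  classical
  have := Fintype.ofFinite G
  have h := (FDRep.simple_iff_char_is_norm_one V).1 hs
  simp only [character_of_scalar hμ0 hR V hV] at h
  have hterm : ∀ g : G, (Module.finrank ℂ V * μ g) * (Module.finrank ℂ V * μ g⁻¹) =
      if g ∈ R then (Module.finrank ℂ V : ℂ) ^ 2 else 0 := by
    intro g
    split_ifs with hg
    · have : μ g * μ g⁻¹ = 1 := by rw [← hμ g hg _ (R.inv_mem hg), mul_inv_cancel, hμ1]
      linear_combination (Module.finrank ℂ V : ℂ) ^ 2 * this
    · rw [hμ0 g hg]
      ring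
  simp only [hterm] at h
  rw [Finset.sum_ite, Finset.sum_const, Finset.sum_const_zero, add_zero, ← Fintype.card_subtype,
    nsmul_eq_mul, mul_comm] at h
  rw [Nat.card_eq_fintype_card (α := R)]
  exact_mod_cast h

open scoped MonoidAlgebra in
lemma exists_simple_of_isSimpleModule [Finite G] (M : Type) [AddCommGroup M] [Module ℂ M]
    [Module ℂ[G] M] [IsScalarTower ℂ ℂ[G] M] [IsSimpleModule ℂ[G] M] [Module.Finite ℂ M] :
    ∃ V : FDRep ℂ G, CategoryTheory.Simple V ∧ ∀ (g : G) (c : ℂ),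
      (∀ m : M, MonoidAlgebra.single g (1 : ℂ) • m = c • m) → V.ρ g = c • LinearMap.id := by
  have := Fintype.ofFinite G
  let ρ : Representation ℂ G M := Representation.ofModule' M
  let E : ρ.asModule ≃ₗ[ℂ[G]] M :=
    { ρ.asModuleEquiv with
      map_smul' := fun x m => by
        change ρ.asAlgebraHom x (ρ.asModuleEquiv m) = x • ρ.asModuleEquiv m
        simp [ρ, Representation.ofModule', Representation.asAlgebraHom] }
  have hirr : ρ.IsIrreducible :=
    (Representation.irreducible_iff_isSimpleModule_asModule ρ).2 (IsSimpleModule.congr E)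
  have := invertibleOfNonzero (NeZero.ne (Nat.card G : ℂ))
  have h := Representation.char_orthonormal ρ ρ
  rw [if_pos ⟨Representation.Equiv.refl _⟩, inv_mul_eq_one₀ (NeZero.ne _), eq_comm] at h
  refine ⟨FDRep.of ρ, (FDRep.simple_iff_char_is_norm_one _).2 h, fun g c hg => ?_⟩
  have hρ : ρ g = c • LinearMap.id := by
    refine LinearMap.ext fun m => ?_
    simpa [ρ, Representation.ofModule'] using hg m
  exact hρ

open scoped MonoidAlgebra in
/-- A conjugation-invariant linear character of a subgroup occurs as scalars in some irreducible
representation of the whole group. -/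
lemma exists_simple_of_scalar [Finite G] (hμ0 : ∀ g ∉ R, μ g = 0) (hμ1 : μ 1 = 1)
    (hμ : ∀ r ∈ R, ∀ s ∈ R, μ (r * s) = μ r * μ s)
    (hconj : ∀ g, ∀ r ∈ R, g * r * g⁻¹ ∈ R ∧ μ (g * r * g⁻¹) = μ r) :
    ∃ V : FDRep ℂ G, CategoryTheory.Simple V ∧ ∀ r ∈ R, V.ρ r = μ r • LinearMap.id := by
  classical
  have := Fintype.ofFinite G
  let N : Submodule ℂ[G] ℂ[G] :=
    { carrier := {x | ∀ r ∈ R, MonoidAlgebra.single r (1 : ℂ) * x = μ r • x}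
      add_mem' := by
        intro a b ha hb r hr
        rw [mul_add, ha r hr, hb r hr, smul_add]
      zero_mem' := by
        intro r _
        simp
      smul_mem' := by
        intro c x hx
        induction c using MonoidAlgebra.induction_on with
        | of g =>
          intro r hr
          have h1 := hconj g⁻¹ r hr
          have h2 := hx _ h1.1
          rw [h1.2] at h2
          rw [smul_eq_mul, MonoidAlgebra.of_apply, ← mul_smul_comm, ← h2, ← mul_assoc, ← mul_assoc,
            MonoidAlgebra.single_mul_single, MonoidAlgebra.single_mul_single]
          simp only [inv_inv, mul_assoc, mul_inv_cancel_left]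
        | add a b ha hb =>
          intro r hr
          rw [add_smul, mul_add, ha r hr, hb r hr, smul_add]
        | smul t a ha =>
          intro r hr
          rw [smul_assoc, mul_smul_comm, ha r hr, smul_comm] }
  have hN : Nontrivial N := by
    refine Submodule.nontrivial_iff_ne_bot.2 ((Submodule.ne_bot_iff _).2
      ⟨∑ g : G, MonoidAlgebra.single g (μ g⁻¹), fun r hr => ?_, ?_⟩)
    · rw [Finset.mul_sum, Finset.smul_sum,
        ← Equiv.sum_comp (Equiv.mulLeft r) fun g => μ r • MonoidAlgebra.single g (μ g⁻¹)]
      refine Finset.sum_congr rfl fun g _ => ?_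
      rw [MonoidAlgebra.single_mul_single, MonoidAlgebra.smul_single, one_mul, smul_eq_mul]
      simp only [Equiv.coe_mulLeft]
      congr 1
      by_cases hg : g ∈ R
      · rw [mul_comm, ← hμ _ (R.inv_mem (R.mul_mem hr hg)) _ hr]
        simp
      · rw [hμ0 g⁻¹ fun h => hg (by simpa using h), hμ0 (r * g)⁻¹ fun h => hg ?_, mul_zero]
        exact (R.mul_mem_cancel_left hr).1 (R.inv_mem_iff.1 h)
    · intro h
      have h1 := congrArg (fun x : ℂ[G] => x.coeff 1) h
      simp [Finsupp.single_apply, hμ1] at h1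
  obtain ⟨M, hM⟩ := IsSemisimpleModule.exists_simple_submodule ℂ[G] N
  have hfin : Module.Finite ℂ M := Module.Finite.trans ℂ[G] _
  obtain ⟨V, hV, hscal⟩ := exists_simple_of_isSimpleModule (G := G) M
  exact ⟨V, hV, fun r hr => hscal r (μ r) fun m => Subtype.ext (Subtype.ext (m.1.2 r hr))⟩

end CentralType

section Coordinates

variable {F : Type} [Field F] {d m : ℕ}

/-- The additive group of symmetric `d × d` matrices. -/
def symMat (F : Type) [Field F] (d : ℕ) : AddSubgroup (Matrix (Fin d) (Fin d) F) where
  carrier := {C | Cᵀ = C}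
  add_mem' := by
    intro a b ha hb
    exact (Matrix.transpose_add a b).trans (congrArg₂ (· + ·) ha hb)
  zero_mem' := Matrix.transpose_zero
  neg_mem' := by
    intro a ha
    exact (Matrix.transpose_neg a).trans (congrArg Neg.neg ha)

/-- The symmetric matrix `A Bᵀ + B Aᵀ`. -/
def cross (A B : Matrix (Fin d) (Fin m) F) : symMat F d :=
  ⟨A * Bᵀ + B * Aᵀ, by
    change (A * Bᵀ + B * Aᵀ)ᵀ = A * Bᵀ + B * Aᵀ
    rw [Matrix.transpose_add, Matrix.transpose_mul, Matrix.transpose_mul,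
      Matrix.transpose_transpose, Matrix.transpose_transpose, add_comm]⟩

/-- Coordinates `(A, B, C)` on the unipotent radical. -/
abbrev Coord (F : Type) [Field F] (d m : ℕ) :=
  Matrix (Fin d) (Fin m) F × Matrix (Fin d) (Fin m) F × symMat F d

/-- The group law of the unipotent radical in coordinates. -/
def coordMul (x y : Coord F d m) : Coord F d m :=
  (x.1 + y.1, x.2.1 + y.2.1, x.2.2 + y.2.2 + cross x.1 y.2.1)

/-- The pairs `(A, B)` with `S A = 0` and `S B = 0`. -/
def rad (m : ℕ) (S : Matrix (Fin d) (Fin d) F) :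
    AddSubgroup (Matrix (Fin d) (Fin m) F × Matrix (Fin d) (Fin m) F) where
  carrier := {p | S * p.1 = 0 ∧ S * p.2 = 0}
  add_mem' := by
    rintro a b ⟨ha, ha'⟩ ⟨hb, hb'⟩
    exact ⟨by rw [Prod.fst_add, Matrix.mul_add, ha, hb, add_zero],
      by rw [Prod.snd_add, Matrix.mul_add, ha', hb', add_zero]⟩
  zero_mem' := ⟨Matrix.mul_zero _, Matrix.mul_zero _⟩
  neg_mem' := by
    rintro a ⟨ha, ha'⟩
    exact ⟨by rw [Prod.fst_neg, Matrix.mul_neg, ha, neg_zero],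
      by rw [Prod.snd_neg, Matrix.mul_neg, ha', neg_zero]⟩

lemma card_rad [Fintype F] (m : ℕ) (S : Matrix (Fin d) (Fin d) F) :
    Nat.card (rad m S) = Fintype.card F ^ (2 * m * (d - S.rank)) := by
  have hcol : ∀ A : Matrix (Fin d) (Fin m) F,
      S * A = 0 ↔ ∀ j, (fun i => A i j) ∈ LinearMap.ker S.mulVecLin := by
    intro A
    simp only [LinearMap.mem_ker, Matrix.mulVecLin_apply]
    constructor
    · intro h j
      ext i
      exact congrFun (congrFun h i) j
    · intro h
      ext i j
      exact congrFun (h j) i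
  let E : rad m S ≃ (Fin m → LinearMap.ker S.mulVecLin) × (Fin m → LinearMap.ker S.mulVecLin) :=
    { toFun := fun p => (fun j => ⟨fun i => p.1.1 i j, (hcol _).1 p.2.1 j⟩,
        fun j => ⟨fun i => p.1.2 i j, (hcol _).1 p.2.2 j⟩)
      invFun := fun f => ⟨(Matrix.of fun i j => (f.1 j).1 i, Matrix.of fun i j => (f.2 j).1 i),
        (hcol _).2 fun j => (f.1 j).2, (hcol _).2 fun j => (f.2 j).2⟩
      left_inv := fun _ => rfl
      right_inv := fun _ => rfl }
  have hker : Nat.card (LinearMap.ker S.mulVecLin) = Fintype.card F ^ (d - S.rank) := by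
    have h := finrank_ker_add_rank S
    rw [Fintype.card_fin] at h
    rw [Module.natCard_eq_pow_finrank (K := F), Nat.card_eq_fintype_card]
    congr 1
    omega
  rw [Nat.card_congr E, Nat.card_prod, Nat.card_pi, Finset.prod_const, hker, Finset.card_univ,
    Fintype.card_fin, ← pow_mul, ← pow_add]
  congr 1
  ring

lemma trace_mul_transpose_symm {S : Matrix (Fin d) (Fin d) F} (hS : Sᵀ = S)
    (A B : Matrix (Fin d) (Fin m) F) : (S * B * Aᵀ).trace = (S * A * Bᵀ).trace := by
  rw [← Matrix.trace_transpose, Matrix.transpose_mul, Matrix.transpose_mul, hS,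
    Matrix.transpose_transpose, Matrix.trace_mul_comm A, Matrix.mul_assoc, Matrix.trace_mul_comm,
    Matrix.mul_assoc]

lemma trace_mul_cross {S : Matrix (Fin d) (Fin d) F} (hS : Sᵀ = S)
    (A B : Matrix (Fin d) (Fin m) F) :
    (S * (cross A B).1).trace = 2 * (S * A * Bᵀ).trace := by
  rw [cross, Matrix.mul_add, Matrix.trace_add, ← Matrix.mul_assoc, ← Matrix.mul_assoc,
    trace_mul_transpose_symm hS, two_mul]

lemma trace_mul_cross_comm {S : Matrix (Fin d) (Fin d) F} (hS : Sᵀ = S)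
    (A B : Matrix (Fin d) (Fin m) F) :
    (S * (cross A B).1).trace = 2 * (S * B * Aᵀ).trace := by
  rw [trace_mul_cross hS, trace_mul_transpose_symm hS]

variable (ψ : AddChar F ℂ)

/-- The character `C ↦ ψ (tr (S C))` of the group of symmetric matrices. -/
def traceChar (S : Matrix (Fin d) (Fin d) F) : AddChar (symMat F d) ℂ where
  toFun C := ψ (S * C.1).trace
  map_zero_eq_one' := by simp
  map_add_eq_mul' C D := by
    rw [AddSubgroup.coe_add, Matrix.mul_add, Matrix.trace_add, AddChar.map_add_eq_mul]

lemma traceChar_apply (S : Matrix (Fin d) (Fin d) F) (C : symMat F d) :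
    traceChar ψ S C = ψ (S * C.1).trace := rfl

variable {ψ}

lemma eq_zero_of_traceChar_eq_one (h2 : (2 : F) ≠ 0) (hψ : ψ 1 ≠ 1)
    {S : Matrix (Fin d) (Fin d) F} (hS : Sᵀ = S) (h : ∀ C, traceChar ψ S C = 1) : S = 0 := by
  by_contra hne
  obtain ⟨i, j, hij⟩ : ∃ i j, S i j ≠ 0 := by
    by_contra! hc
    exact hne (Matrix.ext hc)
  have hsymm : S j i = S i j := congrFun (congrFun hS i) j
  let t : F := (2 * S i j)⁻¹
  let C : symMat F d := ⟨Matrix.single i j t + Matrix.single j i t, by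
    change (_ + _)ᵀ = _
    rw [Matrix.transpose_add, Matrix.transpose_single, Matrix.transpose_single, add_comm]⟩
  refine hψ ?_
  rw [← h C, traceChar_apply]
  congr 1
  simp only [C, Matrix.mul_add, Matrix.trace_add, Matrix.trace_mul_single]
  simp only [t, hsymm, MulOpposite.smul_eq_mul_unop, MulOpposite.unop_op]
  field_simp
  norm_num

lemma traceChar_injective (h2 : (2 : F) ≠ 0) (hψ : ψ 1 ≠ 1) :
    Function.Injective fun S : symMat F d => traceChar ψ S.1 := by
  intro S T hST
  rw [← sub_eq_zero]
  refine Subtype.ext (eq_zero_of_traceChar_eq_one h2 hψ (S - T).2 fun C => ?_)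
  have h := DFunLike.congr_fun hST C
  simp only [traceChar_apply] at h
  rw [traceChar_apply, AddSubgroup.coe_sub, Matrix.sub_mul, Matrix.trace_sub,
    AddChar.map_sub_eq_div, h, div_self (ψ.val_isUnit _).ne_zero]

lemma traceChar_surjective [Finite F] (h2 : (2 : F) ≠ 0) (hψ : ψ 1 ≠ 1) :
    Function.Surjective fun S : symMat F d => traceChar ψ S.1 := by
  classical
  have := Fintype.ofFinite F
  have := Fintype.ofFinite (symMat F d)
  exact ((Fintype.bijective_iff_injective_and_card _).2
    ⟨traceChar_injective h2 hψ, (AddChar.card_eq).symm⟩).2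

end Coordinates

section Characters

variable {F : Type} [Field F] {d m : ℕ} {G : Type} [Group G] {e : Coord F d m ≃ G}

lemma cross_zero_left (B : Matrix (Fin d) (Fin m) F) : cross 0 B = 0 := by
  refine Subtype.ext ?_
  simp [cross]

lemma cross_zero_right (A : Matrix (Fin d) (Fin m) F) : cross A 0 = 0 := by
  refine Subtype.ext ?_
  simp [cross]

lemma apply_zero_eq_one (he : ∀ x y, e x * e y = e (coordMul x y)) : e 0 = 1 := by
  have h := he 0 0
  have h0 : coordMul (0 : Coord F d m) 0 = 0 := by
    simp [coordMul, cross_zero_left]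
  rw [h0] at h
  exact mul_eq_left.1 h

/-- The projection of the unipotent radical onto its coordinates `(A, B)`. -/
def projHom (he : ∀ x y, e x * e y = e (coordMul x y)) :
    G →* Multiplicative (Matrix (Fin d) (Fin m) F × Matrix (Fin d) (Fin m) F) :=
  MonoidHom.mk' (fun g => Multiplicative.ofAdd ((e.symm g).1, (e.symm g).2.1)) fun g h => by
    obtain ⟨x, rfl⟩ := e.surjective g
    obtain ⟨y, rfl⟩ := e.surjective h
    rw [he]
    simp only [Equiv.symm_apply_apply]
    rfl

/-- The elements of the unipotent radical with `S A = 0` and `S B = 0`. -/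
def radGroup (he : ∀ x y, e x * e y = e (coordMul x y)) (S : Matrix (Fin d) (Fin d) F) :
    Subgroup G :=
  (AddSubgroup.toSubgroup (rad m S)).comap (projHom he)

lemma mem_radGroup (he : ∀ x y, e x * e y = e (coordMul x y)) {S : Matrix (Fin d) (Fin d) F}
    {x : Coord F d m} : e x ∈ radGroup he S ↔ (x.1, x.2.1) ∈ rad m S := by
  change ((e.symm (e x)).1, (e.symm (e x)).2.1) ∈ rad m S ↔ _
  rw [Equiv.symm_apply_apply]

lemma conj_eq (he : ∀ x y, e x * e y = e (coordMul x y)) (x y : Coord F d m) :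
    e y * e x * (e y)⁻¹ = e (0, 0, cross y.1 x.2.1 - cross x.1 y.2.1) * e x := by
  rw [mul_inv_eq_iff_eq_mul, he, he, he]
  congr 1
  simp only [coordMul, cross_zero_left, Prod.mk.injEq]
  refine ⟨by abel, by abel, ?_⟩
  rw [zero_add]
  abel

variable {ψ : AddChar F ℂ}

lemma traceChar_cross_of_left {S : Matrix (Fin d) (Fin d) F} (hS : Sᵀ = S)
    {A : Matrix (Fin d) (Fin m) F} (hA : S * A = 0) (B : Matrix (Fin d) (Fin m) F) :
    traceChar ψ S (cross A B) = 1 := by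
  rw [traceChar_apply, trace_mul_cross hS, hA, Matrix.zero_mul, Matrix.trace_zero, mul_zero,
    AddChar.map_zero_eq_one]

lemma traceChar_cross_of_right {S : Matrix (Fin d) (Fin d) F} (hS : Sᵀ = S)
    (A : Matrix (Fin d) (Fin m) F) {B : Matrix (Fin d) (Fin m) F} (hB : S * B = 0) :
    traceChar ψ S (cross A B) = 1 := by
  rw [traceChar_apply, trace_mul_cross_comm hS, hB, Matrix.zero_mul, Matrix.trace_zero, mul_zero,
    AddChar.map_zero_eq_one]

open Classical in
/-- The function supported on `radGroup` given there by
`(A, B, C) ↦ ψ (tr (S C)) * ν (A, B)`. -/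
noncomputable def scalarFun {G : Type} (e : Coord F d m ≃ G) (ψ : AddChar F ℂ)
    (S : Matrix (Fin d) (Fin d) F) (ν : AddChar (rad m S) ℂ) (g : G) : ℂ :=
  if h : ((e.symm g).1, (e.symm g).2.1) ∈ rad m S then
    traceChar ψ S (e.symm g).2.2 * ν ⟨_, h⟩ else 0

variable {S : Matrix (Fin d) (Fin d) F} {ν : AddChar (rad m S) ℂ}

lemma scalarFun_of_mem {G : Type} {e : Coord F d m ≃ G} {x : Coord F d m}
    (h : (x.1, x.2.1) ∈ rad m S) :
    scalarFun e ψ S ν (e x) = traceChar ψ S x.2.2 * ν ⟨(x.1, x.2.1), h⟩ := by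
  have h' : ((e.symm (e x)).1, (e.symm (e x)).2.1) ∈ rad m S := by
    rwa [Equiv.symm_apply_apply]
  rw [scalarFun, dif_pos h']
  simp only [Equiv.symm_apply_apply]

lemma scalarFun_of_notMem (he : ∀ x y, e x * e y = e (coordMul x y)) (g : G)
    (hg : g ∉ radGroup he S) : scalarFun e ψ S ν g = 0 :=
  dif_neg hg

lemma scalarFun_central {G : Type} {e : Coord F d m ≃ G} (C : symMat F d) :
    scalarFun e ψ S ν (e (0, 0, C)) = traceChar ψ S C := by
  rw [scalarFun_of_mem (rad m S).zero_mem]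
  change _ * ν 0 = _
  rw [AddChar.map_zero_eq_one, mul_one]

lemma scalarFun_one (he : ∀ x y, e x * e y = e (coordMul x y)) : scalarFun e ψ S ν 1 = 1 := by
  rw [← apply_zero_eq_one he]
  exact (scalarFun_central 0).trans (AddChar.map_zero_eq_one _)

lemma scalarFun_mul (he : ∀ x y, e x * e y = e (coordMul x y)) (hS : Sᵀ = S) :
    ∀ g ∈ radGroup he S, ∀ h ∈ radGroup he S,
      scalarFun e ψ S ν (g * h) = scalarFun e ψ S ν g * scalarFun e ψ S ν h := by
  intro g hg h hh
  obtain ⟨x, rfl⟩ := e.surjective g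
  obtain ⟨y, rfl⟩ := e.surjective h
  rw [mem_radGroup] at hg hh
  rw [he, scalarFun_of_mem hg, scalarFun_of_mem hh,
    scalarFun_of_mem (x := coordMul x y) ((rad m S).add_mem hg hh)]
  have h1 : ν ⟨((coordMul x y).1, (coordMul x y).2.1), (rad m S).add_mem hg hh⟩ =
      ν ⟨_, hg⟩ * ν ⟨_, hh⟩ := (AddChar.map_add_eq_mul ν ⟨_, hg⟩ ⟨_, hh⟩)
  rw [h1, coordMul, AddChar.map_add_eq_mul, AddChar.map_add_eq_mul,
    traceChar_cross_of_left hS hg.1]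
  ring

lemma scalarFun_conj (he : ∀ x y, e x * e y = e (coordMul x y)) (hS : Sᵀ = S) (g : G) :
    ∀ r ∈ radGroup he S,
      g * r * g⁻¹ ∈ radGroup he S ∧ scalarFun e ψ S ν (g * r * g⁻¹) = scalarFun e ψ S ν r := by
  intro r hr
  obtain ⟨x, rfl⟩ := e.surjective r
  obtain ⟨y, rfl⟩ := e.surjective g
  have hx := (mem_radGroup he).1 hr
  have hc : e (0, 0, cross y.1 x.2.1 - cross x.1 y.2.1) ∈ radGroup he S :=
    (mem_radGroup he).2 (rad m S).zero_mem
  rw [conj_eq he]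
  refine ⟨mul_mem hc hr, ?_⟩
  rw [scalarFun_mul he hS _ hc _ hr, scalarFun_central, AddChar.map_sub_eq_div,
    traceChar_cross_of_left hS hx.1, traceChar_cross_of_right hS _ hx.2, div_one, one_mul]

lemma exists_trace_mul_transpose_eq_one {B : Matrix (Fin d) (Fin m) F} (hB : S * B ≠ 0) :
    ∃ A : Matrix (Fin d) (Fin m) F, (S * B * Aᵀ).trace = 1 := by
  obtain ⟨i, j, hij⟩ : ∃ i j, (S * B) i j ≠ 0 := by
    by_contra! hc
    exact hB (Matrix.ext hc)
  refine ⟨Matrix.single i j ((S * B) i j)⁻¹, ?_⟩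
  rw [Matrix.transpose_single, Matrix.trace_mul_single]
  simp only [MulOpposite.smul_eq_mul_unop, MulOpposite.unop_op]
  field_simp

lemma exists_conj_of_notMem (he : ∀ x y, e x * e y = e (coordMul x y)) (h2 : (2 : F) ≠ 0)
    (hψ : ψ 1 ≠ 1) (hS : Sᵀ = S) (g : G) (hg : g ∉ radGroup he S) :
    ∃ h, ∃ z ∈ radGroup he S, h * g * h⁻¹ = z * g ∧ scalarFun e ψ S ν z ≠ 1 := by
  obtain ⟨x, rfl⟩ := e.surjective g
  rw [mem_radGroup] at hg
  have key : ∃ y : Coord F d m, traceChar ψ S (cross y.1 x.2.1 - cross x.1 y.2.1) ≠ 1 := by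
    by_cases hB : S * x.2.1 = 0
    · have hA : S * x.1 ≠ 0 := fun hA => hg ⟨hA, hB⟩
      obtain ⟨B, hB'⟩ := exists_trace_mul_transpose_eq_one hA
      refine ⟨(0, -((2 : F)⁻¹ • B), 0), ?_⟩
      rw [cross_zero_left, zero_sub, traceChar_apply, AddSubgroup.coe_neg, Matrix.mul_neg,
        Matrix.trace_neg, trace_mul_cross hS, Matrix.transpose_neg, Matrix.transpose_smul,
        Matrix.mul_neg, Matrix.mul_smul, Matrix.trace_neg, Matrix.trace_smul, hB', smul_eq_mul,
        mul_one, mul_neg, neg_neg, mul_inv_cancel₀ h2]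
      exact hψ
    · obtain ⟨A, hA⟩ := exists_trace_mul_transpose_eq_one hB
      refine ⟨((2 : F)⁻¹ • A, 0, 0), ?_⟩
      rw [cross_zero_right, sub_zero, traceChar_apply, trace_mul_cross_comm hS,
        Matrix.transpose_smul, Matrix.mul_smul, Matrix.trace_smul, hA, smul_eq_mul,
        mul_one, mul_inv_cancel₀ h2]
      exact hψ
  obtain ⟨y, hy⟩ := key
  refine ⟨e y, e (0, 0, cross y.1 x.2.1 - cross x.1 y.2.1),
    (mem_radGroup he).2 (rad m S).zero_mem, conj_eq he x y, ?_⟩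
  rwa [scalarFun_central]

lemma card_radGroup (he : ∀ x y, e x * e y = e (coordMul x y)) :
    Nat.card (radGroup he S) = Nat.card (rad m S) * Nat.card (symMat F d) := by
  let E : radGroup he S ≃ rad m S × symMat F d :=
    { toFun := fun g => (⟨((e.symm g.1).1, (e.symm g.1).2.1), g.2⟩, (e.symm g.1).2.2)
      invFun := fun p => ⟨e (p.1.1.1, p.1.1.2, p.2), (mem_radGroup he).2 p.1.2⟩
      left_inv := fun g => Subtype.ext (e.apply_symm_apply g.1)
      right_inv := fun p => by simp }
  rw [Nat.card_congr E, Nat.card_prod]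

lemma finrank_eq [Fintype F] (he : ∀ x y, e x * e y = e (coordMul x y)) (h2 : (2 : F) ≠ 0)
    (hψ : ψ 1 ≠ 1) (hS : Sᵀ = S) (V : FDRep ℂ G) [CategoryTheory.Simple V]
    (hV : ∀ r ∈ radGroup he S, V.ρ r = scalarFun e ψ S ν r • LinearMap.id) :
    Module.finrank ℂ V = Fintype.card F ^ (m * S.rank) := by
  have : Finite G := Finite.of_equiv _ e
  have h := finrank_sq_mul_card (scalarFun_of_notMem he) (scalarFun_one he)
    (scalarFun_mul he hS) (exists_conj_of_notMem he h2 hψ hS) V hV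
  have hG : Nat.card G = Fintype.card F ^ (2 * m * d) * Nat.card (symMat F d) := by
    rw [← Nat.card_congr e, Nat.card_prod, Nat.card_prod, ← mul_assoc]
    congr 1
    simp only [Nat.card_eq_fintype_card, Matrix, Fintype.card_fun, Fintype.card_fin]
    rw [← pow_mul, ← pow_add]
    congr 1
    ring
  have hr : S.rank ≤ d := by simpa using S.rank_le_card_width
  rw [card_radGroup he, card_rad, hG, ← mul_assoc] at h
  have hsym : 0 < Nat.card (symMat F d) := Nat.card_pos
  have h3 := Nat.eq_of_mul_eq_mul_right hsym h
  have hq : 0 < Fintype.card F := Fintype.card_pos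
  have h4 : Fintype.card F ^ (2 * m * d) =
      (Fintype.card F ^ (m * S.rank)) ^ 2 * Fintype.card F ^ (2 * m * (d - S.rank)) := by
    rw [← pow_mul, ← pow_add]
    congr 1
    rw [Nat.mul_sub, Nat.add_comm, mul_comm (m * S.rank), ← mul_assoc, Nat.sub_add_cancel]
    exact Nat.mul_le_mul_left _ hr
  rw [h4] at h3
  exact Nat.pow_left_injective two_ne_zero (Nat.eq_of_mul_eq_mul_right (pow_pos hq _) h3)

lemma character_eq [Fintype F] (he : ∀ x y, e x * e y = e (coordMul x y)) (h2 : (2 : F) ≠ 0)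
    (hψ : ψ 1 ≠ 1) (hS : Sᵀ = S) (V : FDRep ℂ G) [CategoryTheory.Simple V]
    (hV : ∀ r ∈ radGroup he S, V.ρ r = scalarFun e ψ S ν r • LinearMap.id) (g : G) :
    V.character g = (Fintype.card F : ℂ) ^ (m * S.rank) * scalarFun e ψ S ν g := by
  rw [character_of_scalar (scalarFun_of_notMem he) (exists_conj_of_notMem he h2 hψ hS) V hV,
    finrank_eq he h2 hψ hS V hV, Nat.cast_pow]

lemma exists_scalarFun [Finite F] (he : ∀ x y, e x * e y = e (coordMul x y)) (h2 : (2 : F) ≠ 0)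
    (hψ : ψ 1 ≠ 1) (V : FDRep ℂ G) [CategoryTheory.Simple V] :
    ∃ (S : Matrix (Fin d) (Fin d) F) (ν : AddChar (rad m S) ℂ), Sᵀ = S ∧
      ∀ r ∈ radGroup he S, V.ρ r = scalarFun e ψ S ν r • LinearMap.id := by
  have : Finite G := Finite.of_equiv _ e
  have hid : (LinearMap.id : V →ₗ[ℂ] V) ≠ 0 := by
    intro h
    refine CategoryTheory.id_nonzero V ?_
    ext v
    exact DFunLike.congr_fun h v
  have hinj : ∀ a b : ℂ, a • (LinearMap.id : V →ₗ[ℂ] V) = b • LinearMap.id → a = b :=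
    fun a b h => smul_left_injective ℂ hid h
  have hmul : ∀ {g h : G} {a b : ℂ}, V.ρ g = a • LinearMap.id → V.ρ h = b • LinearMap.id →
      V.ρ (g * h) = (a * b) • LinearMap.id := by
    intro g h a b hg hh
    rw [map_mul, hg, hh, ← Module.End.one_eq_id, smul_mul_smul_comm, one_mul]
  have hcent : ∀ C : symMat F d, ∃ c : ℂ, V.ρ (e (0, 0, C)) = c • LinearMap.id := by
    intro C
    refine exists_smul_of_commute V _ fun g => ?_
    obtain ⟨y, rfl⟩ := e.surjective g
    have hcomm : e y * e (0, 0, C) = e (0, 0, C) * e y := by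
      rw [he, he]
      simp [coordMul, cross_zero_left, cross_zero_right, add_comm]
    rw [← Module.End.mul_eq_comp, ← Module.End.mul_eq_comp, ← map_mul V.ρ, hcomm, map_mul]
  choose c hc using hcent
  let θ : AddChar (symMat F d) ℂ :=
    { toFun := c
      map_zero_eq_one' := hinj _ _ (by
        rw [← hc, one_smul]
        exact (congrArg V.ρ (apply_zero_eq_one he)).trans (map_one _))
      map_add_eq_mul' := fun C D => hinj _ _ (by
        rw [← hmul (hc C) (hc D), ← hc, he]
        simp [coordMul, cross_zero_left]) }
  obtain ⟨⟨S, hS⟩, hSθ⟩ := traceChar_surjective h2 hψ θ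
  have hS : Sᵀ = S := hS
  have hθ : ∀ C : symMat F d, V.ρ (e (0, 0, C)) = traceChar ψ S C • LinearMap.id := by
    intro C
    rw [hc C]
    exact congrArg (· • LinearMap.id) (DFunLike.congr_fun hSθ C).symm
  have hrad : ∀ p : rad m S, ∃ c : ℂ, V.ρ (e (p.1.1, p.1.2, 0)) = c • LinearMap.id := by
    intro p
    refine exists_smul_of_commute V _ fun g => ?_
    obtain ⟨y, rfl⟩ := e.surjective g
    have hcomm := mul_inv_eq_iff_eq_mul.1 (conj_eq he (p.1.1, p.1.2, 0) y)
    rw [← Module.End.mul_eq_comp, ← Module.End.mul_eq_comp, ← map_mul V.ρ, hcomm, map_mul,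
      map_mul, hθ, AddChar.map_sub_eq_div, traceChar_cross_of_left hS p.2.1,
      traceChar_cross_of_right hS _ p.2.2, div_one, one_smul, ← Module.End.one_eq_id, one_mul]
  choose b hb using hrad
  have hsplit : ∀ x : Coord F d m, e (0, 0, x.2.2) * e (x.1, x.2.1, 0) = e x := by
    intro x
    rw [he]
    simp [coordMul, cross_zero_left]
  let ν : AddChar (rad m S) ℂ :=
    { toFun := b
      map_zero_eq_one' := hinj _ _ (by
        rw [← hb, one_smul]
        exact (congrArg V.ρ (apply_zero_eq_one he)).trans (map_one _))
      map_add_eq_mul' := fun p r => hinj _ _ (by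
        rw [← hmul (hb p) (hb r), he, ← hsplit (coordMul _ _)]
        have h1 : V.ρ (e (0, 0, (coordMul (p.1.1, p.1.2, 0) (r.1.1, r.1.2, 0)).2.2)) =
            (1 : ℂ) • LinearMap.id := by
          rw [hθ, coordMul, zero_add, zero_add, traceChar_cross_of_left hS p.2.1]
        have h3 := hmul h1 (hb (p + r))
        rw [one_mul] at h3
        exact h3.symm) }
  refine ⟨S, ν, hS, fun r hr => ?_⟩
  obtain ⟨x, rfl⟩ := e.surjective r
  rw [mem_radGroup] at hr
  rw [scalarFun_of_mem hr, ← hsplit x]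
  exact hmul (hθ _) (hb ⟨_, hr⟩)

lemma scalarFun_injective {G : Type} {e : Coord F d m ≃ G} (h2 : (2 : F) ≠ 0)
    (hψ : ψ 1 ≠ 1) (hS : Sᵀ = S)
    {T : Matrix (Fin d) (Fin d) F} (hT : Tᵀ = T) {ξ : AddChar (rad m T) ℂ}
    (h : scalarFun e ψ S ν = scalarFun e ψ T ξ) : S = T := by
  have hST : traceChar ψ S = traceChar ψ T := by
    refine DFunLike.ext _ _ fun C => ?_
    rw [← scalarFun_central (e := e) (ν := ν), h, scalarFun_central]
  exact congrArg Subtype.val (@traceChar_injective F _ d ψ h2 hψ ⟨S, hS⟩ ⟨T, hT⟩ hST)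

lemma scalarFun_injective_right {G : Type} {e : Coord F d m ≃ G} :
    Function.Injective (scalarFun e ψ S) := by
  intro ν ξ h
  refine DFunLike.ext _ _ fun p => ?_
  have hp := congrFun h (e (p.1.1, p.1.2, 0))
  rw [scalarFun_of_mem p.2, scalarFun_of_mem p.2, AddChar.map_zero_eq_one, one_mul, one_mul] at hp
  exact hp

lemma card_characters [Fintype F] (he : ∀ x y, e x * e y = e (coordMul x y)) (h2 : (2 : F) ≠ 0)
    (k : ℕ) :
    Nat.card {χ : G → ℂ | (∃ V : FDRep ℂ G, CategoryTheory.Simple V ∧ V.character = χ) ∧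
      χ 1 = (Fintype.card F : ℂ) ^ k} =
    Nat.card {S : Matrix (Fin d) (Fin d) F // Sᵀ = S ∧ m * S.rank = k} *
      Fintype.card F ^ (2 * (m * d - k)) := by
  classical
  have : Finite G := Finite.of_equiv _ e
  obtain ⟨ψ, hψ⟩ : ∃ ψ : AddChar F ℂ, ψ 1 ≠ 1 := AddChar.exists_apply_ne_zero.2 one_ne_zero
  have hq : 1 < Fintype.card F := Fintype.one_lt_card
  have hq0 : (Fintype.card F : ℂ) ≠ 0 := by
    exact_mod_cast hq.ne_bot
  let f : (Σ S : {S : Matrix (Fin d) (Fin d) F // Sᵀ = S ∧ m * S.rank = k},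
      AddChar (rad m S.1) ℂ) → G → ℂ :=
    fun p g => (Fintype.card F : ℂ) ^ k * scalarFun e ψ p.1.1 p.2 g
  have hf : Function.Injective f := by
    rintro ⟨⟨S, hS, hS'⟩, ν⟩ ⟨⟨T, hT, hT'⟩, ξ⟩ h
    have h' : scalarFun e ψ S ν = scalarFun e ψ T ξ := by
      funext g
      exact mul_left_cancel₀ (pow_ne_zero k hq0) (congrFun h g)
    obtain rfl := scalarFun_injective h2 hψ hS hT h'
    obtain rfl := scalarFun_injective_right h'
    rfl
  have hrange : {χ : G → ℂ | (∃ V : FDRep ℂ G, CategoryTheory.Simple V ∧ V.character = χ) ∧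
      χ 1 = (Fintype.card F : ℂ) ^ k} = Set.range f := by
    ext χ
    constructor
    · rintro ⟨⟨V, hV, rfl⟩, hχ⟩
      obtain ⟨S, ν, hS, hSν⟩ := exists_scalarFun he h2 hψ V
      have hchar := character_eq he h2 hψ hS V hSν
      have hk : m * S.rank = k := by
        rw [hchar 1, scalarFun_one he, mul_one] at hχ
        exact Nat.pow_right_injective hq (by exact_mod_cast hχ)
      refine ⟨⟨⟨S, hS, hk⟩, ν⟩, ?_⟩
      funext g
      exact (congrArg (fun j => (Fintype.card F : ℂ) ^ j * _) hk.symm).trans (hchar g).symm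
    · rintro ⟨⟨⟨S, hS, hk⟩, ν⟩, rfl⟩
      obtain ⟨V, hV, hSν⟩ := exists_simple_of_scalar (scalarFun_of_notMem he) (scalarFun_one he)
        (scalarFun_mul he hS (ψ := ψ) (ν := ν)) (scalarFun_conj he hS)
      refine ⟨⟨V, hV, ?_⟩, ?_⟩
      · funext g
        exact (character_eq he h2 hψ hS V hSν g).trans
          (congrArg (fun j => (Fintype.card F : ℂ) ^ j * _) hk)
      · change _ * _ = _
        rw [scalarFun_one he, mul_one]
  have hdual : ∀ S : {S : Matrix (Fin d) (Fin d) F // Sᵀ = S ∧ m * S.rank = k},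
      Nat.card (AddChar (rad m S.1) ℂ) = Fintype.card F ^ (2 * (m * d - k)) := by
    rintro ⟨S, hS, hk⟩
    have := Fintype.ofFinite (rad m S)
    rw [Nat.card_eq_fintype_card, AddChar.card_eq, ← Nat.card_eq_fintype_card, card_rad,
      mul_assoc, Nat.mul_sub m, hk]
  rw [hrange, Nat.card_range_of_injective hf, Nat.card_sigma,
    Finset.sum_congr rfl fun S _ => hdual S, Finset.sum_const, Finset.card_univ, smul_eq_mul,
    Nat.card_eq_fintype_card]

end Characters

section Radical

variable {F : Type} [Field F] {n d : ℕ}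

lemma Umat_transpose_inv (A : Matrix (Fin d) (Fin (n - d)) F) :
    ((Umat F n d A)ᵀ)⁻¹ = Matrix.fromBlocks 1 0 (-Aᵀ) 1 := by
  refine Matrix.inv_eq_right_inv ?_
  rw [Umat, Matrix.fromBlocks_transpose, Matrix.fromBlocks_multiply, ← Matrix.fromBlocks_one]
  simp

/-- The element of the unipotent radical with coordinates `(A, B, C)`. -/
def radicalMatrix (x : Coord F d (n - d)) : Matrix (κ n d) (κ n d) F :=
  Matrix.fromBlocks (Umat F n d x.1)
    (Matrix.fromBlocks x.2.2.1 x.2.1 x.2.1ᵀ 0 * Matrix.fromBlocks 1 0 (-x.1ᵀ) 1) 0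
    (Matrix.fromBlocks 1 0 (-x.1ᵀ) 1)

lemma radicalMatrix_mul (x y : Coord F d (n - d)) :
    radicalMatrix x * radicalMatrix y = radicalMatrix (coordMul x y) := by
  obtain ⟨A, B, C⟩ := x
  obtain ⟨A', B', C'⟩ := y
  simp only [radicalMatrix, Umat, coordMul, cross, Matrix.fromBlocks_multiply,
    AddSubgroup.coe_add]
  simp only [Matrix.fromBlocks_add, Matrix.mul_add, Matrix.add_mul, Matrix.mul_zero,
    Matrix.zero_mul, Matrix.mul_one, Matrix.one_mul, Matrix.mul_neg,
    Matrix.transpose_add, zero_add, add_zero, neg_zero, neg_add, Matrix.fromBlocks_inj,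
    true_and, and_true]
  exact ⟨add_comm _ _, by abel, add_comm _ _, add_comm _ _⟩

lemma radicalMatrix_zero : radicalMatrix (0 : Coord F d (n - d)) = 1 := by
  simp [radicalMatrix, Umat, Matrix.fromBlocks_one]

lemma radicalMatrix_injective :
    Function.Injective (radicalMatrix : Coord F d (n - d) → Matrix (κ n d) (κ n d) F) := by
  rintro ⟨A, B, C⟩ ⟨A', B', C'⟩ h
  simp only [radicalMatrix, Umat, Matrix.fromBlocks_multiply, Matrix.fromBlocks_inj] at h
  obtain ⟨⟨-, hA, -, -⟩, ⟨hC, hB, -, -⟩, -, -⟩ := h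
  subst hA
  simp only [Matrix.mul_zero, Matrix.mul_one, zero_add] at hB
  subst hB
  simp only [Matrix.mul_one, add_left_inj] at hC
  rw [Subtype.ext hC]

lemma mem_RuC_iff {g : Matrix (κ n d) (κ n d) F} :
    g ∈ RuC F n d ↔ ∃ x : Coord F d (n - d), radicalMatrix x = g := by
  constructor
  · rintro ⟨A, V, ⟨hV, hV0⟩, rfl⟩
    have hblock : ∀ i j, V i j = V j i := fun i j => congrFun (congrFun hV j) i
    refine ⟨(A, V.toBlocks₁₂, ⟨V.toBlocks₁₁, ?_⟩), ?_⟩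
    · ext i j
      exact hblock _ _
    · rw [radicalMatrix, Umat_transpose_inv]
      have hVb : V = Matrix.fromBlocks V.toBlocks₁₁ V.toBlocks₁₂ V.toBlocks₁₂ᵀ 0 := by
        conv_lhs => rw [← Matrix.fromBlocks_toBlocks V]
        congr 1
        · ext i j
          exact hblock _ _
        · ext i j
          exact hV0 i j
      rw [← hVb]
  · rintro ⟨⟨A, B, C⟩, rfl⟩
    refine ⟨A, Matrix.fromBlocks C.1 B Bᵀ 0, ⟨?_, fun i j => rfl⟩, ?_⟩
    · have hC : C.1ᵀ = C.1 := C.2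
      rw [Matrix.fromBlocks_transpose, hC, Matrix.transpose_transpose, Matrix.transpose_zero]
    · rw [radicalMatrix, Umat_transpose_inv]

lemma exists_coord_equiv (G : Subgroup (Matrix (κ n d) (κ n d) F)ˣ)
    (hG : ∀ u : (Matrix (κ n d) (κ n d) F)ˣ,
      u ∈ G ↔ (u : Matrix (κ n d) (κ n d) F) ∈ RuC F n d) :
    ∃ e : Coord F d (n - d) ≃ G, ∀ x y, e x * e y = e (coordMul x y) := by
  have hinv : ∀ x : Coord F d (n - d),
      coordMul x (-x.1, -x.2.1, -x.2.2 + cross x.1 x.2.1) = 0 ∧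
      coordMul (-x.1, -x.2.1, -x.2.2 + cross x.1 x.2.1) x = 0 := by
    have hneg : ∀ A B : Matrix (Fin d) (Fin (n - d)) F,
        cross A (-B) = -cross A B ∧ cross (-A) B = -cross A B := fun A B =>
      ⟨Subtype.ext (by simp [cross, add_comm]), Subtype.ext (by simp [cross, add_comm])⟩
    intro x
    simp [coordMul, (hneg _ _).1, (hneg _ _).2]
  let u : Coord F d (n - d) → (Matrix (κ n d) (κ n d) F)ˣ := fun x =>
    { val := radicalMatrix x
      inv := radicalMatrix (-x.1, -x.2.1, -x.2.2 + cross x.1 x.2.1)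
      val_inv := by rw [radicalMatrix_mul, (hinv x).1, radicalMatrix_zero]
      inv_val := by rw [radicalMatrix_mul, (hinv x).2, radicalMatrix_zero] }
  refine ⟨Equiv.ofBijective (fun x => ⟨u x, (hG _).2 (mem_RuC_iff.2 ⟨x, rfl⟩)⟩) ⟨?_, ?_⟩, ?_⟩
  · intro x y h
    exact radicalMatrix_injective (congrArg (fun g : G => g.1.1) h)
  · rintro ⟨g, hg⟩
    obtain ⟨x, hx⟩ := mem_RuC_iff.1 ((hG g).1 hg)
    exact ⟨x, Subtype.ext (Units.ext hx)⟩
  · intro x y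
    exact Subtype.ext (Units.ext (radicalMatrix_mul x y))

end Radical

/-- for fixed `n, d, e`, there is a polynomial `P` with non-negative integer
coefficients such that for every power `q` of an odd prime, the number of irreducible
characters of `R_u^{C,d}` over `F_q` of degree `q^e` equals `P(q−1)`. -/
theorem ruC_char_count_polynomial
    (n d e : ℕ) (hd : 1 ≤ d) (hdn : d < n) :
    ∃ P : Polynomial ℕ, ∀ (p k q : ℕ), p.Prime → Odd p → 1 ≤ k → q = p ^ k →
      ∀ (F : Type) [Field F] [Fintype F], Fintype.card F = q →
      ∀ (G : Subgroup (Matrix (κ n d) (κ n d) F)ˣ),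
        (∀ u : (Matrix (κ n d) (κ n d) F)ˣ,
          u ∈ G ↔ (u : Matrix (κ n d) (κ n d) F) ∈ RuC F n d) →
        Nat.card {χ : ↥G → ℂ |
            (∃ V : FDRep ℂ ↥G, CategoryTheory.Simple V ∧ FDRep.character V = χ) ∧
            χ 1 = (q : ℂ) ^ e} = P.eval (q - 1) := by
  obtain ⟨P, hP⟩ := exists_card_symm_rank_polynomial d
  have hm : 0 < n - d := by omega
  have main : ∀ (p k q : ℕ), p.Prime → Odd p → 1 ≤ k → q = p ^ k →
      ∀ (F : Type) [Field F] [Fintype F], Fintype.card F = q →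
      ∀ (G : Subgroup (Matrix (κ n d) (κ n d) F)ˣ),
        (∀ u : (Matrix (κ n d) (κ n d) F)ˣ,
          u ∈ G ↔ (u : Matrix (κ n d) (κ n d) F) ∈ RuC F n d) →
        Nat.card {χ : ↥G → ℂ |
            (∃ V : FDRep ℂ ↥G, CategoryTheory.Simple V ∧ FDRep.character V = χ) ∧
            χ 1 = (q : ℂ) ^ e} =
        Nat.card {S : Matrix (Fin d) (Fin d) F // Sᵀ = S ∧ (n - d) * S.rank = e} *
          Fintype.card F ^ (2 * ((n - d) * d - e)) := by
    rintro p k q hp hodd hk rfl F _ _ hcard G hG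
    obtain ⟨ε, hε⟩ := exists_coord_equiv G hG
    have h2 : (2 : F) ≠ 0 := by
      intro h
      have h2' : ringChar F = 2 :=
        CharP.ringChar_of_prime_eq_zero Nat.prime_two (by exact_mod_cast h)
      have h3 := FiniteField.even_card_of_char_two h2'
      have h4 : Odd (Fintype.card F) := hcard ▸ hodd.pow
      exact Nat.not_even_iff_odd.2 h4 (Nat.even_iff.2 h3)
    rw [← hcard]
    exact card_characters hε h2 e
  by_cases hdvd : n - d ∣ e
  · obtain ⟨r, rfl⟩ := hdvd
    refine ⟨P r * (Polynomial.X + 1) ^ (2 * ((n - d) * d - (n - d) * r)), ?_⟩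
    intro p k q hp hodd hk hq F _ _ hcard G hG
    have h1 : q - 1 + 1 = q := Nat.sub_add_cancel (hcard ▸ Fintype.card_pos)
    rw [main p k q hp hodd hk hq F hcard G hG, Polynomial.eval_mul, Polynomial.eval_pow,
      Polynomial.eval_add, Polynomial.eval_X, Polynomial.eval_one, h1, ← hcard, ← hP r F]
    congr 1
    exact Nat.card_congr (Equiv.subtypeEquivRight fun S => by rw [Nat.mul_right_inj hm.ne'])
  · refine ⟨0, ?_⟩
    intro p k q hp hodd hk hq F _ _ hcard G hG
    have : IsEmpty {S : Matrix (Fin d) (Fin d) F // Sᵀ = S ∧ (n - d) * S.rank = e} :=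
      ⟨fun S => hdvd ⟨_, S.2.2.symm⟩⟩
    rw [main p k q hp hodd hk hq F hcard G hG, Nat.card_of_isEmpty, zero_mul, Polynomial.eval_zero]

end SpUnipotentRadical
end

section
/- Fix integers n, d, e with 1 ≤ d < n−1 and e ≥ 0. Then there exists a polynomial P with non-negative integer coefficients such that for every power q of an odd prime, the number of irreducible characters of R_u^{D,d} (defined over 𝔽_q) of degree q^e equals P(q−1). -/
open Matrix
namespace SOUnipotentRadical

/-- The index type for `n×n` matrices, split as `d + (n−d)`. -/
abbrev ι (n d : ℕ) := Fin d ⊕ Fin (n - d)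

/-- The index type for `2n×2n` matrices, split as `n + n`. -/
abbrev κ (n d : ℕ) := ι n d ⊕ ι n d

/-- `U(A) = [[I_d, A],[0, I_{n−d}]]`. -/
def Umat (F : Type) [Field F] (n d : ℕ) (A : Matrix (Fin d) (Fin (n - d)) F) :
    Matrix (ι n d) (ι n d) F :=
  Matrix.fromBlocks 1 A 0 1

/-- `K_d`: skew-symmetric `n×n` matrices whose lower-right `(n−d)×(n−d)` block is zero. -/
def Kd (F : Type) [Field F] (n d : ℕ) : Set (Matrix (ι n d) (ι n d) F) :=
  {V | Vᵀ = -V ∧ ∀ i j, V (Sum.inr i) (Sum.inr j) = 0}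

/-- `R_u^{D,d} = { [[U(A), V·U(A)⁻ᵀ],[0, U(A)⁻ᵀ]] | A ∈ Mat_{d×(n−d)}, V ∈ K_d }`. -/
def RuD (F : Type) [Field F] (n d : ℕ) : Set (Matrix (κ n d) (κ n d) F) :=
  {g | ∃ (A : Matrix (Fin d) (Fin (n - d)) F) (V : Matrix (ι n d) (ι n d) F),
    V ∈ Kd F n d ∧
    g = Matrix.fromBlocks (Umat F n d A) (V * ((Umat F n d A)ᵀ)⁻¹) 0 ((Umat F n d A)ᵀ)⁻¹}

section Schur

variable {G : Type} [Group G] [Finite G]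

/-- Schur's lemma for a simple object of `FDRep ℂ G`, phrased with linear endomorphisms. -/
theorem exists_eq_smul_one_of_commute (V : FDRep ℂ G) [CategoryTheory.Simple V]
    (T : Module.End ℂ V) (hT : ∀ g, T * V.ρ g = V.ρ g * T) : ∃ c : ℂ, T = c • 1 := by
  have := Fintype.ofFinite G
  have hinv := invertibleOfNonzero (NeZero.ne (Nat.card G : ℂ))
  have hnorm := (FDRep.simple_iff_char_is_norm_one V).1 inferInstance
  have hrank := Representation.card_inv_mul_sum_char_mul_char_eq_finrank V.ρ V.ρ
  have hsum : ∑ g : G, Representation.character V.ρ g * Representation.character V.ρ g⁻¹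
      = Nat.card G := hnorm
  rw [hsum, inv_mul_cancel_of_invertible] at hrank
  have hone : Module.finrank ℂ (Representation.IntertwiningMap V.ρ V.ρ) = 1 := by
    exact_mod_cast hrank.symm
  have hne : (Representation.IntertwiningMap.id V.ρ) ≠ 0 := by
    intro h0
    have hsub : Subsingleton (Representation.IntertwiningMap V.ρ V.ρ) := by
      refine ⟨fun a b => ?_⟩
      ext v
      have hv : v = 0 := by
        simpa using congrArg (fun f : Representation.IntertwiningMap V.ρ V.ρ => f v) h0
      rw [hv]; simp
    rw [Module.finrank_zero_of_subsingleton] at hone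
    exact zero_ne_one hone
  obtain ⟨c, hc⟩ := (finrank_eq_one_iff_of_nonzero' _ hne).1 hone ⟨T, fun g => hT g⟩
  refine ⟨c, ?_⟩
  ext v
  simpa using (congrArg (fun f : Representation.IntertwiningMap V.ρ V.ρ => f v) hc).symm

/-- The underlying space of a simple object of `FDRep ℂ G` has positive dimension. -/
theorem finrank_pos_of_simple (V : FDRep ℂ G) [CategoryTheory.Simple V] :
    0 < Module.finrank ℂ V := by
  have := Fintype.ofFinite G
  have hnorm := (FDRep.simple_iff_char_is_norm_one V).1 inferInstance
  by_contra hzero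
  have hsub : Subsingleton V := Module.finrank_zero_iff.1 (Nat.eq_zero_of_not_pos hzero)
  have hchar : ∀ g, V.character g = 0 := fun g => by
    have : V.ρ g = 0 := LinearMap.ext fun v => Subsingleton.elim _ _
    simp [FDRep.character, this]
  simp only [hchar, mul_zero, Finset.sum_const_zero] at hnorm
  exact (NeZero.ne (Nat.card G : ℂ)) hnorm.symm

/-- If some group elements act on a nonzero representation by prescribed scalars, then they act
by the same scalars on some simple representation. -/
theorem exists_simple_of_scalar (s : Set (G × ℂ)) {E : Type} [AddCommGroup E] [Module ℂ E]
    [FiniteDimensional ℂ E] [Nontrivial E] (ρ : Representation ℂ G E)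
    (hρ : ∀ p ∈ s, ρ p.1 = p.2 • 1) :
    ∃ V : FDRep ℂ G, CategoryTheory.Simple V ∧ ∀ p ∈ s, V.ρ p.1 = p.2 • 1 := by
  have := Fintype.ofFinite G
  have hinv := invertibleOfNonzero (NeZero.ne (Nat.card G : ℂ))
  induction hN : Module.finrank ℂ E using Nat.strong_induction_on generalizing E with
  | _ N ih =>
  by_cases hirr : Representation.IsIrreducible ρ
  · refine ⟨FDRep.of ρ, ?_, hρ⟩
    rw [FDRep.simple_iff_char_is_norm_one]
    have horth := Representation.char_orthonormal ρ ρ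
    rw [if_pos ⟨Representation.Equiv.refl ρ⟩, inv_mul_eq_one₀ (NeZero.ne _)] at horth
    exact horth.symm
  · obtain ⟨U, hbot, htop⟩ : ∃ U : Subrepresentation ρ, U ≠ ⊥ ∧ U ≠ ⊤ := by
      by_contra! hall
      refine hirr ?_
      have : Nontrivial (Subrepresentation ρ) := by
        refine ⟨⊥, ⊤, fun h => ?_⟩
        have h' := congrArg Subrepresentation.toSubmodule h
        exact bot_ne_top (α := Submodule ℂ E) h'
      exact ⟨fun U => or_iff_not_imp_left.2 (hall U)⟩
    have hlt : U.toSubmodule ≠ ⊤ := fun h => htop (Subrepresentation.toSubmodule_injective h)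
    have : Nontrivial U.toSubmodule := (Submodule.nontrivial_iff_ne_bot).2
      fun h => hbot (Subrepresentation.toSubmodule_injective h)
    refine ih _ (hN ▸ Submodule.finrank_lt hlt) U.toRepresentation (fun p hp => ?_) rfl
    ext v
    have := congrArg (fun f : Module.End ℂ E => f (v : E)) (hρ p hp)
    simpa [Subrepresentation.toRepresentation] using this

end Schur

section Heisenberg

variable {G X Z : Type} [Group G] [AddCommGroup X] [AddCommGroup Z]

/-- Coordinates exhibiting `G` as the Heisenberg-type group `X × Z` with multiplication
`(x, c) * (y, d) = (x + y, c + d + β x y)`, where `β` is alternating. -/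
structure HeisenbergCoord (G : Type) [Group G] (β : X →+ X →+ Z) extends (X × Z) ≃ G where
  alternating : ∀ x, β x x = 0
  mul_apply : ∀ a b, toFun a * toFun b = toFun (a.1 + b.1, a.2 + b.2 + β a.1 b.1)

/-- The radical of the bicharacter `l ∘ β`. -/
def radical (β : X →+ X →+ Z) (l : AddChar Z ℂ) : AddSubgroup X where
  carrier := {x | ∀ y, l (β x y) = 1}
  zero_mem' := fun y => by simp
  add_mem' := fun {a b} ha hb y => by
    simp [AddChar.map_add_eq_mul, ha y, hb y]
  neg_mem' := fun {a} ha y => by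
    simp [AddChar.map_neg_eq_inv, ha y]

theorem mem_radical {β : X →+ X →+ Z} {l : AddChar Z ℂ} {x : X} :
    x ∈ radical β l ↔ ∀ y, l (β x y) = 1 := Iff.rfl

namespace HeisenbergCoord

variable {β : X →+ X →+ Z} (φ : HeisenbergCoord G β)

theorem mul_mk (x y : X) (c d : Z) :
    φ.toEquiv (x, c) * φ.toEquiv (y, d) = φ.toEquiv (x + y, c + d + β x y) :=
  φ.mul_apply (x, c) (y, d)

include φ in
theorem skew (x y : X) : β y x = -β x y := by
  have h := φ.alternating (x + y)
  simp only [map_add, AddMonoidHom.add_apply, φ.alternating, zero_add, add_zero] at h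
  exact eq_neg_of_add_eq_zero_left h

theorem map_zero : φ.toEquiv (0, 0) = 1 := by
  have h := φ.mul_mk 0 0 0 0
  simpa using h

theorem inv_mk (x : X) (c : Z) : (φ.toEquiv (x, c))⁻¹ = φ.toEquiv (-x, -c) := by
  rw [inv_eq_iff_mul_eq_one, φ.mul_mk, ← φ.map_zero]
  simp [φ.alternating]

theorem mk_eq_central_mul (x : X) (c : Z) :
    φ.toEquiv (x, c) = φ.toEquiv (0, c) * φ.toEquiv (x, 0) := by
  simp [φ.mul_mk]

theorem central_commute (c : Z) (g : G) :
    φ.toEquiv (0, c) * g = g * φ.toEquiv (0, c) := by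
  obtain ⟨⟨x, d⟩, rfl⟩ := φ.toEquiv.surjective g
  simp [φ.mul_mk, add_comm]

theorem mul_swap (x y : X) (c d : Z) :
    φ.toEquiv (x, c) * φ.toEquiv (y, d) =
      φ.toEquiv (0, β (x + x) y) * (φ.toEquiv (y, d) * φ.toEquiv (x, c)) := by
  simp only [φ.mul_mk, φ.skew x y, map_add, AddMonoidHom.add_apply, _root_.map_zero,
    AddMonoidHom.zero_apply]
  congr 2 <;> abel

/-- The class function attached to a character `l` of `Z`, a character `m` of the radical, and a
degree `D`. -/
noncomputable def charFun (l : AddChar Z ℂ) (m : AddChar (radical β l) ℂ) (D : ℂ) : G → ℂ :=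
  open Classical in fun g =>
    if h : (φ.toEquiv.symm g).1 ∈ radical β l then
      D * (l (φ.toEquiv.symm g).2 * m ⟨(φ.toEquiv.symm g).1, h⟩) else 0

theorem charFun_of_mem (l : AddChar Z ℂ) (m : AddChar (radical β l) ℂ) (D : ℂ) {x : X}
    (hx : x ∈ radical β l) (c : Z) :
    φ.charFun l m D (φ.toEquiv (x, c)) = D * (l c * m ⟨x, hx⟩) := by
  simp [charFun, hx]

theorem charFun_of_notMem (l : AddChar Z ℂ) (m : AddChar (radical β l) ℂ) (D : ℂ) {x : X}
    (hx : x ∉ radical β l) (c : Z) :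
    φ.charFun l m D (φ.toEquiv (x, c)) = 0 := by
  simp [charFun, hx]

theorem charFun_one (l : AddChar Z ℂ) (m : AddChar (radical β l) ℂ) (D : ℂ) :
    φ.charFun l m D 1 = D := by
  rw [← φ.map_zero, φ.charFun_of_mem l m D (zero_mem _)]
  have : m ⟨0, zero_mem _⟩ = 1 := m.map_zero_eq_one
  simp [this]

theorem charFun_injective {D : ℂ} (hD : D ≠ 0) {l l' : AddChar Z ℂ}
    {m : AddChar (radical β l) ℂ} {m' : AddChar (radical β l') ℂ}
    (h : φ.charFun l m D = φ.charFun l' m' D) :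
    (⟨l, m⟩ : Σ l : AddChar Z ℂ, AddChar (radical β l) ℂ) = ⟨l', m'⟩ := by
  obtain rfl : l = l' := by
    ext c
    have hc := congrFun h (φ.toEquiv (0, c))
    rw [φ.charFun_of_mem l m D (zero_mem _), φ.charFun_of_mem l' m' D (zero_mem _)] at hc
    have h1 : m ⟨0, zero_mem _⟩ = 1 := m.map_zero_eq_one
    have h2 : m' ⟨0, zero_mem _⟩ = 1 := m'.map_zero_eq_one
    simpa [h1, h2, hD] using hc
  obtain rfl : m = m' := by
    ext ⟨x, hx⟩
    have hc := congrFun h (φ.toEquiv (x, 0))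
    rw [φ.charFun_of_mem l m D hx, φ.charFun_of_mem l m' D hx] at hc
    simpa [hD] using hc
  rfl

section Representations

/-- Every simple representation has a character of the form `charFun`. -/
theorem exists_character_eq [Fintype X] [Fintype Z] (hdouble : ∀ x : X, ∃ y, y + y = x)
    (V : FDRep ℂ G) [CategoryTheory.Simple V] :
    ∃ (l : AddChar Z ℂ) (m : AddChar (radical β l) ℂ),
      Module.finrank ℂ V ^ 2 * Nat.card (radical β l) = Nat.card X ∧
      V.character = φ.charFun l m (Module.finrank ℂ V) := by
  have : Fintype G := Fintype.ofEquiv _ φ.toEquiv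
  have hpos := finrank_pos_of_simple V
  have : Nontrivial V := Module.finrank_pos_iff.1 hpos
  have hinj : Function.Injective (fun c : ℂ => c • (1 : Module.End ℂ V)) :=
    smul_left_injective ℂ one_ne_zero
  choose l hl using fun c => exists_eq_smul_one_of_commute V (V.ρ (φ.toEquiv (0, c)))
    fun g => by rw [← map_mul, ← map_mul, φ.central_commute]
  let L : AddChar Z ℂ :=
    { toFun := l
      map_zero_eq_one' := hinj (by simp only [← hl, φ.map_zero, map_one, one_smul])
      map_add_eq_mul' := fun a b => hinj (by
        have : φ.toEquiv (0, a + b) = φ.toEquiv (0, a) * φ.toEquiv (0, b) := by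
          simp [φ.mul_mk]
        simp only [← hl, this, map_mul]
        rw [hl a, hl b]
        simp [smul_smul, mul_comm]) }
  have hL : ∀ c, V.ρ (φ.toEquiv (0, c)) = L c • 1 := hl
  choose m hm using fun x : radical β L =>
    exists_eq_smul_one_of_commute V (V.ρ (φ.toEquiv (x, 0))) fun g => by
      obtain ⟨⟨y, d⟩, rfl⟩ := φ.toEquiv.surjective g
      rw [← map_mul V.ρ, ← map_mul V.ρ, φ.mul_swap, map_mul, hL, map_add, AddMonoidHom.add_apply,
        AddChar.map_add_eq_mul, x.2 y]
      simp
  let M : AddChar (radical β L) ℂ :=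
    { toFun := m
      map_zero_eq_one' := hinj (by
        simp only [← hm, AddSubgroup.coe_zero, φ.map_zero, map_one, one_smul])
      map_add_eq_mul' := fun a b => hinj (by
        have hab : V.ρ (φ.toEquiv ((a : X) + b, 0)) =
            V.ρ (φ.toEquiv ((a : X), 0) * φ.toEquiv ((b : X), 0)) := by
          rw [φ.mul_mk, φ.mk_eq_central_mul _ (0 + 0 + _), map_mul, hL, zero_add, zero_add, a.2 b,
            one_smul, one_mul]
        simp only [← hm, AddSubgroup.coe_add, hab, map_mul]
        rw [hm a, hm b]
        simp [smul_smul, mul_comm]) }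
  have hM : ∀ x : radical β L, V.ρ (φ.toEquiv (x, 0)) = M x • 1 := hm
  have hchar : V.character = φ.charFun L M (Module.finrank ℂ V) := by
    ext g
    obtain ⟨⟨x, c⟩, rfl⟩ := φ.toEquiv.surjective g
    by_cases hx : x ∈ radical β L
    · rw [φ.charFun_of_mem L M _ hx, FDRep.character, φ.mk_eq_central_mul, map_mul, hL,
        hM ⟨x, hx⟩]
      simp
      ring
    · rw [φ.charFun_of_notMem L M _ hx]
      obtain ⟨y, hy⟩ : ∃ y, L (β x y) ≠ 1 := by simpa [mem_radical] using hx
      obtain ⟨z, rfl⟩ := hdouble y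
      have hconj := V.char_conj (φ.toEquiv (x, c)) (φ.toEquiv (z, 0))
      rw [φ.mul_swap, mul_assoc, mul_assoc, mul_inv_cancel, mul_one, FDRep.character, map_mul, hL,
        φ.skew x, AddChar.map_neg_eq_inv, smul_mul_assoc, one_mul, map_smul, smul_eq_mul] at hconj
      by_contra hne
      exact hy (inv_eq_one.1 (mul_right_cancel₀ hne (hconj.trans (one_mul _).symm)))
  refine ⟨L, M, ?_, hchar⟩
  have hnorm := (FDRep.simple_iff_char_is_norm_one V).1 inferInstance
  classical
  have hterm : ∀ a : X × Z, V.character (φ.toEquiv a) * V.character (φ.toEquiv a)⁻¹ =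
      if a.1 ∈ radical β L then (Module.finrank ℂ V : ℂ) ^ 2 else 0 := by
    rintro ⟨x, c⟩
    rw [φ.inv_mk, hchar]
    by_cases hx : x ∈ radical β L
    · have hneg : (⟨-x, neg_mem hx⟩ : radical β L) = -⟨x, hx⟩ := rfl
      rw [φ.charFun_of_mem L M _ hx, φ.charFun_of_mem L M _ (neg_mem hx), if_pos hx, hneg,
        AddChar.map_neg_eq_inv, AddChar.map_neg_eq_inv]
      have h1 : L c ≠ 0 := (L.val_isUnit c).ne_zero
      have h2 : M ⟨x, hx⟩ ≠ 0 := (M.val_isUnit _).ne_zero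
      field_simp
    · rw [φ.charFun_of_notMem L M _ hx, if_neg hx, zero_mul]
  rw [← φ.toEquiv.sum_comp, Finset.sum_congr rfl fun a _ => hterm a, Fintype.sum_prod_type,
    Finset.sum_comm] at hnorm
  simp only [← Finset.sum_filter, Finset.sum_const] at hnorm
  have hcard : (Finset.univ.filter (· ∈ radical β L)).card = Nat.card (radical β L) := by
    rw [Nat.card_eq_fintype_card, Fintype.card_subtype]
  rw [hcard, ← Nat.card_congr φ.toEquiv, Nat.card_prod, Finset.card_univ,
    ← Nat.card_eq_fintype_card] at hnorm
  have hZ : (Nat.card Z : ℂ) ≠ 0 := by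
    exact_mod_cast Nat.card_pos.ne'
  simp only [nsmul_eq_mul, Nat.cast_mul] at hnorm
  rw [mul_comm (Nat.card X : ℂ)] at hnorm
  have := mul_left_cancel₀ hZ hnorm
  rw [mul_comm]
  exact_mod_cast this

/-- The right regular representation on functions. -/
noncomputable def rightRegular (G : Type) [Group G] : Representation ℂ G (G → ℂ) where
  toFun g := LinearMap.funLeft ℂ ℂ (· * g)
  map_one' := by ext; simp [LinearMap.funLeft]
  map_mul' a b := by
    ext; simp [LinearMap.funLeft, mul_assoc]

theorem rightRegular_apply (g h : G) (f : G → ℂ) : rightRegular G g f h = f (h * g) := rfl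

/-- The functions on which the preimage of the radical acts through the character
`(x, c) ↦ l c * m x`. -/
def isotypic (l : AddChar Z ℂ) (m : AddChar (radical β l) ℂ) :
    Subrepresentation (rightRegular G) where
  toSubmodule :=
    { carrier := {f | ∀ (x : radical β l) (c : Z) (g : G),
        f (g * φ.toEquiv (x, c)) = l c * m x * f g}
      zero_mem' := fun x c g => by simp
      add_mem' := fun {a b} ha hb x c g => by
        simp only [Pi.add_apply, ha x c g, hb x c g, mul_add]
      smul_mem' := fun a f hf x c g => by
        simp only [Pi.smul_apply, hf x c g, smul_eq_mul]; ring }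
  apply_mem_toSubmodule h f hf x c g := by
    simp only [rightRegular_apply]
    obtain ⟨⟨y, d⟩, rfl⟩ := φ.toEquiv.surjective h
    have hswap : g * φ.toEquiv ((x : X), c) * φ.toEquiv (y, d) =
        g * φ.toEquiv (y, d) * φ.toEquiv ((x : X), c + β (x + x) y) := by
      rw [mul_assoc, φ.mul_swap, φ.central_commute, mul_assoc, mul_assoc, φ.mul_mk]
      simp
    rw [hswap, hf, AddChar.map_add_eq_mul, map_add, AddMonoidHom.add_apply,
      AddChar.map_add_eq_mul, x.2 y]
    ring

theorem charFun_mem_isotypic (l : AddChar Z ℂ) (m : AddChar (radical β l) ℂ) :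
    φ.charFun l m 1 ∈ (φ.isotypic l m).toSubmodule := by
  intro x c g
  obtain ⟨⟨y, d⟩, rfl⟩ := φ.toEquiv.surjective g
  rw [φ.mul_mk]
  by_cases hy : y ∈ radical β l
  · have hadd : (⟨y + x, add_mem hy x.2⟩ : radical β l) = ⟨y, hy⟩ + x := rfl
    rw [φ.charFun_of_mem l m 1 hy, φ.charFun_of_mem l m 1 (add_mem hy x.2), hadd]
    simp only [AddChar.map_add_eq_mul, hy x]
    ring
  · rw [φ.charFun_of_notMem l m 1 hy, φ.charFun_of_notMem l m 1, mul_zero]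
    rwa [AddSubgroup.add_mem_cancel_right _ x.2]

/-- Every pair of characters `l`, `m` occurs in some simple representation. -/
theorem exists_simple_character_eq [Fintype X] [Fintype Z] (hdouble : ∀ x : X, ∃ y, y + y = x)
    (l : AddChar Z ℂ) (m : AddChar (radical β l) ℂ) :
    ∃ V : FDRep ℂ G, CategoryTheory.Simple V ∧
      Module.finrank ℂ V ^ 2 * Nat.card (radical β l) = Nat.card X ∧
      V.character = φ.charFun l m (Module.finrank ℂ V) := by
  have : Finite G := Finite.of_equiv _ φ.toEquiv
  have : Nontrivial (φ.isotypic l m).toSubmodule := by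
    refine ⟨⟨_, φ.charFun_mem_isotypic l m⟩, 0, fun h => ?_⟩
    have h1 := congrFun (congrArg Subtype.val h) 1
    simp only [φ.charFun_one] at h1
    exact one_ne_zero h1
  obtain ⟨V, hV, hact⟩ := exists_simple_of_scalar
    (Set.range fun a : radical β l × Z => (φ.toEquiv ((a.1 : X), a.2), l a.2 * m a.1))
    (φ.isotypic l m).toRepresentation (by
      rintro _ ⟨⟨x, c⟩, rfl⟩
      ext f g
      exact f.2 x c g)
  refine ⟨V, hV, ?_⟩
  obtain ⟨l', m', hcard, hchar⟩ := φ.exists_character_eq hdouble V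
  have hD : (Module.finrank ℂ V : ℂ) ≠ 0 := by exact_mod_cast (finrank_pos_of_simple V).ne'
  have hval : ∀ (x : radical β l) (c : Z), φ.charFun l' m' (Module.finrank ℂ V)
      (φ.toEquiv ((x : X), c)) = Module.finrank ℂ V * (l c * m x) := fun x c => by
    rw [← hchar, FDRep.character, hact _ ⟨(x, c), rfl⟩]
    simp [mul_comm]
  obtain rfl : l = l' := by
    ext c
    have hc := hval 0 c
    rw [AddSubgroup.coe_zero, φ.charFun_of_mem l' m' _ (zero_mem _)] at hc
    have h2 : m' ⟨0, zero_mem _⟩ = 1 := m'.map_zero_eq_one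
    simpa [h2, hD] using hc.symm
  obtain rfl : m = m' := by
    ext x
    have hc := hval x 0
    rw [φ.charFun_of_mem l m' _ x.2] at hc
    simpa [hD] using hc.symm
  exact ⟨hcard, hchar⟩

include φ in
open Classical in
/-- The number of irreducible characters of given degree of a Heisenberg-type group. -/
theorem card_irreducible_characters [Fintype X] [Fintype Z]
    (hdouble : ∀ x : X, ∃ y, y + y = x) (D : ℕ) (hD : D ≠ 0) :
    Nat.card {χ : G → ℂ | (∃ V : FDRep ℂ G, CategoryTheory.Simple V ∧ FDRep.character V = χ) ∧
        χ 1 = D} =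
      ∑ l : AddChar Z ℂ, if D ^ 2 * Nat.card (radical β l) = Nat.card X
        then Nat.card (radical β l) else 0 := by
  have hD' : (D : ℂ) ≠ 0 := by exact_mod_cast hD
  let T := {l : AddChar Z ℂ // D ^ 2 * Nat.card (radical β l) = Nat.card X}
  let f : (Σ l : T, AddChar (radical β l.1) ℂ) → (G → ℂ) := fun a => φ.charFun a.1.1 a.2 D
  have hf : Function.Injective f := by
    rintro ⟨⟨l, hl⟩, m⟩ ⟨⟨l', hl'⟩, m'⟩ h
    have := φ.charFun_injective hD' h
    cases this
    rfl
  have hrange : {χ : G → ℂ | (∃ V : FDRep ℂ G, CategoryTheory.Simple V ∧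
      FDRep.character V = χ) ∧ χ 1 = D} = Set.range f := by
    ext χ
    constructor
    · rintro ⟨⟨V, hV, rfl⟩, hdeg⟩
      obtain ⟨l, m, hcard, hchar⟩ := φ.exists_character_eq hdouble V
      rw [FDRep.char_one] at hdeg
      have hdeg' : Module.finrank ℂ V = D := by exact_mod_cast hdeg
      rw [hdeg'] at hcard hchar
      exact ⟨⟨⟨l, hcard⟩, m⟩, hchar.symm⟩
    · rintro ⟨⟨⟨l, hl⟩, m⟩, rfl⟩
      obtain ⟨V, hV, hcard, hchar⟩ := φ.exists_simple_character_eq hdouble l m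
      have hdeg : Module.finrank ℂ V = D := by
        have h := hcard.trans hl.symm
        have hpos : 0 < Nat.card (radical β l) := Nat.card_pos
        exact Nat.pow_left_injective (n := 2) (by norm_num) (Nat.eq_of_mul_eq_mul_right hpos h)
      rw [hdeg] at hchar
      exact ⟨⟨V, hV, hchar⟩, φ.charFun_one l m D⟩
  rw [hrange, Nat.card_congr (Equiv.ofInjective f hf).symm, Nat.card_sigma,
    ← Finset.sum_filter, ← Finset.sum_subtype_eq_sum_filter, Finset.subtype_univ]
  refine Finset.sum_congr rfl fun l _ => ?_
  rw [Nat.card_eq_fintype_card, AddChar.card_eq]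
  exact Nat.card_eq_fintype_card.symm

end Representations

end HeisenbergCoord

end Heisenberg

section SkewCount

variable {F : Type} [Field F]

/-- The additive group of skew-symmetric `d×d` matrices. -/
def skewMatrices (F : Type) [Field F] (d : ℕ) : AddSubgroup (Matrix (Fin d) (Fin d) F) where
  carrier := {S | Sᵀ = -S}
  zero_mem' := by simp
  add_mem' := fun {A B} hA hB => by
    simp only [Set.mem_ofPred_eq] at *
    rw [transpose_add, hA, hB, neg_add]
  neg_mem' := fun {A} hA => by
    simp only [Set.mem_ofPred_eq] at *
    rw [transpose_neg, hA]

theorem mem_skewMatrices {d : ℕ} {S : Matrix (Fin d) (Fin d) F} :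
    S ∈ skewMatrices F d ↔ Sᵀ = -S := Iff.rfl

theorem skewMatrices_apply_swap {d : ℕ} {S : Matrix (Fin d) (Fin d) F}
    (hS : S ∈ skewMatrices F d) (i j : Fin d) : S j i = -S i j :=
  congrFun (congrFun hS i) j

/-- The dimension of the kernel of a matrix. -/
noncomputable def nullity {d : ℕ} (S : Matrix (Fin d) (Fin d) F) : ℕ :=
  Module.finrank F (LinearMap.ker S.mulVecLin)

theorem nullity_le {d : ℕ} (S : Matrix (Fin d) (Fin d) F) : nullity S ≤ d := by
  simpa [nullity] using Submodule.finrank_le (LinearMap.ker S.mulVecLin)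

/-- The matrix `[[0, v], [-vᵗ, S]]`. -/
def border {d : ℕ} (S : Matrix (Fin d) (Fin d) F) (v : Fin d → F) :
    Matrix (Fin (d + 1)) (Fin (d + 1)) F :=
  Matrix.of (Fin.cons (Fin.cons 0 v) fun i => Fin.cons (-v i) (S i))

theorem border_mem {d : ℕ} {S : Matrix (Fin d) (Fin d) F} (hS : S ∈ skewMatrices F d)
    (v : Fin d → F) : border S v ∈ skewMatrices F (d + 1) := by
  rw [mem_skewMatrices]
  ext i j
  cases i using Fin.cases <;> cases j using Fin.cases
  case succ.succ i j => simpa [border] using skewMatrices_apply_swap hS i j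
  all_goals simp [border]

/-- Over a field of characteristic not two, bordering parametrises skew-symmetric matrices. -/
def borderEquiv (h2 : (2 : F) ≠ 0) (d : ℕ) :
    (skewMatrices F d × (Fin d → F)) ≃ skewMatrices F (d + 1) where
  toFun a := ⟨border a.1.1 a.2, border_mem a.1.2 a.2⟩
  invFun S := (⟨S.1.submatrix Fin.succ Fin.succ, by
    ext i j
    exact skewMatrices_apply_swap S.2 _ _⟩, fun j => S.1 0 j.succ)
  left_inv a := by
    rcases a with ⟨⟨S, hS⟩, v⟩
    rfl
  right_inv S := by
    have hdiag : S.1 0 0 = 0 := by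
      have h := skewMatrices_apply_swap S.2 0 0
      have h' : 2 * S.1 0 0 = 0 := by linear_combination h
      exact (mul_eq_zero.1 h').resolve_left h2
    ext i j
    cases i using Fin.cases <;> cases j using Fin.cases <;>
      simp [border, hdiag, skewMatrices_apply_swap S.2 0]

theorem mem_ker_border {d : ℕ} {S : Matrix (Fin d) (Fin d) F} {v : Fin d → F} {a : F}
    {x : Fin d → F} :
    (Fin.cons a x : Fin (d + 1) → F) ∈ LinearMap.ker (border S v).mulVecLin ↔
      v ⬝ᵥ x = 0 ∧ S *ᵥ x = a • v := by
  rw [LinearMap.mem_ker, mulVecLin_apply, funext_iff, Fin.forall_fin_succ, funext_iff]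
  refine and_congr ?_ (forall_congr' fun i => ?_)
  · simp [mulVec, dotProduct, border, Fin.sum_univ_succ]
  · simp only [mulVec, dotProduct, border, of_apply, Fin.sum_univ_succ, Fin.cons_succ,
      Fin.cons_zero, Pi.zero_apply, Pi.smul_apply, smul_eq_mul]
    constructor <;> intro h <;> linear_combination h

theorem dotProduct_mulVec_skew {d : ℕ} {S : Matrix (Fin d) (Fin d) F}
    (hS : S ∈ skewMatrices F d) (x y : Fin d → F) : (S *ᵥ x) ⬝ᵥ y = -(x ⬝ᵥ (S *ᵥ y)) := by
  rw [dotProduct_mulVec, ← mulVec_transpose, mem_skewMatrices.1 hS, neg_mulVec, neg_dotProduct,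
    neg_neg]

theorem nullity_border_of_mem (h2 : (2 : F) ≠ 0) {d : ℕ} {S : Matrix (Fin d) (Fin d) F}
    (hS : S ∈ skewMatrices F d) {v : Fin d → F} (hv : v ∈ LinearMap.range S.mulVecLin) :
    nullity (border S v) = nullity S + 1 := by
  obtain ⟨u, rfl⟩ := hv
  rw [mulVecLin_apply]
  have huu : (S *ᵥ u) ⬝ᵥ u = 0 := by
    have h := dotProduct_mulVec_skew hS u u
    rw [dotProduct_comm u] at h
    have h' : 2 * ((S *ᵥ u) ⬝ᵥ u) = 0 := by linear_combination h
    exact (mul_eq_zero.1 h').resolve_left h2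
  let e : (F × LinearMap.ker S.mulVecLin) ≃ₗ[F]
      LinearMap.ker (border S (S *ᵥ u)).mulVecLin :=
    { toFun := fun p => ⟨Fin.cons p.1 (p.2.1 + p.1 • u), by
        have hp : S *ᵥ p.2.1 = 0 := p.2.2
        rw [mem_ker_border, dotProduct_add, dotProduct_smul, huu, dotProduct_mulVec_skew hS, hp,
          mulVec_add, mulVec_smul, hp]
        simp⟩
      invFun := fun w => (w.1 0, ⟨Fin.tail w.1 - w.1 0 • u, by
        have hw := w.2
        rw [← Fin.cons_self_tail w.1, mem_ker_border] at hw
        rw [LinearMap.mem_ker, mulVecLin_apply, mulVec_sub, mulVec_smul, hw.2, sub_self]⟩)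
      map_add' := fun p p' => by
        ext i
        cases i using Fin.cases <;> simp [add_mul]
        ring
      map_smul' := fun a p => by
        ext i
        cases i using Fin.cases <;> simp [mul_add, mul_assoc]
      left_inv := fun p => by
        ext <;> simp
      right_inv := fun w => by
        ext i
        cases i using Fin.cases <;> simp [Fin.tail] }
  rw [nullity, ← e.finrank_eq, Module.finrank_prod, Module.finrank_self, add_comm, nullity]

theorem exists_mem_ker_dotProduct_ne_zero {d : ℕ} {S : Matrix (Fin d) (Fin d) F}
    (hS : S ∈ skewMatrices F d) {v : Fin d → F} (hv : v ∉ LinearMap.range S.mulVecLin) :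
    ∃ x, S *ᵥ x = 0 ∧ v ⬝ᵥ x ≠ 0 := by
  by_contra! hall
  have hmem : dotProductEquiv F (Fin d) v ∈ (LinearMap.ker S.mulVecLin).dualAnnihilator := by
    rw [Submodule.mem_dualAnnihilator]
    intro x hx
    exact hall x hx
  rw [← LinearMap.range_dualMap_eq_dualAnnihilator_ker] at hmem
  obtain ⟨g, hg⟩ := hmem
  obtain ⟨w, rfl⟩ := (dotProductEquiv F (Fin d)).surjective g
  refine hv ⟨-w, ?_⟩
  refine dotProduct_eq _ _ fun x => ?_
  have hx := LinearMap.congr_fun hg x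
  simp only [LinearMap.dualMap_apply, dotProductEquiv_apply_apply, mulVecLin_apply] at hx
  rw [mulVecLin_apply, dotProduct_mulVec_skew hS, neg_dotProduct, neg_neg, hx]

theorem nullity_border_of_notMem {d : ℕ} {S : Matrix (Fin d) (Fin d) F}
    (hS : S ∈ skewMatrices F d) {v : Fin d → F} (hv : v ∉ LinearMap.range S.mulVecLin) :
    nullity (border S v) + 1 = nullity S := by
  let f : LinearMap.ker S.mulVecLin →ₗ[F] F :=
    (dotProductEquiv F (Fin d) v).comp (LinearMap.ker S.mulVecLin).subtype
  have hf : ∀ x, f x = v ⬝ᵥ x.1 := fun x => rfl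
  have hrange : LinearMap.range f = ⊤ := by
    obtain ⟨x, hx, hvx⟩ := exists_mem_ker_dotProduct_ne_zero hS hv
    refine LinearMap.range_eq_top.2 fun a => ⟨(a / (v ⬝ᵥ x)) • ⟨x, hx⟩, ?_⟩
    rw [map_smul, hf, smul_eq_mul, div_mul_cancel₀ _ hvx]
  have hzero : ∀ w ∈ LinearMap.ker (border S v).mulVecLin, w 0 = 0 := by
    intro w hw
    rw [← Fin.cons_self_tail w, mem_ker_border] at hw
    by_contra hne
    exact hv ⟨(w 0)⁻¹ • Fin.tail w, by
      rw [mulVecLin_apply, mulVec_smul, hw.2, smul_smul, inv_mul_cancel₀ hne, one_smul]⟩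
  let e : LinearMap.ker f ≃ₗ[F] LinearMap.ker (border S v).mulVecLin :=
    { toFun := fun p => ⟨Fin.cons 0 p.1.1, by
        rw [mem_ker_border, zero_smul]
        exact ⟨p.2, p.1.2⟩⟩
      invFun := fun w => ⟨⟨Fin.tail w.1, by
          have hw := w.2
          rw [← Fin.cons_self_tail w.1, mem_ker_border, hzero _ w.2, zero_smul] at hw
          exact hw.2⟩, by
        have hw := w.2
        rw [← Fin.cons_self_tail w.1, mem_ker_border] at hw
        exact hw.1⟩
      map_add' := fun p p' => by
        ext i
        cases i using Fin.cases <;> simp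
      map_smul' := fun a p => by
        ext i
        cases i using Fin.cases <;> simp
      left_inv := fun p => by
        ext; simp
      right_inv := fun w => by
        ext i
        cases i using Fin.cases <;> simp [Fin.tail, hzero _ w.2] }
  have hsum := f.finrank_range_add_finrank_ker
  rw [hrange, finrank_top, Module.finrank_self, e.finrank_eq] at hsum
  rw [nullity, nullity, ← hsum, add_comm]

variable [Fintype F]

open Classical in
theorem card_range_mulVecLin {d : ℕ} (S : Matrix (Fin d) (Fin d) F) :
    (Finset.univ.filter (· ∈ LinearMap.range S.mulVecLin)).card =
      Fintype.card F ^ (d - nullity S) := by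
  have hsum := S.mulVecLin.finrank_range_add_finrank_ker
  rw [Module.finrank_fin_fun] at hsum
  rw [← Fintype.card_subtype, nullity, ← Nat.eq_sub_of_add_eq hsum]
  exact Module.card_eq_pow_finrank

/-- The polynomial in `q - 1` counting skew-symmetric `d×d` matrices with nullity `k`. -/
noncomputable def skewPoly : ℕ → ℕ → Polynomial ℕ
  | 0, k => if k = 0 then 1 else 0
  | d + 1, k =>
    (if k = 0 then 0 else (1 + Polynomial.X) ^ (d - (k - 1)) * skewPoly d (k - 1)) +
      (1 + Polynomial.X) ^ (d - (k + 1)) *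
        (∑ i ∈ Finset.range (k + 1), Polynomial.X * (1 + Polynomial.X) ^ i) * skewPoly d (k + 1)

open Classical in
theorem sum_border_nullity (h2 : (2 : F) ≠ 0) {d : ℕ} (k : ℕ) {S : Matrix (Fin d) (Fin d) F}
    (hS : S ∈ skewMatrices F d) :
    (∑ v : Fin d → F, if nullity (border S v) = k then 1 else 0) =
      (if k = 0 then 0 else
        Fintype.card F ^ (d - (k - 1)) * if nullity S = k - 1 then 1 else 0) +
      Fintype.card F ^ (d - (k + 1)) *
        (∑ i ∈ Finset.range (k + 1), (Fintype.card F - 1) * Fintype.card F ^ i) *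
          if nullity S = k + 1 then 1 else 0 := by
  have hq : 1 ≤ Fintype.card F := Fintype.card_pos
  have hle := nullity_le S
  have hsplit : ∀ v : Fin d → F, (if nullity (border S v) = k then 1 else 0) =
      if v ∈ LinearMap.range S.mulVecLin then (if nullity S + 1 = k then 1 else 0)
      else (if nullity S = k + 1 then 1 else 0) := by
    intro v
    by_cases hv : v ∈ LinearMap.range S.mulVecLin
    · rw [if_pos hv, nullity_border_of_mem h2 hS hv]
    · rw [if_neg hv, ← nullity_border_of_notMem hS hv]
      simp
  rw [Finset.sum_congr rfl fun v _ => hsplit v, Finset.sum_ite, Finset.sum_const,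
    Finset.sum_const, card_range_mulVecLin, smul_eq_mul, smul_eq_mul]
  congr 1
  · rcases k with _ | k
    · simp
    · by_cases hk : nullity S = k
      · simp [hk]
      · simp [hk]
  · by_cases hk : nullity S = k + 1
    · simp only [hk, if_true, mul_one]
      have hcompl := Finset.card_filter_add_card_filter_not (s := (Finset.univ : Finset (Fin d → F)))
        (· ∈ LinearMap.range S.mulVecLin)
      rw [card_range_mulVecLin, hk, Finset.card_univ, Fintype.card_fun, Fintype.card_fin] at hcompl
      have hgeom : (∑ i ∈ Finset.range (k + 1), (Fintype.card F - 1) * Fintype.card F ^ i) + 1 =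
          Fintype.card F ^ (k + 1) := by
        have hgeom' := geom_sum_mul_add (Fintype.card F - 1) (k + 1)
        rw [Nat.sub_add_cancel hq] at hgeom'
        rw [← Finset.mul_sum, mul_comm, hgeom']
      have hpow : Fintype.card F ^ d =
          Fintype.card F ^ (d - (k + 1)) * Fintype.card F ^ (k + 1) := by
        rw [← pow_add, Nat.sub_add_cancel (hk ▸ hle)]
      rw [hpow, ← hgeom, mul_add, mul_one, add_comm] at hcompl
      exact Nat.add_right_cancel hcompl
    · simp [hk]

open Classical in
/-- The number of skew-symmetric matrices of given nullity is a polynomial in `q - 1`. -/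
theorem card_skew_nullity (h2 : (2 : F) ≠ 0) (d k : ℕ) :
    (∑ S : skewMatrices F d, if nullity S.1 = k then 1 else 0) =
      (skewPoly d k).eval (Fintype.card F - 1) := by
  have hq : 1 + (Fintype.card F - 1) = Fintype.card F :=
    Nat.add_sub_cancel' Fintype.card_pos
  induction d generalizing k with
  | zero =>
    have hnull : ∀ S : Matrix (Fin 0) (Fin 0) F, nullity S = 0 := fun S =>
      Nat.le_zero.1 (nullity_le S)
    have : Unique (skewMatrices F 0) := ⟨⟨0⟩, fun a => Subtype.ext (Subsingleton.elim _ _)⟩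
    rw [Fintype.sum_unique, hnull, skewPoly]
    rcases k with _ | k <;> simp
  | succ d ih =>
    rw [← (borderEquiv h2 d).sum_comp, Fintype.sum_prod_type]
    have hinner : ∀ S : skewMatrices F d, _ := fun S => sum_border_nullity h2 k S.2
    refine (Finset.sum_congr rfl fun S _ => hinner S).trans ?_
    rw [Finset.sum_add_distrib, ← Finset.mul_sum, ih, skewPoly, Polynomial.eval_add]
    congr 1
    · split_ifs
      · simp
      · rw [← Finset.mul_sum, ih]
        simp [hq]
    · simp [Polynomial.eval_finsetSum, hq]

end SkewCount

section Commutator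

variable {F : Type} [Field F] {d m : ℕ}

/-- The alternating form `(A₁, B₁), (A₂, B₂) ↦ B₂A₁ᵗ - A₁B₂ᵗ + A₂B₁ᵗ - B₁A₂ᵗ` with values in
skew-symmetric matrices. -/
def skewForm (F : Type) [Field F] (d m : ℕ) :
    (Matrix (Fin d) (Fin m) F × Matrix (Fin d) (Fin m) F) →+
      (Matrix (Fin d) (Fin m) F × Matrix (Fin d) (Fin m) F) →+ skewMatrices F d :=
  AddMonoidHom.mk' (fun a => AddMonoidHom.mk'
    (fun b => ⟨b.2 * a.1ᵀ - a.1 * b.2ᵀ + (b.1 * a.2ᵀ - a.2 * b.1ᵀ), by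
      rw [mem_skewMatrices]
      simp only [transpose_add, transpose_sub, transpose_mul, transpose_transpose]
      abel⟩)
    (fun b c => by
      ext : 1
      simp only [Prod.fst_add, Prod.snd_add, transpose_add, Matrix.mul_add, Matrix.add_mul,
        AddSubgroup.coe_add]
      abel))
    (fun a b => by
      ext c : 2
      simp only [AddMonoidHom.mk'_apply, AddMonoidHom.add_apply, Prod.fst_add, Prod.snd_add,
        transpose_add, Matrix.mul_add, Matrix.add_mul, AddSubgroup.coe_add]
      abel)

theorem coe_skewForm (a b : Matrix (Fin d) (Fin m) F × Matrix (Fin d) (Fin m) F) :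
    (skewForm F d m a b : Matrix (Fin d) (Fin d) F) =
      b.2 * a.1ᵀ - a.1 * b.2ᵀ + (b.1 * a.2ᵀ - a.2 * b.1ᵀ) := rfl

theorem trace_skew_mul {S : Matrix (Fin d) (Fin d) F} (hS : S ∈ skewMatrices F d)
    (A B : Matrix (Fin d) (Fin m) F) :
    trace (S * (B * Aᵀ - A * Bᵀ)) = -2 * trace (S * A * Bᵀ) := by
  have h : trace (S * (B * Aᵀ)) = -trace (S * (A * Bᵀ)) := by
    rw [← trace_transpose, transpose_mul, transpose_mul, transpose_transpose,
      mem_skewMatrices.1 hS, mul_neg, trace_neg, trace_mul_comm]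
  rw [mul_sub, trace_sub, h, Matrix.mul_assoc]
  ring

theorem trace_mul_skewForm {S : Matrix (Fin d) (Fin d) F} (hS : S ∈ skewMatrices F d)
    (a b : Matrix (Fin d) (Fin m) F × Matrix (Fin d) (Fin m) F) :
    trace (S * (skewForm F d m a b : Matrix (Fin d) (Fin d) F)) =
      -2 * (trace (S * a.1 * b.2ᵀ) + trace (S * a.2 * b.1ᵀ)) := by
  rw [coe_skewForm, mul_add, trace_add, trace_skew_mul hS, trace_skew_mul hS]
  ring

theorem trace_mul_transpose_single {m' : ℕ} (M : Matrix (Fin d) (Fin m') F) (i : Fin d)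
    (j : Fin m') (a : F) : trace (M * (Matrix.single i j a)ᵀ) = M i j * a := by
  rw [transpose_single, trace_mul_single]
  simp

variable [Fintype F]

omit [Fintype F] in
theorem eq_zero_of_primitive {ψ : AddChar F ℂ} (hψ : ψ.IsPrimitive) {t : F}
    (h : ∀ a, ψ (t * a) = 1) : t = 0 := by
  by_contra ht
  exact hψ ht (DFunLike.ext _ _ fun a => by simpa using h a)

/-- The character `C ↦ ψ (tr (S C))` of the group of skew-symmetric matrices. -/
def traceChar (ψ : AddChar F ℂ) (S : skewMatrices F d) : AddChar (skewMatrices F d) ℂ where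
  toFun C := ψ (trace (S.1 * C.1))
  map_zero_eq_one' := by simp
  map_add_eq_mul' A B := by
    simp [mul_add, trace_add, AddChar.map_add_eq_mul]

omit [Fintype F] in
theorem traceChar_apply (ψ : AddChar F ℂ) (S C : skewMatrices F d) :
    traceChar ψ S C = ψ (trace (S.1 * C.1)) := rfl

theorem traceChar_bijective (h2 : (2 : F) ≠ 0) {ψ : AddChar F ℂ} (hψ : ψ.IsPrimitive) :
    Function.Bijective (traceChar ψ : skewMatrices F d → AddChar (skewMatrices F d) ℂ) := by
  classical
  rw [Fintype.bijective_iff_injective_and_card]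
  refine ⟨fun S T hST => ?_, AddChar.card_eq.symm⟩
  rw [← sub_eq_zero]
  have hsub : ∀ C : skewMatrices F d, ψ (trace ((S - T : skewMatrices F d).1 * C.1)) = 1 := by
    intro C
    have h := DFunLike.congr_fun hST C
    rw [traceChar_apply, traceChar_apply] at h
    rw [AddSubgroup.coe_sub, sub_mul, trace_sub, AddChar.map_sub_eq_div, h,
      div_self (ψ.val_isUnit _).ne_zero]
  generalize S - T = R at hsub
  ext i j
  have hR : (-2) * R.1 i j = 0 := eq_zero_of_primitive hψ fun a => by
    rw [← hsub ⟨(Matrix.single i j a) - (Matrix.single i j a)ᵀ, by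
      rw [mem_skewMatrices]; simp⟩]
    simp only [mul_sub, trace_sub, trace_mul_transpose_single, trace_mul_single]
    rw [skewMatrices_apply_swap R.2 i j]
    congr 1
    simp
    ring
  simpa [h2] using hR

omit [Fintype F] in
theorem mem_radical_traceChar (h2 : (2 : F) ≠ 0) {ψ : AddChar F ℂ} (hψ : ψ.IsPrimitive)
    (S : skewMatrices F d) (a : Matrix (Fin d) (Fin m) F × Matrix (Fin d) (Fin m) F) :
    a ∈ radical (skewForm F d m) (traceChar ψ S) ↔ S.1 * a.1 = 0 ∧ S.1 * a.2 = 0 := by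
  simp only [mem_radical, traceChar_apply, trace_mul_skewForm S.2]
  constructor
  · intro h
    constructor
    · ext i j
      have hz : (-2) * (S.1 * a.1) i j = 0 := eq_zero_of_primitive hψ fun t => by
        have ht := h (0, Matrix.single i j t)
        simp only [trace_mul_transpose_single] at ht
        simpa [mul_assoc] using ht
      simpa [h2] using hz
    · ext i j
      have hz : (-2) * (S.1 * a.2) i j = 0 := eq_zero_of_primitive hψ fun t => by
        have ht := h (Matrix.single i j t, 0)
        simp only [trace_mul_transpose_single] at ht
        simpa [mul_assoc] using ht
      simpa [h2] using hz
  · rintro ⟨h1, h2⟩ b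
    simp [h1, h2]

omit [Fintype F] in
theorem mul_eq_zero_iff_col_mem_ker (S : Matrix (Fin d) (Fin d) F)
    (A : Matrix (Fin d) (Fin m) F) :
    S * A = 0 ↔ ∀ j, Aᵀ j ∈ LinearMap.ker S.mulVecLin := by
  simp only [LinearMap.mem_ker, mulVecLin_apply, ← Matrix.ext_iff, funext_iff]
  exact forall_comm

theorem card_annihilated (S : Matrix (Fin d) (Fin d) F) :
    Nat.card {A : Matrix (Fin d) (Fin m) F // S * A = 0} =
      Fintype.card F ^ (m * nullity S) := by
  let e : {A : Matrix (Fin d) (Fin m) F // S * A = 0} ≃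
      (Fin m → LinearMap.ker S.mulVecLin) :=
    { toFun := fun A j => ⟨A.1ᵀ j, (mul_eq_zero_iff_col_mem_ker S A.1).1 A.2 j⟩
      invFun := fun f => ⟨Matrix.of fun i j => (f j).1 i,
        (mul_eq_zero_iff_col_mem_ker S _).2 fun j => (f j).2⟩
      left_inv := fun A => rfl
      right_inv := fun f => rfl }
  rw [Nat.card_congr e, Nat.card_fun, Module.natCard_eq_pow_finrank (K := F), ← pow_mul,
    Nat.card_fin, Nat.card_eq_fintype_card, mul_comm, nullity]

theorem card_radical_traceChar (h2 : (2 : F) ≠ 0) {ψ : AddChar F ℂ} (hψ : ψ.IsPrimitive)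
    (S : skewMatrices F d) :
    Nat.card (radical (skewForm F d m) (traceChar ψ S)) =
      Fintype.card F ^ (2 * (m * nullity S.1)) := by
  let e : radical (skewForm F d m) (traceChar ψ S) ≃
      {A : Matrix (Fin d) (Fin m) F // S.1 * A = 0} ×
        {A : Matrix (Fin d) (Fin m) F // S.1 * A = 0} :=
    (Equiv.subtypeEquivRight (mem_radical_traceChar h2 hψ S)).trans
      (Equiv.subtypeProdEquivProd (p := fun A : Matrix (Fin d) (Fin m) F => S.1 * A = 0)
        (q := fun A : Matrix (Fin d) (Fin m) F => S.1 * A = 0))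
  rw [Nat.card_congr e, Nat.card_prod, card_annihilated, ← pow_add, two_mul]

end Commutator

section Coordinates

variable {F : Type} [Field F] {n d : ℕ}

theorem inv_transpose_Umat (A : Matrix (Fin d) (Fin (n - d)) F) :
    ((Umat F n d A)ᵀ)⁻¹ = fromBlocks 1 0 (-Aᵀ) 1 := by
  refine inv_eq_right_inv ?_
  simp [Umat, fromBlocks_transpose, fromBlocks_multiply]

/-- The element of the unipotent radical with given coordinates, as a matrix. -/
def coordMatrix (a : (Matrix (Fin d) (Fin (n - d)) F × Matrix (Fin d) (Fin (n - d)) F) ×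
    skewMatrices F d) : Matrix (κ n d) (κ n d) F :=
  fromBlocks (fromBlocks 1 (a.1.1 + a.1.1) 0 1)
    (fromBlocks (a.2.1 - (a.1.1 * a.1.2ᵀ + a.1.2 * a.1.1ᵀ)) a.1.2 (-a.1.2ᵀ) 0) 0
    (fromBlocks 1 0 (-(a.1.1 + a.1.1)ᵀ) 1)

theorem coordMatrix_mul
    (a b : (Matrix (Fin d) (Fin (n - d)) F × Matrix (Fin d) (Fin (n - d)) F) ×
      skewMatrices F d) :
    coordMatrix a * coordMatrix b =
      coordMatrix (n := n) (a.1 + b.1, a.2 + b.2 + skewForm F d (n - d) a.1 b.1) := by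
  simp only [coordMatrix, fromBlocks_multiply, fromBlocks_add, Matrix.mul_zero, Matrix.zero_mul,
    Matrix.one_mul, Matrix.mul_one, add_zero, zero_add, Prod.fst_add, Prod.snd_add,
    AddSubgroup.coe_add, coe_skewForm, transpose_add, Matrix.mul_add, Matrix.add_mul,
    Matrix.mul_neg, neg_zero, fromBlocks_inj, true_and, and_true]
  refine ⟨?_, ⟨?_, ?_, ?_⟩, ?_⟩
  all_goals abel

theorem coordMatrix_zero : coordMatrix (F := F) (n := n) (d := d) 0 = 1 := by
  simp [coordMatrix]

theorem coordMatrix_injective (h2 : (2 : F) ≠ 0) :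
    Function.Injective (coordMatrix (F := F) (n := n) (d := d)) := by
  rintro ⟨⟨A, B⟩, C⟩ ⟨⟨A', B'⟩, C'⟩ h
  simp only [coordMatrix, fromBlocks_inj] at h
  obtain ⟨⟨-, hA, -, -⟩, ⟨hC, rfl, -, -⟩, -, -⟩ := h
  obtain rfl : A = A' := by
    rw [← two_smul F, ← two_smul F] at hA
    exact smul_right_injective _ h2 hA
  obtain rfl : C = C' := Subtype.ext (sub_left_injective hC)
  rfl

theorem skew_fromBlocks_mul_inv (A B : Matrix (Fin d) (Fin (n - d)) F)
    (C : Matrix (Fin d) (Fin d) F) :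
    (fromBlocks C B (-Bᵀ) 0 : Matrix (ι n d) (ι n d) F) * ((Umat F n d A)ᵀ)⁻¹ =
      fromBlocks (C - B * Aᵀ) B (-Bᵀ) 0 := by
  rw [inv_transpose_Umat, fromBlocks_multiply]
  simp [sub_eq_add_neg]

theorem fromBlocks_mem_Kd (B : Matrix (Fin d) (Fin (n - d)) F) {C : Matrix (Fin d) (Fin d) F}
    (hC : C ∈ skewMatrices F d) : fromBlocks C B (-Bᵀ) 0 ∈ Kd F n d := by
  refine ⟨?_, fun i j => rfl⟩
  rw [fromBlocks_transpose, fromBlocks_neg, mem_skewMatrices.1 hC]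
  simp

theorem eq_fromBlocks_of_mem_Kd {V : Matrix (ι n d) (ι n d) F} (hV : V ∈ Kd F n d) :
    ∃ C ∈ skewMatrices F d, ∃ B, V = fromBlocks C B (-Bᵀ) 0 := by
  refine ⟨V.toBlocks₁₁, ?_, V.toBlocks₁₂, ?_⟩
  · ext i j
    exact congrFun (congrFun hV.1 (Sum.inl i)) (Sum.inl j)
  · conv_lhs => rw [← fromBlocks_toBlocks V]
    rw [fromBlocks_inj]
    refine ⟨rfl, rfl, ?_, ?_⟩
    · ext i j
      exact congrFun (congrFun hV.1 (Sum.inl j)) (Sum.inr i) |>.symm ▸ by simp [toBlocks₂₁]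
    · ext i j
      exact hV.2 i j

theorem coordMatrix_mem
    (a : (Matrix (Fin d) (Fin (n - d)) F × Matrix (Fin d) (Fin (n - d)) F) ×
      skewMatrices F d) : coordMatrix a ∈ RuD F n d := by
  obtain ⟨⟨A, B⟩, C⟩ := a
  refine ⟨A + A, fromBlocks (C.1 + (B * Aᵀ - A * Bᵀ)) B (-Bᵀ) 0, fromBlocks_mem_Kd B ?_, ?_⟩
  · refine add_mem C.2 ?_
    rw [mem_skewMatrices]
    simp
  · rw [skew_fromBlocks_mul_inv, inv_transpose_Umat, coordMatrix, Umat]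
    simp only [fromBlocks_inj, transpose_add, Matrix.mul_add, and_true, true_and]
    abel

theorem exists_coordMatrix_eq (h2 : (2 : F) ≠ 0) {g : Matrix (κ n d) (κ n d) F}
    (hg : g ∈ RuD F n d) : ∃ a, coordMatrix a = g := by
  obtain ⟨A, V, hV, rfl⟩ := hg
  obtain ⟨C, hC, B, rfl⟩ := eq_fromBlocks_of_mem_Kd hV
  obtain ⟨A, rfl⟩ : ∃ A', A = A' + A' := ⟨(2⁻¹ : F) • A, by
    rw [← two_smul F, smul_smul, mul_inv_cancel₀ h2, one_smul]⟩
  refine ⟨((A, B), ⟨C - (B * Aᵀ - A * Bᵀ), sub_mem hC ?_⟩), ?_⟩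
  · rw [mem_skewMatrices]
    simp
  · rw [skew_fromBlocks_mul_inv, inv_transpose_Umat, coordMatrix, Umat]
    simp only [fromBlocks_inj, transpose_add, Matrix.mul_add, and_true, true_and]
    abel

/-- The element of the unipotent radical with given coordinates, as a unit. -/
def coordUnit (a : (Matrix (Fin d) (Fin (n - d)) F × Matrix (Fin d) (Fin (n - d)) F) ×
    skewMatrices F d) : (Matrix (κ n d) (κ n d) F)ˣ where
  val := coordMatrix a
  inv := coordMatrix (-a)
  val_inv := by
    rw [coordMatrix_mul, ← coordMatrix_zero]
    congr 1
    ext : 2 <;> simp [coe_skewForm]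
  inv_val := by
    rw [coordMatrix_mul, ← coordMatrix_zero]
    congr 1
    ext : 2 <;> simp [coe_skewForm]

/-- The unipotent radical is a Heisenberg-type group. -/
noncomputable def heisenbergCoord (h2 : (2 : F) ≠ 0)
    (G : Subgroup (Matrix (κ n d) (κ n d) F)ˣ)
    (hG : ∀ u : (Matrix (κ n d) (κ n d) F)ˣ,
      u ∈ G ↔ (u : Matrix (κ n d) (κ n d) F) ∈ RuD F n d) :
    HeisenbergCoord G (skewForm F d (n - d)) where
  toEquiv := Equiv.ofBijective (fun a => ⟨coordUnit a, (hG _).2 (coordMatrix_mem a)⟩) (by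
    refine ⟨fun a b h => coordMatrix_injective h2 ?_, fun g => ?_⟩
    · exact congrArg (fun g : G => (g.1.val : Matrix (κ n d) (κ n d) F)) h
    · obtain ⟨a, ha⟩ := exists_coordMatrix_eq h2 ((hG g).1 g.2)
      exact ⟨a, Subtype.ext (Units.ext ha)⟩)
  alternating a := by
    ext : 1
    rw [coe_skewForm, AddSubgroup.coe_zero]
    abel
  mul_apply a b := Subtype.ext (Units.ext (coordMatrix_mul a b))

end Coordinates

theorem two_ne_zero_of_card {F : Type} [Field F] [Fintype F] (hF : Odd (Fintype.card F)) :
    (2 : F) ≠ 0 := by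
  refine Ring.two_ne_zero fun h => ?_
  have heven := FiniteField.even_card_iff_char_two.1 h
  rw [Nat.odd_iff] at hF
  omega

/-- The polynomial in `q - 1` counting irreducible characters of degree `q ^ e` of the unipotent
radical with `d×m` blocks. -/
noncomputable def charCountPoly (d m e : ℕ) : Polynomial ℕ :=
  ∑ k ∈ Finset.range (d + 1),
    if e + m * k = d * m then (1 + Polynomial.X) ^ (2 * (m * k)) * skewPoly d k else 0

theorem sum_skewMatrices_eq_eval {F : Type} [Field F] [Fintype F] (h2 : (2 : F) ≠ 0)
    (d m e : ℕ) [Fintype (skewMatrices F d)] :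
    (∑ S : skewMatrices F d, if e + m * nullity S.1 = d * m
        then Fintype.card F ^ (2 * (m * nullity S.1)) else 0) =
      (charCountPoly d m e).eval (Fintype.card F - 1) := by
  classical
  have hq : 1 + (Fintype.card F - 1) = Fintype.card F :=
    Nat.add_sub_cancel' Fintype.card_pos
  have hsplit : ∀ S : skewMatrices F d, (if e + m * nullity S.1 = d * m
      then Fintype.card F ^ (2 * (m * nullity S.1)) else 0) =
      ∑ k ∈ Finset.range (d + 1),
        (if e + m * k = d * m then Fintype.card F ^ (2 * (m * k)) else 0) *
          if nullity S.1 = k then 1 else 0 := by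
    intro S
    have hmem : nullity S.1 ∈ Finset.range (d + 1) :=
      Finset.mem_range.2 (Nat.lt_succ_of_le (nullity_le S.1))
    simp [hmem]
  rw [Finset.sum_congr rfl fun S _ => hsplit S, Finset.sum_comm, charCountPoly,
    Polynomial.eval_finsetSum]
  refine Finset.sum_congr rfl fun k _ => ?_
  rw [← Finset.mul_sum]
  have hcount := card_skew_nullity h2 d k
  split_ifs
  · rw [Polynomial.eval_mul, ← hcount]
    simp only [Polynomial.eval_pow, Polynomial.eval_add, Polynomial.eval_one, Polynomial.eval_X, hq]
    congr!
  · simp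

/-- for fixed `n, d, e`, there is a polynomial `P` with non-negative integer
coefficients such that for every power `q` of an odd prime, the number of irreducible
characters of `R_u^{D,d}` over `F_q` of degree `q^e` equals `P(q−1)`. -/
theorem ruD_char_count_polynomial
    (n d e : ℕ) (hd : 1 ≤ d) (hdn : d < n - 1) :
    ∃ P : Polynomial ℕ, ∀ (p k q : ℕ), p.Prime → Odd p → 1 ≤ k → q = p ^ k →
      ∀ (F : Type) [Field F] [Fintype F], Fintype.card F = q →
      ∀ (G : Subgroup (Matrix (κ n d) (κ n d) F)ˣ),
        (∀ u : (Matrix (κ n d) (κ n d) F)ˣ,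
          u ∈ G ↔ (u : Matrix (κ n d) (κ n d) F) ∈ RuD F n d) →
        Nat.card {χ : ↥G → ℂ |
            (∃ V : FDRep ℂ ↥G, CategoryTheory.Simple V ∧ FDRep.character V = χ) ∧
            χ 1 = (q : ℂ) ^ e} = P.eval (q - 1) := by
  refine ⟨charCountPoly d (n - d) e, ?_⟩
  intro p k q hp hodd hk hq F _ _ hF G hG
  classical
  have h2 : (2 : F) ≠ 0 := two_ne_zero_of_card (by rw [hF, hq]; exact hodd.pow)
  have hψ := AddChar.FiniteField.primitiveChar_to_Complex_isPrimitive F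
  have hq1 : 1 < q := hF ▸ Fintype.one_lt_card
  have hdouble : ∀ x : Matrix (Fin d) (Fin (n - d)) F × Matrix (Fin d) (Fin (n - d)) F,
      ∃ y, y + y = x := fun x => ⟨(2⁻¹ : F) • x, by
    rw [← two_smul F, smul_smul, mul_inv_cancel₀ h2, one_smul]⟩
  have hcount := (heisenbergCoord h2 G hG).card_irreducible_characters hdouble (q ^ e)
    (pow_pos (by omega) e).ne'
  rw [Nat.cast_pow] at hcount
  rw [hcount, ← (Equiv.ofBijective _ (traceChar_bijective h2 hψ)).sum_comp, ← hF,
    ← sum_skewMatrices_eq_eval h2]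
  refine Finset.sum_congr rfl fun S _ => ?_
  rw [Equiv.ofBijective_apply, card_radical_traceChar h2 hψ]
  have hX : Nat.card (Matrix (Fin d) (Fin (n - d)) F × Matrix (Fin d) (Fin (n - d)) F) =
      Fintype.card F ^ (2 * (d * (n - d))) := by
    rw [Module.natCard_eq_pow_finrank (K := F), Nat.card_eq_fintype_card, Module.finrank_prod,
      Module.finrank_matrix]
    simp [two_mul]
  refine if_congr ?_ rfl rfl
  rw [hX, ← pow_mul, ← pow_add, Nat.pow_right_inj (hF ▸ hq1)]
  omega

end SOUnipotentRadical
end
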